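/- Let R be a Gorenstein local ring of dimension d, and let I be an R-ideal of height g ≥ 1 and analytic spread ℓ. Assume I satisfies condition G_{ℓ+1} and depth(I^j) ≥ d − g − j + 2 for 1 ≤ j ≤ ℓ − g. Then I is of linear type (the natural surjection S(I) → R(I) from the symmetric algebra to the Rees algebra is an isomorphism) and the Rees algebra R(I) is Cohen-Macaulay. -/

import Mathlib

open scoped TensorProduct

noncomputable section

universe u

section Defs
variable (R : Type u) [CommRing R]

/-- The total ring of fractions of `R`. -/
abbrev TotalQuot := Localization (nonZeroDivisors R)

/-- `E` has rank `e`: `E ⊗_R Quot(R)` is free of rank `e` over the total quotient ring. -/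
def HasRank (E : Type u) [AddCommGroup E] [Module R E] (e : ℕ) : Prop :=
  Nonempty ((TotalQuot R ⊗[R] E) ≃ₗ[TotalQuot R] (Fin e → TotalQuot R))

/-- Complement of a prime ideal, with the primality hypothesis explicit. -/
def primeCompl' (p : Ideal R) (hp : p.IsPrime) : Submonoid R :=
  @Ideal.primeCompl R _ p hp

/-- Minimal number of generators of a module. -/
def minGens (E : Type u) [AddCommGroup E] [Module R E] : ℕ :=
  sInf {n | ∃ f : Fin n → E, Submodule.span R (Set.range f) = ⊤}

/-- The grade of an ideal `I` on a module `M`: supremum of lengths of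
`M`-regular sequences contained in `I`. -/
def sequenceGrade (I : Ideal R) (M : Type u) [AddCommGroup M] [Module R M] : ℕ∞ :=
  sSup {n : ℕ∞ | ∃ rs : List R, (rs.length : ℕ∞) = n ∧ (∀ r ∈ rs, r ∈ I) ∧
    RingTheory.Sequence.IsRegular M rs}

/-- Depth of a module over a local ring. -/
def moduleDepth [IsLocalRing R] (M : Type u) [AddCommGroup M] [Module R M] : ℕ∞ :=
  sequenceGrade R (IsLocalRing.maximalIdeal R) M

/-- The grade of a module: grade of its annihilator on `R`. -/
def moduleGrade (M : Type u) [AddCommGroup M] [Module R M] : ℕ∞ :=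
  sequenceGrade R (Module.annihilator R M) R

/-- Dimension of a module: Krull dimension of `R` modulo the annihilator. -/
def moduleDim (M : Type u) [AddCommGroup M] [Module R M] : WithBot ℕ∞ :=
  ringKrullDim (R ⧸ Module.annihilator R M)

/-- Krull dimension of the localization `R_p`. -/
def localDimAt (p : Ideal R) (hp : p.IsPrime) : WithBot ℕ∞ :=
  ringKrullDim (Localization (primeCompl' R p hp))

/-- Height of an ideal: infimum of `dim R_p` over primes `p ⊇ I`. -/
def idealHeight (I : Ideal R) : WithBot ℕ∞ :=
  sInf {d | ∃ (p : Ideal R) (hp : p.IsPrime), I ≤ p ∧ d = localDimAt R p hp}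

/-- A local ring is Cohen-Macaulay if its depth equals its dimension. -/
def IsCMLocalRing [IsLocalRing R] : Prop :=
  (moduleDepth R R : WithBot ℕ∞) = ringKrullDim R

/-- A ring is Cohen-Macaulay if all its localizations at maximal ideals are. -/
def IsCMRing : Prop :=
  ∀ (p : Ideal R), ∀ hp : p.IsMaximal,
    letI : p.IsPrime := hp.isPrime
    (moduleDepth (Localization.AtPrime p) (Localization.AtPrime p) : WithBot ℕ∞)
      = ringKrullDim (Localization.AtPrime p)

/-- A finite module over a local ring is Cohen-Macaulay if it is zero or
its depth equals its dimension. -/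
def IsCMModule [IsLocalRing R] (M : Type u) [AddCommGroup M] [Module R M] : Prop :=
  Subsingleton M ∨ (moduleDepth R M : WithBot ℕ∞) = moduleDim R M

open CategoryTheory in
/-- Vanishing of `Ext_R^n(M, N)`. -/
def extVanish (M N : Type u) [AddCommGroup M] [Module R M] [AddCommGroup N] [Module R N]
    (n : ℕ) : Prop :=
  Subsingleton (((Ext R (ModuleCat.{u} R) n).obj (Opposite.op (ModuleCat.of R M))).obj
    (ModuleCat.of R N))

/-- A Noetherian local ring is Gorenstein iff it is Cohen-Macaulay and `R` has finite
injective dimension, i.e. `Ext^i(k, R) = 0` for all large `i`. -/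
def IsGorensteinLocalRing [IsLocalRing R] : Prop :=
  IsCMLocalRing R ∧ ∃ n : ℕ, ∀ i : ℕ, n < i → extVanish R (IsLocalRing.ResidueField R) R i

variable (E : Type u) [AddCommGroup E] [Module R E]

/-- Defining relations of the symmetric algebra, presented as the free commutative
`R`-algebra on `E` modulo linearity relations. -/
def symRels : Set (MvPolynomial E R) :=
  {p | ∃ x y : E, p = MvPolynomial.X (x + y) - MvPolynomial.X x - MvPolynomial.X y} ∪
  {p | ∃ (r : R) (x : E), p = MvPolynomial.X (r • x) - MvPolynomial.C r * MvPolynomial.X x}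

/-- The symmetric algebra of a module. -/
abbrev SymModAlg := MvPolynomial E R ⧸ Ideal.span (symRels R E)

/-- The `R`-torsion ideal of an `R`-algebra `A`. -/
def torsionIdeal (A : Type u) [CommRing A] [Algebra R A] : Ideal A where
  carrier := {a | ∃ r ∈ nonZeroDivisors R, r • a = 0}
  zero_mem' := ⟨1, one_mem _, smul_zero _⟩
  add_mem' := by
    rintro a b ⟨r, hr, ha⟩ ⟨s, hs, hb⟩
    refine ⟨r * s, mul_mem hr hs, ?_⟩
    have h1 : (r * s) • a = 0 := by rw [mul_comm, mul_smul, ha, smul_zero]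
    have h2 : (r * s) • b = 0 := by rw [mul_smul, hb, smul_zero]
    rw [smul_add, h1, h2, add_zero]
  smul_mem' := by
    rintro c a ⟨r, hr, ha⟩
    exact ⟨r, hr, by rw [smul_comm, ha, smul_zero]⟩

/-- The Rees algebra of a module: the symmetric algebra modulo `R`-torsion. -/
abbrev ReesModAlg := SymModAlg R E ⧸ torsionIdeal R (SymModAlg R E)

/-- The canonical map `E → R(E)`. -/
def reesι (x : E) : ReesModAlg R E :=
  Ideal.Quotient.mk _ (Ideal.Quotient.mk _ (MvPolynomial.X x))

/-- The `j`-th power `E^j` of a module: the `j`-th graded component of its Rees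
algebra, i.e. the `R`-span of products of `j` elements of `E`. -/
def reesPower (j : ℕ) : Submodule R (ReesModAlg R E) :=
  Submodule.span R {a | ∃ f : Fin j → E, a = ∏ i, reesι R E (f i)}

/-- A module is of linear type if its symmetric algebra is `R`-torsion-free,
i.e. the natural surjection `S(E) → R(E)` is an isomorphism. -/
def IsLinearType : Prop := torsionIdeal R (SymModAlg R E) = ⊥

/-- The extension of the maximal ideal to the Rees algebra. -/
def fiberIdeal [IsLocalRing R] : Ideal (ReesModAlg R E) :=
  Ideal.map (algebraMap R (ReesModAlg R E)) (IsLocalRing.maximalIdeal R)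

/-- The analytic spread: Krull dimension of the special fiber ring `R(E) ⊗ k`. -/
def analyticSpread [IsLocalRing R] : WithBot ℕ∞ :=
  ringKrullDim (ReesModAlg R E ⧸ fiberIdeal R E)

/-- The submodule `U·E^r` of the Rees algebra. -/
def mulPower (U : Submodule R E) (r : ℕ) : Submodule R (ReesModAlg R E) :=
  Submodule.span R {a | ∃ u ∈ U, ∃ f : Fin r → E, a = reesι R E u * ∏ i, reesι R E (f i)}

/-- `U` is a reduction of `E` if `E^{r+1} = U·E^r` for some `r`. -/
def IsReduction (U : Submodule R E) : Prop :=
  ∃ r : ℕ, reesPower R E (r + 1) = mulPower R E U r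

/-- A minimal reduction. -/
def IsMinimalReduction (U : Submodule R E) : Prop :=
  IsReduction R E U ∧ ∀ U' : Submodule R E, U' ≤ U → IsReduction R E U' → U' = U

/-- The reduction number of a reduction `U`. -/
def reductionNumberOf (U : Submodule R E) : ℕ :=
  sInf {r | reesPower R E (r + 1) = mulPower R E U r}

/-- The reduction number of `E`. -/
def reductionNumber : ℕ :=
  sInf {r | ∃ U : Submodule R E, IsMinimalReduction R E U ∧ reductionNumberOf R E U = r}

/-- The condition `G_s` for a module of rank `e`:
`μ(E_p) ≤ dim R_p + e - 1` for all primes with `1 ≤ dim R_p ≤ s - 1`. -/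
def Gcond (e s : ℕ) : Prop :=
  ∀ (p : Ideal R) (hp : p.IsPrime),
    (1 : WithBot ℕ∞) ≤ localDimAt R p hp → localDimAt R p hp + 1 ≤ (s : WithBot ℕ∞) →
    (minGens (Localization (primeCompl' R p hp)) (LocalizedModule (primeCompl' R p hp) E)
        : WithBot ℕ∞) ≤ localDimAt R p hp + ((e - 1 : ℕ) : WithBot ℕ∞)

/-- The condition `G_∞` for a module of rank `e`. -/
def GcondInf (e : ℕ) : Prop := ∀ s : ℕ, Gcond R E e s

/-- The condition `G_s` for an ideal: `μ(I_p) ≤ dim R_p` for all primes `p ⊇ I`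
with `dim R_p ≤ s - 1`. -/
def GcondIdeal (I : Ideal R) (s : ℕ) : Prop :=
  ∀ (p : Ideal R) (hp : p.IsPrime), I ≤ p → localDimAt R p hp + 1 ≤ (s : WithBot ℕ∞) →
    (minGens (Localization (primeCompl' R p hp)) (LocalizedModule (primeCompl' R p hp) ↥I)
        : WithBot ℕ∞) ≤ localDimAt R p hp

/-- The `0`-th Fitting ideal of a module. -/
def fitting0 (M : Type u) [AddCommGroup M] [Module R M] : Ideal R :=
  ⨆ (n : ℕ) (π : (Fin n → R) →ₗ[R] M) (_ : Function.Surjective π),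
    Ideal.span {d | ∃ A : Matrix (Fin n) (Fin n) R,
      (∀ jc : Fin n, π (fun i => A i jc) = 0) ∧ d = A.det}

end Defs

set_option linter.unusedSectionVars false

-- Part 1
section ExtBasics

open CategoryTheory Abelian

variable {R : Type u} [CommRing R]
variable {A B C M N X : Type u} [AddCommGroup A] [Module R A] [AddCommGroup B] [Module R B]
  [AddCommGroup C] [Module R C] [AddCommGroup M] [Module R M] [AddCommGroup N] [Module R N]
  [AddCommGroup X] [Module R X]

variable (R) in
/-- Ext modules, unbundled. -/
abbrev EE (M N : Type u) [AddCommGroup M] [Module R M] [AddCommGroup N] [Module R N] (n : ℕ) :=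
  Abelian.Ext (ModuleCat.of R M) (ModuleCat.of R N) n

variable (R) in
/-- Vanishing of Ext modules. -/
abbrev XV (M N : Type u) [AddCommGroup M] [Module R M] [AddCommGroup N] [Module R N] (n : ℕ) :
    Prop := Subsingleton (EE R M N n)

/-- Contravariant functoriality. -/
def preE (f : M →ₗ[R] B) (N : Type u) [AddCommGroup N] [Module R N] (n : ℕ) :
    EE R B N n →ₗ[R] EE R M N n where
  toFun x := (Ext.mk₀ (ModuleCat.ofHom f)).comp x (zero_add n)
  map_add' x y := by simp
  map_smul' r x := by simp

/-- Covariant functoriality. -/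
def postE (X : Type u) [AddCommGroup X] [Module R X] (f : M →ₗ[R] B) (n : ℕ) :
    EE R X M n →ₗ[R] EE R X B n where
  toFun x := x.comp (Ext.mk₀ (ModuleCat.ofHom f)) (add_zero n)
  map_add' x y := by simp
  map_smul' r x := by simp

lemma preE_comp (f : A →ₗ[R] B) (g : B →ₗ[R] C) (n : ℕ) (x : EE R C N n) :
    preE (g ∘ₗ f) N n x = preE f N n (preE g N n x) := by
  simp [preE, ModuleCat.ofHom_comp, ← Ext.mk₀_comp_mk₀_assoc]

lemma preE_id (n : ℕ) (x : EE R A N n) : preE (LinearMap.id) N n x = x := by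
  simp [preE]

lemma preE_smul (r : R) (f : A →ₗ[R] B) (n : ℕ) (x : EE R B N n) :
    preE (r • f) N n x = r • preE f N n x := by
  have : ModuleCat.ofHom (r • f) = r • ModuleCat.ofHom f := rfl
  simp only [preE, LinearMap.coe_mk, AddHom.coe_mk, this, Ext.mk₀_smul, Ext.smul_comp]

lemma preE_smul_id (r : R) (n : ℕ) (x : EE R A N n) :
    preE (r • (LinearMap.id : A →ₗ[R] A)) N n x = r • x := by
  rw [preE_smul, preE_id]

lemma preE_zero (n : ℕ) (x : EE R B N n) : preE (0 : A →ₗ[R] B) N n x = 0 := by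
  have : (0 : A →ₗ[R] B) = (0 : R) • 0 := by simp
  rw [this, preE_smul, zero_smul]

lemma postE_comp (f : A →ₗ[R] B) (g : B →ₗ[R] C) (n : ℕ) (x : EE R X A n) :
    postE X (g ∘ₗ f) n x = postE X g n (postE X f n x) := by
  simp [postE, ModuleCat.ofHom_comp, ← Ext.mk₀_comp_mk₀]

lemma postE_id (n : ℕ) (x : EE R X A n) : postE X (LinearMap.id) n x = x := by
  simp [postE]

lemma postE_smul_id (r : R) (n : ℕ) (x : EE R X A n) :
    postE X (r • (LinearMap.id : A →ₗ[R] A)) n x = r • x := by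
  have : ModuleCat.ofHom (r • (LinearMap.id : A →ₗ[R] A)) = r • ModuleCat.ofHom LinearMap.id := rfl
  simp only [postE, LinearMap.coe_mk, AddHom.coe_mk, this, Ext.mk₀_smul, Ext.comp_smul]
  simp

/-- The short complex of an exact sequence of linear maps. -/
def sesC (f : A →ₗ[R] B) (g : B →ₗ[R] C) (he : Function.Exact f g) :
    ShortComplex (ModuleCat.{u} R) :=
  ShortComplex.mk (ModuleCat.ofHom f) (ModuleCat.ofHom g)
    (by rw [← ModuleCat.ofHom_comp, he.linearMap_comp_eq_zero]; rfl)

lemma sesC_exact {f : A →ₗ[R] B} {g : B →ₗ[R] C} (hf : Function.Injective f)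
    (he : Function.Exact f g) (hg : Function.Surjective g) : (sesC f g he).ShortExact := by
  have : Mono (sesC f g he).f := (ModuleCat.mono_iff_injective _).2 hf
  have : Epi (sesC f g he).g := (ModuleCat.epi_iff_surjective _).2 hg
  refine ⟨?_⟩
  rw [ShortComplex.moduleCat_exact_iff]
  intro x hx
  exact (he x).1 hx

section
variable {f : A →ₗ[R] B} {g : B →ₗ[R] C}

/-- Connecting map. -/
def delE (hf : Function.Injective f)
    (he : Function.Exact f g) (hg : Function.Surjective g) (N : Type u) [AddCommGroup N] [Module R N] (n : ℕ) : EE R A N n →ₗ[R] EE R C N (n+1) where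
  toFun x := (sesC_exact hf he hg).extClass.comp x (Nat.add_comm 1 n)
  map_add' _ _ := Ext.comp_add _ _ _ _
  map_smul' _ _ := Ext.comp_smul (X := (sesC f g he).X₃) (Y := (sesC f g he).X₁) _ _ _ _

lemma preE_exact_mid (hf : Function.Injective f)
    (he : Function.Exact f g) (hg : Function.Surjective g) (N : Type u) [AddCommGroup N] [Module R N] (n : ℕ) :
    Function.Exact (preE g N n) (preE f N n) := by
  intro x
  constructor
  · intro hx
    exact Ext.contravariant_sequence_exact₂ (sesC_exact hf he hg) _ x hx
  · rintro ⟨y, rfl⟩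
    rw [← preE_comp, he.linearMap_comp_eq_zero, preE_zero]

lemma preE_exact_left (hf : Function.Injective f)
    (he : Function.Exact f g) (hg : Function.Surjective g) (N : Type u) [AddCommGroup N] [Module R N] (n : ℕ) :
    Function.Exact (preE f N n) (delE hf he hg N n) := by
  intro x
  constructor
  · intro hx
    exact Ext.contravariant_sequence_exact₁ (sesC_exact hf he hg) _ x (Nat.add_comm 1 n) hx
  · rintro ⟨y, rfl⟩
    exact (sesC_exact hf he hg).extClass_comp_assoc _ (h := Nat.add_comm 1 n)

lemma preE_exact_right (hf : Function.Injective f)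
    (he : Function.Exact f g) (hg : Function.Surjective g) (N : Type u) [AddCommGroup N] [Module R N] (n : ℕ) :
    Function.Exact (delE hf he hg N n) (preE g N (n+1)) := by
  intro x
  constructor
  · intro hx
    exact Ext.contravariant_sequence_exact₃ (sesC_exact hf he hg) _ x hx (Nat.add_comm 1 n)
  · rintro ⟨y, rfl⟩
    exact (sesC_exact hf he hg).comp_extClass_assoc _ (Nat.add_comm 1 n)

lemma preE_zero_inj (hg : Function.Surjective g) (N : Type u) [AddCommGroup N] [Module R N] :
    Function.Injective (preE g N 0) := by
  have : Epi (ModuleCat.ofHom g) := (ModuleCat.epi_iff_surjective _).2 hg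
  exact Ext.precomp_mk₀_injective_of_epi _ (ModuleCat.ofHom g)

lemma XV_mid_con (hf : Function.Injective f)
    (he : Function.Exact f g) (hg : Function.Surjective g) {N : Type u} [AddCommGroup N] [Module R N] {n : ℕ}
    (h1 : XV R A N n) (h2 : XV R C N n) : XV R B N n := by
  refine subsingleton_of_forall_eq 0 fun x => ?_
  obtain ⟨y, rfl⟩ := (preE_exact_mid hf he hg N n x).1 (Subsingleton.elim _ _)
  rw [Subsingleton.elim y 0, map_zero]

lemma XV_left_con (hf : Function.Injective f)
    (he : Function.Exact f g) (hg : Function.Surjective g) {N : Type u} [AddCommGroup N] [Module R N] {n : ℕ}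
    (h1 : XV R B N n) (h2 : XV R C N (n+1)) : XV R A N n := by
  refine subsingleton_of_forall_eq 0 fun x => ?_
  obtain ⟨y, rfl⟩ := (preE_exact_left hf he hg N n x).1 (Subsingleton.elim _ _)
  rw [Subsingleton.elim y 0, map_zero]

lemma XV_right_con (hf : Function.Injective f)
    (he : Function.Exact f g) (hg : Function.Surjective g) {N : Type u} [AddCommGroup N] [Module R N] {n : ℕ}
    (h1 : XV R B N (n+1)) (h2 : XV R A N n) : XV R C N (n+1) := by
  refine subsingleton_of_forall_eq 0 fun x => ?_
  obtain ⟨y, rfl⟩ := (preE_exact_right hf he hg N n x).1 (Subsingleton.elim _ _)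
  rw [Subsingleton.elim y 0, map_zero]

lemma XV_right_con0 (hg : Function.Surjective g) {N : Type u} [AddCommGroup N] [Module R N]
    (h1 : XV R B N 0) : XV R C N 0 :=
  (preE_zero_inj hg N).subsingleton

lemma postE_exact_mid (hf : Function.Injective f)
    (he : Function.Exact f g) (hg : Function.Surjective g) (X : Type u) [AddCommGroup X] [Module R X] (n : ℕ) (x : EE R X B n)
    (hx : postE X g n x = 0) : ∃ y, postE X f n y = x :=
  Ext.covariant_sequence_exact₂ _ (sesC_exact hf he hg) x hx

lemma XV_mid_cov (hf : Function.Injective f)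
    (he : Function.Exact f g) (hg : Function.Surjective g) {X : Type u} [AddCommGroup X] [Module R X] {n : ℕ}
    (h1 : XV R X A n) (h2 : XV R X C n) : XV R X B n := by
  refine subsingleton_of_forall_eq 0 fun x => ?_
  obtain ⟨y, rfl⟩ := postE_exact_mid hf he hg X n x (Subsingleton.elim _ _)
  rw [Subsingleton.elim y 0, map_zero]

lemma XV_left_cov0 (hf : Function.Injective f) {X : Type u} [AddCommGroup X] [Module R X]
    (h1 : XV R X B 0) : XV R X A 0 := by
  have : Mono (ModuleCat.ofHom f) := (ModuleCat.mono_iff_injective _).2 hf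
  exact (Ext.postcomp_mk₀_injective_of_mono (ModuleCat.of R X) (ModuleCat.ofHom f)).subsingleton

lemma XV_left_cov (hf : Function.Injective f)
    (he : Function.Exact f g) (hg : Function.Surjective g) {X : Type u} [AddCommGroup X] [Module R X] {n : ℕ}
    (h1 : XV R X B (n+1)) (h2 : XV R X C n) : XV R X A (n+1) := by
  refine subsingleton_of_forall_eq 0 fun x => ?_
  obtain ⟨y, rfl⟩ := Ext.covariant_sequence_exact₁ _ (sesC_exact hf he hg) x
    (Subsingleton.elim (h := h1) _ _) rfl
  have : y = 0 := Subsingleton.elim (h := h2) _ _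
  rw [this]
  exact Ext.zero_comp (Y := (sesC f g he).X₃) _ _ _ _ _

lemma XV_right_cov (hf : Function.Injective f)
    (he : Function.Exact f g) (hg : Function.Surjective g) {X : Type u} [AddCommGroup X] [Module R X] {n : ℕ}
    (h1 : XV R X B n) (h2 : XV R X A (n+1)) : XV R X C n := by
  refine subsingleton_of_forall_eq 0 fun x => ?_
  obtain ⟨y, rfl⟩ := Ext.covariant_sequence_exact₃ _ (sesC_exact hf he hg) x rfl
    (Subsingleton.elim (h := h2) _ _)
  have : y = 0 := Subsingleton.elim (h := h1) _ _
  rw [this]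
  exact Ext.zero_comp (Y := (sesC f g he).X₂) _ _ _ _ _

lemma postE_exact_right (hf : Function.Injective f)
    (he : Function.Exact f g) (hg : Function.Surjective g) (X : Type u) [AddCommGroup X] [Module R X] (n : ℕ) (h : XV R X A (n+1)) :
    Function.Surjective (postE X g n) := fun x =>
  Ext.covariant_sequence_exact₃ _ (sesC_exact hf he hg) x rfl (Subsingleton.elim (h := h) _ _)

end

/-- Isomorphism invariance in the first variable. -/
def congrE (e : A ≃ₗ[R] B) (N : Type u) [AddCommGroup N] [Module R N] (n : ℕ) :
    EE R B N n ≃ₗ[R] EE R A N n :=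
  LinearEquiv.ofLinearMap (preE e.toLinearMap N n) (preE e.symm.toLinearMap N n)
    (by ext x; simp only [LinearMap.comp_apply, ← preE_comp]; simp [preE_id])
    (by ext x; simp only [LinearMap.comp_apply, ← preE_comp]; simp [preE_id])

lemma XV_congr_left (e : A ≃ₗ[R] B) {n : ℕ} (h : XV R A N n) : XV R B N n :=
  (congrE e N n).injective.subsingleton

/-- Isomorphism invariance in the second variable. -/
def congrE' (X : Type u) [AddCommGroup X] [Module R X] (e : A ≃ₗ[R] B) (n : ℕ) :
    EE R X A n ≃ₗ[R] EE R X B n :=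
  LinearEquiv.ofLinearMap (postE X e.toLinearMap n) (postE X e.symm.toLinearMap n)
    (by ext x; simp only [LinearMap.comp_apply, ← postE_comp]; simp [postE_id])
    (by ext x; simp only [LinearMap.comp_apply, ← postE_comp]; simp [postE_id])

lemma XV_congr_right (e : A ≃ₗ[R] B) {n : ℕ} (h : XV R X A n) : XV R X B n :=
  (congrE' X e n).symm.injective.subsingleton

lemma XV_of_subsingleton_left [Subsingleton M] (n : ℕ) : XV R M N n := by
  refine subsingleton_of_forall_eq 0 fun x => ?_
  rw [← preE_id n x, Subsingleton.elim (LinearMap.id : M →ₗ[R] M) 0, preE_zero]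

lemma XV_of_subsingleton_right [Subsingleton N] (n : ℕ) : XV R M N n := by
  refine subsingleton_of_forall_eq 0 fun x => ?_
  rw [← postE_id n x]
  have : (LinearMap.id : N →ₗ[R] N) = (0 : R) • LinearMap.id := Subsingleton.elim _ _
  rw [this, postE_smul_id, zero_smul]

lemma XV_projective [Module.Projective R M] (n : ℕ) : XV R M N (n+1) := by
  have : Projective (ModuleCat.of R M) := (IsProjective.iff_projective (R := R) M).1 inferInstance
  exact Ext.subsingleton_of_projective _ _ _

instance [IsNoetherianRing R] [Module.Finite R M] [Module.Finite R N] (n : ℕ) :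
    Module.Finite R (EE R M N n) := ModuleCat.finite_ext _ _ _ _

variable (R) in
/-- Ext in degree zero out of the ring. -/
def EE0 (N : Type u) [AddCommGroup N] [Module R N] : EE R R N 0 ≃ₗ[R] N :=
  (Ext.linearEquiv₀ (R := R)).trans <| (ModuleCat.homLinearEquiv (S := R)).trans (LinearMap.ringLmapEquivSelf R R N)

end ExtBasics

-- Part 2
section DepthBasics

open CategoryTheory Abelian IsLocalRing Pointwise

variable {R : Type u} [CommRing R] 
variable {A B C M N X : Type u} [AddCommGroup A] [Module R A] [AddCommGroup B] [Module R B]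
  [AddCommGroup C] [Module R C] [AddCommGroup M] [Module R M] [AddCommGroup N] [Module R N]
  [AddCommGroup X] [Module R X]

variable (R) in
/-- Depth at least `n`, through vanishing of Ext. -/
def dp [IsLocalRing R] (M : Type u) [AddCommGroup M] [Module R M] (n : ℕ) : Prop :=
  ∀ i < n, XV R (R ⧸ maximalIdeal R) M i

variable (R) in
/-- Dimension at most `c`. -/
def dimLE (M : Type u) [AddCommGroup M] [Module R M] (c : ℕ) : Prop :=
  ∀ p : PrimeSpectrum R, Module.annihilator R M ≤ p.asIdeal → Order.coheight p ≤ c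

lemma dimLE_inj {f : A →ₗ[R] B} (hf : Function.Injective f) {c : ℕ} (h : dimLE R B c) :
    dimLE R A c := fun p hp => h p ((f.annihilator_le_of_injective hf).trans hp)

lemma dimLE_surj {f : A →ₗ[R] B} (hf : Function.Surjective f) {c : ℕ} (h : dimLE R A c) :
    dimLE R B c := fun p hp => h p ((f.annihilator_le_of_surjective hf).trans hp)

lemma dimLE_mono {c c' : ℕ} (hc : c ≤ c') (h : dimLE R A c) : dimLE R A c' :=
  fun p hp => (h p hp).trans (by exact_mod_cast hc)

lemma smul_exact (x : R) (M : Type u) [AddCommGroup M] [Module R M] :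
    Function.Exact (x • (LinearMap.id : M →ₗ[R] M)) (Submodule.mkQ (x • (⊤ : Submodule R M))) := by
  intro y
  rw [Submodule.mkQ_apply, Submodule.Quotient.mk_eq_zero, Submodule.mem_smul_pointwise_iff_exists]
  simp

lemma smul_inj {x : R} (h : IsSMulRegular M x) :
    Function.Injective (x • (LinearMap.id : M →ₗ[R] M)) := h

lemma smul_mem_annihilator_quot (x : R) : x ∈ Module.annihilator R (QuotSMulTop x M) := by
  rw [Module.mem_annihilator]
  intro m
  obtain ⟨m, rfl⟩ := Submodule.mkQ_surjective _ m
  rw [← map_smul, Submodule.mkQ_apply, Submodule.Quotient.mk_eq_zero]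
  exact Submodule.smul_mem_pointwise_smul _ _ _ trivial

variable [IsLocalRing R]

section
variable {f : A →ₗ[R] B} {g : B →ₗ[R] C} 

lemma dp_mono {n n' : ℕ} (hn : n ≤ n') (h : dp R A n') : dp R A n :=
  fun i hi => h i (hi.trans_le hn)

lemma dp_congr (e : A ≃ₗ[R] B) {n : ℕ} (h : dp R A n) : dp R B n :=
  fun i hi => XV_congr_right e (h i hi)

lemma dp_mid (hf : Function.Injective f)
    (he : Function.Exact f g) (hg : Function.Surjective g) {n : ℕ}
    (h1 : dp R A n) (h2 : dp R C n) : dp R B n :=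
  fun i hi => XV_mid_cov hf he hg (h1 i hi) (h2 i hi)

lemma dp_left (hf : Function.Injective f)
    (he : Function.Exact f g) (hg : Function.Surjective g) {n : ℕ}
    (h1 : dp R B (n+1)) (h2 : dp R C n) : dp R A (n+1) := by
  rintro (_ | i) hi
  · exact XV_left_cov0 hf (h1 0 hi)
  · exact XV_left_cov hf he hg (h1 _ hi) (h2 i (by omega))

lemma dp_right (hf : Function.Injective f)
    (he : Function.Exact f g) (hg : Function.Surjective g) {n : ℕ}
    (h1 : dp R B n) (h2 : dp R A (n+1)) : dp R C n :=
  fun i hi => XV_right_cov hf he hg (h1 i hi) (h2 _ (by omega))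
end

lemma dp_subsingleton [Subsingleton M] (n : ℕ) : dp R M n := fun _ _ => XV_of_subsingleton_right _

lemma dp_quot {x : R} (h : IsSMulRegular M x) {n : ℕ} (h1 : dp R M (n+1)) :
    dp R (QuotSMulTop x M) n :=
  dp_right (smul_inj h) (smul_exact x M) (Submodule.mkQ_surjective _) (dp_mono (by omega) h1) h1

lemma smul_ext_zero {x : R} (hx : x ∈ Module.annihilator R A) (n : ℕ) (e : EE R A N n) :
    x • e = 0 := by
  rw [← preE_smul_id]
  have : x • (LinearMap.id : A →ₗ[R] A) = 0 := by
    ext a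
    simpa using Module.mem_annihilator.1 hx a
  rw [this, preE_zero]

lemma dp_of_quot {x : R} (hx : x ∈ maximalIdeal R) (h : IsSMulRegular M x) {n : ℕ}
    (h1 : dp R (QuotSMulTop x M) n) : dp R M (n+1) := by
  have key : ∀ i (e : EE R (R ⧸ maximalIdeal R) M i),
      postE _ (x • (LinearMap.id : M →ₗ[R] M)) i e = 0 := by
    intro i e
    rw [postE_smul_id]
    exact smul_ext_zero (by rwa [Ideal.annihilator_quotient]) i e
  rintro (_ | i) hi
  · refine subsingleton_of_forall_eq 0 fun e => ?_
    have : Mono (ModuleCat.ofHom (x • (LinearMap.id : M →ₗ[R] M))) :=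
      (ModuleCat.mono_iff_injective _).2 (smul_inj h)
    exact (Ext.postcomp_mk₀_injective_of_mono (ModuleCat.of R _) (ModuleCat.ofHom
      (x • (LinearMap.id : M →ₗ[R] M)))) ((key 0 e).trans (key 0 0).symm)
  · refine subsingleton_of_forall_eq 0 fun e => ?_
    obtain ⟨y, rfl⟩ := Ext.covariant_sequence_exact₁ _ (sesC_exact (smul_inj h) (smul_exact x M)
      (Submodule.mkQ_surjective _)) e (key _ e) rfl
    have : y = 0 := Subsingleton.elim (h := h1 i (by omega)) _ _
    rw [this]
    exact Ext.zero_comp (Y := (sesC _ _ (smul_exact x M)).X₃) _ _ _ _ _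

lemma hom_of_XV0 (h : XV R A B 0) : Subsingleton (A →ₗ[R] B) := by
  have : Subsingleton (ModuleCat.of R A ⟶ ModuleCat.of R B) :=
    Ext.addEquiv₀.subsingleton_congr.mp h
  exact (ModuleCat.homAddEquiv (M := ModuleCat.of R A) (N := ModuleCat.of R B)).symm.subsingleton

lemma XV0_of_hom (h : Subsingleton (A →ₗ[R] B)) : XV R A B 0 := by
  have : Subsingleton (ModuleCat.of R A ⟶ ModuleCat.of R B) :=
    (ModuleCat.homAddEquiv (M := ModuleCat.of R A) (N := ModuleCat.of R B)).subsingleton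
  exact Ext.addEquiv₀.subsingleton_congr.mpr this

lemma dp_exists_reg [IsNoetherianRing R] [Module.Finite R M] {n : ℕ} (h : dp R M (n+1)) :
    ∃ x ∈ maximalIdeal R, IsSMulRegular M x := by
  have := hom_of_XV0 (h 0 (by omega))
  obtain ⟨x, hx, h⟩ := IsSMulRegular.subsingleton_linearMap_iff.mp this
  rw [Ideal.annihilator_quotient] at hx
  exact ⟨x, hx, h⟩

lemma nakayama_smul [Module.Finite R M] {x : R} (hx : x ∈ maximalIdeal R)
    (h : ∀ m : M, ∃ m', x • m' = m) : Subsingleton M := by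
  have : (⊤ : Submodule R M) ≤ maximalIdeal R • ⊤ := by
    rintro m -
    obtain ⟨m', rfl⟩ := h m
    exact Submodule.smul_mem_smul hx trivial
  have := Submodule.eq_bot_of_le_smul_of_le_jacobson_bot _ _ Module.Finite.fg_top this
    (IsLocalRing.jacobson_eq_maximalIdeal ⊥ bot_ne_top).ge
  exact (Submodule.subsingleton_iff R).1 (subsingleton_of_bot_eq_top this.symm)

lemma XV_nak [IsNoetherianRing R] [Module.Finite R M] [Module.Finite R N] {x : R}
    (hx : x ∈ maximalIdeal R) (hr : IsSMulRegular M x) {j : ℕ}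
    (h : XV R (QuotSMulTop x M) N (j+1)) : XV R M N j := by
  refine nakayama_smul (R := R) hx fun e => ?_
  obtain ⟨y, hy⟩ := (preE_exact_left (smul_inj hr) (smul_exact x M)
    (Submodule.mkQ_surjective _) N j e).1 (Subsingleton.elim _ _)
  exact ⟨y, by rw [← hy, preE_smul_id]⟩

lemma dimLE_quot [IsNoetherianRing R] [Module.Finite R M] {x : R} (hr : IsSMulRegular M x) {c : ℕ}
    (h : dimLE R M (c+1)) : dimLE R (QuotSMulTop x M) c := by
  intro q hq
  have hxq : x ∈ q.asIdeal := hq (smul_mem_annihilator_quot x)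
  have h2 : Module.annihilator R M ≤ q.asIdeal :=
    (LinearMap.annihilator_le_of_surjective _ (Submodule.mkQ_surjective _)).trans hq
  obtain ⟨p, hp, hpq⟩ := Ideal.exists_minimalPrimes_le h2
  have hass : p ∈ associatedPrimes R M := Module.associatedPrimes.minimalPrimes_annihilator_subset_associatedPrimes R M hp
  have hxp : x ∉ p := by
    intro hxp
    have : x ∈ ⋃ p ∈ associatedPrimes R M, (p : Set R) := by
      simp only [Set.mem_iUnion]; exact ⟨p, hass, hxp⟩
    rw [biUnion_associatedPrimes_eq_compl_regular] at this
    exact this hr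
  have : p.IsPrime := hp.1.1
  have hlt : (⟨p, this⟩ : PrimeSpectrum R) < q := by
    refine lt_of_le_of_ne hpq fun e => hxp ?_
    rw [← e] at hxq; exact hxq
  have h3 := h ⟨p, this⟩ hp.1.2
  have h4 := Order.coheight_strictAnti hlt
    (lt_of_le_of_lt ((Order.coheight_anti hlt.le).trans h3) (ENat.natCast_lt_top _))
  have h5 := lt_of_lt_of_le h4 h3
  rw [Nat.cast_add, Nat.cast_one] at h5
  exact Order.le_of_lt_add_one h5

lemma XV_filt [IsNoetherianRing R] [Module.Finite R N] (Q : ℕ → ℕ → Prop)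
    (h0 : ∀ c j, Q c j → XV R (R ⧸ maximalIdeal R) N j)
    (h1 : ∀ c j, Q (c+1) j → Q c (j+1)) (c : ℕ) : ∀ (j : ℕ), Q c j →
    ∀ (M : Type u) [AddCommGroup M] [Module R M] [Module.Finite R M], dimLE R M c → XV R M N j := by
  induction c with
  | zero =>
    intro j hQ M _ _ hM
    refine IsNoetherianRing.induction_on_isQuotientEquivQuotientPrime (A := R) (M := M) hM
      (motive := fun M _ _ _ => dimLE R M 0 → XV R M N j) ?_ ?_ ?_
    · intro N _ _ _ _ _
      exact XV_of_subsingleton_left _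
    · intro N _ _ _ p e hN
      have : Order.coheight p ≤ 0 := by
        refine hN p ?_
        rw [e.annihilator_eq, Ideal.annihilator_quotient]
      have hm : IsMax p := Order.coheight_eq_zero.1 (le_antisymm this bot_le)
      have : p.asIdeal = maximalIdeal R :=
        IsLocalRing.eq_maximalIdeal (PrimeSpectrum.isMax_iff.1 hm)
      have e' := e.trans (Submodule.quotEquivOfEq _ _ this)
      exact XV_congr_left e'.symm (h0 _ _ hQ)
    · intro N₁ _ _ _ N₂ _ _ _ N₃ _ _ _ f g hf hg he i1 i2 hd
      exact XV_mid_con hf he hg (i1 (dimLE_inj hf hd)) (i2 (dimLE_surj hg hd))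
  | succ c ih =>
    intro j hQ M _ _ hM
    refine IsNoetherianRing.induction_on_isQuotientEquivQuotientPrime (A := R) (M := M) hM
      (motive := fun M _ _ _ => dimLE R M (c+1) → XV R M N j) ?_ ?_ ?_
    · intro N _ _ _ _ _
      exact XV_of_subsingleton_left _
    · intro N _ _ _ p e hN
      by_cases hm : p.asIdeal = maximalIdeal R
      · have e' := e.trans (Submodule.quotEquivOfEq _ _ hm)
        exact XV_congr_left e'.symm (h0 _ _ hQ)
      · have : ∃ x ∈ maximalIdeal R, x ∉ p.asIdeal := by
          by_contra! h
          exact hm (le_antisymm (IsLocalRing.le_maximalIdeal p.2.ne_top) h)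
        obtain ⟨x, hx, hxp⟩ := this
        have hreg : IsSMulRegular (R ⧸ p.asIdeal) x := by
          intro a b hab
          obtain ⟨a, rfl⟩ := Ideal.Quotient.mk_surjective a
          obtain ⟨b, rfl⟩ := Ideal.Quotient.mk_surjective b
          have hab' : (Ideal.Quotient.mk p.asIdeal) (x * a) = (Ideal.Quotient.mk p.asIdeal) (x * b) := hab
          rw [Ideal.Quotient.eq, ← mul_sub] at hab'
          exact Ideal.Quotient.eq.2 ((p.2.mem_or_mem hab').resolve_left hxp)
        refine XV_congr_left e.symm (XV_nak hx hreg (ih _ (h1 _ _ hQ) _ ?_))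
        exact dimLE_quot hreg (dimLE_surj e.surjective hN)
    · intro N₁ _ _ _ N₂ _ _ _ N₃ _ _ _ f g hf hg he i1 i2 hd
      exact XV_mid_con hf he hg (i1 (dimLE_inj hf hd)) (i2 (dimLE_surj hg hd))

/-- Ischebeck-type vanishing. -/
lemma ischebeck [IsNoetherianRing R] [Module.Finite R M] [Module.Finite R N] {n c j : ℕ}
    (hN : dp R N n) (hM : dimLE R M c) (h : j + c < n) : XV R M N j :=
  XV_filt (fun c j => j + c < n) (fun c j h => hN j (by omega)) (fun c j h => by omega) c j h M hM

lemma coheight_le_dim {d : ℕ} (hd : ringKrullDim R = d) (p : PrimeSpectrum R) :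
    Order.coheight p ≤ d := by
  have := Order.coheight_le_krullDim p
  unfold ringKrullDim at hd
  rw [hd] at this
  exact_mod_cast this

lemma height_add_coheight_le {d : ℕ} (hd : ringKrullDim R = d) (p : PrimeSpectrum R) :
    p.asIdeal.height + Order.coheight p ≤ d := by
  have h := Order.krullDim_eq_iSup_height_add_coheight_of_nonempty (α := PrimeSpectrum R)
  unfold ringKrullDim at hd
  rw [hd] at h
  have h' : (d : ℕ∞) = ⨆ a : PrimeSpectrum R, Order.height a + Order.coheight a := by
    exact_mod_cast h
  rw [h', PrimeSpectrum.height_eq_orderHeight]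
  exact le_iSup (fun a : PrimeSpectrum R => Order.height a + Order.coheight a) p

lemma dimLE_dim {d : ℕ} (hd : ringKrullDim R = d) (M : Type u) [AddCommGroup M] [Module R M] :
    dimLE R M d := fun p _ => coheight_le_dim hd p

/-- Associated primes have large coheight. -/
lemma ass_coheight [IsNoetherianRing R] [Module.Finite R N] {n : ℕ} (hN : dp R N n)
    (p : PrimeSpectrum R) (hp : p.asIdeal ∈ associatedPrimes R N) : (n : ℕ∞) ≤ Order.coheight p := by
  by_contra! h
  obtain ⟨c, hc⟩ := ENat.ne_top_iff_exists.1 (h.trans (ENat.natCast_lt_top n)).ne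
  rw [← hc] at h
  have hd : dimLE R (R ⧸ p.asIdeal) c := by
    intro q hq
    rw [Ideal.annihilator_quotient] at hq
    rw [hc]
    exact Order.coheight_anti hq
  have := hom_of_XV0 (ischebeck (j := 0) hN hd (by rw [Nat.zero_add]; exact_mod_cast h))
  obtain ⟨-, f, hf⟩ := (isAssociatedPrime_iff_exists_injective_linearMap _ _).1 hp
  have h0 : f = 0 := Subsingleton.elim _ _
  have : f 1 = f 0 := by rw [h0]; simp
  have := hf this
  have h1 : (1 : R ⧸ p.asIdeal) ≠ 0 := by
    have := p.2
    exact one_ne_zero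
  exact h1 this

lemma ass_height [IsNoetherianRing R] [Module.Finite R N] {n d : ℕ} (hd : ringKrullDim R = d)
    (hN : dp R N n) (p : Ideal R) (hp : p ∈ associatedPrimes R N) : p.height + n ≤ d := by
  have hpp : p.IsPrime := hp.isPrime
  exact (add_le_add_right (ass_coheight hN ⟨p, hpp⟩ hp) _).trans (height_add_coheight_le hd ⟨p, hpp⟩)

end DepthBasics

-- Part 3
section Gor

open CategoryTheory Abelian IsLocalRing Pointwise RingTheory.Sequence

variable {R : Type u} [CommRing R]
variable {A B C M N X : Type u} [AddCommGroup A] [Module R A] [AddCommGroup B] [Module R B]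
  [AddCommGroup C] [Module R C] [AddCommGroup M] [Module R M] [AddCommGroup N] [Module R N]
  [AddCommGroup X] [Module R X]

lemma XV_of_oldExt {n : ℕ}
    (h : Subsingleton (((_root_.Ext R (ModuleCat.{u} R) (n+1)).obj
      (Opposite.op (ModuleCat.of R M))).obj (ModuleCat.of R N))) : XV R M N (n+1) := by
  have P : ProjectiveResolution (ModuleCat.of R M) := projectiveResolution _
  have hz : Limits.IsZero ((P.complex.linearYonedaObj R (ModuleCat.of R N)).homology (n+1)) := by
    have := (ModuleCat.isZero_of_iff_subsingleton (R := R)).2 h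
    exact Limits.IsZero.of_iso this (P.isoExt (n+1) (ModuleCat.of R N)).symm
  rw [← HomologicalComplex.exactAt_iff_isZero_homology,
    HomologicalComplex.exactAt_iff' _ n (n+1) (n+2) (by simp) (by simp),
    ShortComplex.moduleCat_exact_iff] at hz
  refine subsingleton_of_forall_eq 0 fun e => ?_
  obtain ⟨f, hf, rfl⟩ := P.extMk_surjective e (n+2) rfl
  rw [P.extMk_eq_zero_iff f (n+2) rfl hf n rfl]
  obtain ⟨g, hg⟩ := hz f hf
  exact ⟨g, hg⟩

variable [IsLocalRing R]

lemma dp_of_weaklyRegular (rs : List R) (hm : ∀ r ∈ rs, r ∈ maximalIdeal R) :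
    ∀ (M : Type u) [AddCommGroup M] [Module R M], IsWeaklyRegular M rs → dp R M rs.length := by
  induction rs with
  | nil => intro M _ _ _ i hi; simp at hi
  | cons r rs ih =>
    intro M _ _ h
    rw [isWeaklyRegular_cons_iff] at h
    exact dp_of_quot (hm r (by simp)) h.1 (ih (fun r hr => hm r (by simp [hr])) _ h.2)

lemma exists_weaklyRegular [IsNoetherianRing R] (n : ℕ) :
    ∀ (M : Type u) [AddCommGroup M] [Module R M] [Module.Finite R M], dp R M n →
    ∃ rs : List R, rs.length = n ∧ (∀ r ∈ rs, r ∈ maximalIdeal R) ∧ IsWeaklyRegular M rs := by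
  induction n with
  | zero => intro M _ _ _ _; exact ⟨[], by simp⟩
  | succ n ih =>
    intro M _ _ _ h
    obtain ⟨x, hx, hr⟩ := dp_exists_reg h
    obtain ⟨rs, h1, h2, h3⟩ := ih _ (dp_quot hr h)
    exact ⟨x :: rs, by simp [h1], by
      intro r hr
      rcases List.mem_cons.1 hr with rfl | hr
      exacts [hx, h2 r hr], (isWeaklyRegular_cons_iff _ _ _).2 ⟨hr, h3⟩⟩

lemma not_dp_succ [IsNoetherianRing R] {d : ℕ} (hd : ringKrullDim R = d) : ¬ dp R R (d+1) := by
  intro h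
  have : (associatedPrimes R R).Nonempty := associatedPrimes.nonempty R R
  obtain ⟨p, hp⟩ := this
  have := ass_height hd h p hp
  have h2 : ((d + 1 : ℕ) : ℕ∞) ≤ d := le_trans le_add_self this
  have h3 : d + 1 ≤ d := by exact_mod_cast h2
  omega

variable (R) in
/-- Gorenstein property in usable form. -/
structure GorL (d : ℕ) : Prop where
  dim : ringKrullDim R = d
  dpR : dp R R d
  inj : ∀ (M : Type u) [AddCommGroup M] [Module R M] [Module.Finite R M] (j : ℕ), d < j → XV R M R j

lemma exists_simple_sub [IsNoetherianRing R] {d : ℕ} (hd : ringKrullDim R = d) (hR : dp R R d)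
    (r e : ℕ) (hre : r + e = d) : ∃ (Q : Type u) (_ : AddCommGroup Q) (_ : Module R Q)
      (_ : Module.Finite R Q), dp R Q e ∧ ¬ dp R Q (e+1) ∧ ∀ j, r < j → XV R Q R j := by
  induction r generalizing e with
  | zero =>
    obtain rfl : e = d := by omega
    refine ⟨R, inferInstance, inferInstance, inferInstance, hR, not_dp_succ hd, ?_⟩
    rintro (_ | j) hj
    · omega
    · exact XV_projective j
  | succ r ih =>
    obtain ⟨Q, _, _, _, h1, h2, h3⟩ := ih (e+1) (by omega)
    obtain ⟨x, hx, hr⟩ := dp_exists_reg h1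
    refine ⟨QuotSMulTop x Q, inferInstance, inferInstance, inferInstance, dp_quot hr h1,
      fun h => h2 (dp_of_quot hx hr h), ?_⟩
    rintro (_ | j) hj
    · omega
    · exact XV_right_con (smul_inj hr) (smul_exact x Q) (Submodule.mkQ_surjective _)
        (h3 _ (by omega)) (h3 _ (by omega))

lemma gorL_of_resfield [IsNoetherianRing R] {d : ℕ} (hd : ringKrullDim R = d) (hR : dp R R d)
    (n : ℕ) (h : ∀ j, n < j → XV R (R ⧸ maximalIdeal R) R j) : GorL R d := by
  refine ⟨hd, hR, ?_⟩
  have key : ∀ n : ℕ, (∀ j, n < j → XV R (R ⧸ maximalIdeal R) R j) →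
      ∀ (M : Type u) [AddCommGroup M] [Module R M] [Module.Finite R M] (j : ℕ), n < j → XV R M R j := by
    intro n h M _ _ _ j hj
    exact XV_filt (fun c j => n < j) (fun c j hj => h j hj) (fun c j hj => by omega) d j hj M
      (dimLE_dim hd M)
  apply key
  have step : ∀ k : ℕ, (∀ j, d + k < j → XV R (R ⧸ maximalIdeal R) R j) →
      ∀ j, d < j → XV R (R ⧸ maximalIdeal R) R j := by
    intro k
    induction k with
    | zero => intro h; simpa using h
    | succ k ih =>
      intro h
      apply ih
      intro j hj
      rcases (show d + k + 1 ≤ j from hj).eq_or_lt with rfl | hj'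
      · obtain ⟨Q, _, _, _, -, h2, h3⟩ := exists_simple_sub hd hR d 0 (by omega)
        have hne : ¬ Subsingleton ((R ⧸ maximalIdeal R) →ₗ[R] Q) := by
          intro hs
          apply h2
          intro i hi
          obtain rfl : i = 0 := by omega
          exact XV0_of_hom hs
        rw [not_subsingleton_iff_nontrivial] at hne
        obtain ⟨f, hf⟩ := exists_ne (0 : (R ⧸ maximalIdeal R) →ₗ[R] Q)
        have hsimple : IsSimpleModule R (R ⧸ maximalIdeal R) :=
          isSimpleModule_iff_isCoatom.2 (Ideal.isMaximal_def.1 (maximalIdeal.isMaximal R))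
        have hinj : Function.Injective f := (LinearMap.injective_or_eq_zero f).resolve_right hf
        have hC : XV R (Q ⧸ LinearMap.range f) R (d + k + 1 + 1) :=
          key _ h _ _ (by omega)
        exact XV_left_con hinj (LinearMap.exact_map_mkQ_range f) (Submodule.mkQ_surjective _)
          (h3 _ (by omega)) hC
      · exact h j (by omega)
  exact step n fun j hj => h j (by omega)

lemma GorL.ext_vanish [IsNoetherianRing R] {d : ℕ} (G : GorL R d) (n : ℕ) :
    ∀ (M : Type u) [AddCommGroup M] [Module R M] [Module.Finite R M], dp R M n → ∀ j, d < j + n →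
      XV R M R j := by
  induction n with
  | zero => intro M _ _ _ _ j hj; exact G.inj M j hj
  | succ n ih =>
    intro M _ _ _ h j hj
    obtain ⟨x, hx, hr⟩ := dp_exists_reg h
    exact XV_nak hx hr (ih _ (dp_quot hr h) _ (by omega))

lemma GorL.dp_ext [IsNoetherianRing R] {d : ℕ} (G : GorL R d) (e : ℕ) : ∀ (c : ℕ), c + e = d →
    ∀ (M : Type u) [AddCommGroup M] [Module R M] [Module.Finite R M], dp R M e → dimLE R M e →
      dp R (EE R M R c) e := by
  induction e with
  | zero => intro c _ M _ _ _ _ _ i hi; omega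
  | succ e ih =>
    intro c hc M _ _ _ h hdim
    obtain ⟨x, hx, hr⟩ := dp_exists_reg h
    have hf := smul_inj hr
    have he := smul_exact x M
    have hg := Submodule.mkQ_surjective (x • (⊤ : Submodule R M))
    have hq := dimLE_quot hr hdim
    have i1 : XV R (QuotSMulTop x M) R c := ischebeck G.dpR hq (by omega)
    have i2 : XV R M R (c+1) := G.ext_vanish _ M h _ (by omega)
    have hreg : IsSMulRegular (EE R M R c) x := by
      have : Function.Injective (preE (x • (LinearMap.id : M →ₗ[R] M)) R c) := by
        rw [injective_iff_map_eq_zero]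
        intro y hy
        obtain ⟨z, rfl⟩ := (preE_exact_mid hf he hg R c y).1 hy
        rw [Subsingleton.elim z 0, map_zero]
      intro a b hab
      refine this ?_
      rw [preE_smul_id, preE_smul_id]; exact hab
    refine dp_of_quot hx hreg ?_
    have ex := preE_exact_left hf he hg R c
    have sur : Function.Surjective (delE hf he hg R c) := by
      intro y
      exact (preE_exact_right hf he hg R c y).1 (Subsingleton.elim _ _)
    have hker : LinearMap.ker (delE hf he hg R c) = x • (⊤ : Submodule R (EE R M R c)) := by
      rw [ex.linearMap_ker_eq]
      ext y
      rw [Submodule.mem_smul_pointwise_iff_exists]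
      simp [preE_smul_id]
    have eq : QuotSMulTop x (EE R M R c) ≃ₗ[R] EE R (QuotSMulTop x M) R (c+1) :=
      (Submodule.quotEquivOfEq _ _ hker.symm).trans
        ((delE hf he hg R c).quotKerEquivOfSurjective sur)
    exact dp_congr eq.symm (ih (c+1) (by omega) _ (dp_quot hr h) hq)

end Gor

-- Part 4
section Core

open CategoryTheory Abelian IsLocalRing Pointwise

variable {R : Type u} [CommRing R]

/-- The subquotient `P / (P ∩ L)`. -/
abbrev QT (P L : Ideal R) := ↥P ⧸ (Submodule.comap P.subtype L)

/-- multiplication by `a` between subquotients -/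
def mulQ (a : R) {P L P' L' : Ideal R} (h1 : ∀ x ∈ P, a * x ∈ P')
    (h2 : ∀ x ∈ P, x ∈ L → a * x ∈ L') : QT P L →ₗ[R] QT P' L' :=
  Submodule.mapQ _ _ ((a • P.subtype).codRestrict P' (fun x => h1 x.1 x.2))
    (fun x hx => h2 x.1 x.2 hx)

lemma mulQ_mk (a : R) {P L P' L' : Ideal R} (h1 : ∀ x ∈ P, a * x ∈ P')
    (h2 : ∀ x ∈ P, x ∈ L → a * x ∈ L') (x : R) (hx : x ∈ P) :
    mulQ a h1 h2 (Submodule.Quotient.mk ⟨x, hx⟩) = Submodule.Quotient.mk ⟨a * x, h1 x hx⟩ := rfl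

lemma qt_mk_eq_zero {P L : Ideal R} (x : R) (hx : x ∈ P) :
    (Submodule.Quotient.mk ⟨x, hx⟩ : QT P L) = 0 ↔ x ∈ L := by
  rw [Submodule.Quotient.mk_eq_zero]; rfl

lemma qt_surj {P L : Ideal R} (y : QT P L) :
    ∃ (x : R) (hx : x ∈ P), y = Submodule.Quotient.mk ⟨x, hx⟩ := by
  obtain ⟨⟨x, hx⟩, rfl⟩ := Submodule.Quotient.mk_surjective _ y
  exact ⟨x, hx, rfl⟩

lemma mulQ_injective (a : R) {P L P' L' : Ideal R} (h1 : ∀ x ∈ P, a * x ∈ P')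
    (h2 : ∀ x ∈ P, x ∈ L → a * x ∈ L') (h : ∀ x ∈ P, a * x ∈ L' → x ∈ L) :
    Function.Injective (mulQ a h1 h2) := by
  rw [injective_iff_map_eq_zero]
  intro y hy
  obtain ⟨x, hx, rfl⟩ := qt_surj y
  rw [mulQ_mk, qt_mk_eq_zero] at hy
  exact (qt_mk_eq_zero _ _).2 (h x hx hy)

lemma mulQ_exact (a : R) {P L P' L' L'' : Ideal R} (h1 : ∀ x ∈ P, a * x ∈ P')
    (h2 : ∀ x ∈ P, x ∈ L → a * x ∈ L') (h3 : ∀ x ∈ P', 1 * x ∈ P')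
    (h4 : ∀ x ∈ P', x ∈ L' → 1 * x ∈ L'')
    (h : ∀ y ∈ P', y ∈ L'' → ∃ x ∈ P, y - a * x ∈ L') (h' : ∀ x ∈ P, a * x ∈ L'') :
    Function.Exact (mulQ a h1 h2) (mulQ 1 h3 h4) := by
  intro y
  obtain ⟨y, hy, rfl⟩ := qt_surj y
  rw [mulQ_mk, qt_mk_eq_zero, one_mul]
  constructor
  · intro h5
    obtain ⟨x, hx, hxy⟩ := h y hy h5
    refine ⟨Submodule.Quotient.mk ⟨x, hx⟩, ?_⟩
    rw [mulQ_mk, ← sub_eq_zero, ← Submodule.Quotient.mk_sub]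
    refine (qt_mk_eq_zero _ _).2 ?_
    have := neg_mem hxy
    simpa using this
  · rintro ⟨z, hz⟩
    obtain ⟨x, hx, rfl⟩ := qt_surj z
    rw [mulQ_mk, ← sub_eq_zero, ← Submodule.Quotient.mk_sub] at hz
    have h6 := (qt_mk_eq_zero (L := L') (P := P') _ (sub_mem (h1 x hx) hy)).1 hz
    have h7 := h4 _ (sub_mem (h1 x hx) hy) h6
    have := sub_mem (h' x hx) h7
    simpa using this

lemma mulQ_one_surj {P L L'' : Ideal R} (h3 : ∀ x ∈ P, 1 * x ∈ P)
    (h4 : ∀ x ∈ P, x ∈ L → 1 * x ∈ L'') : Function.Surjective (mulQ 1 h3 h4) := by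
  intro y
  obtain ⟨y, hy, rfl⟩ := qt_surj y
  refine ⟨Submodule.Quotient.mk ⟨y, hy⟩, ?_⟩
  rw [mulQ_mk]; simp

/-- checking membership at associated primes -/
lemma ass_check [IsNoetherianRing R] {P L : Ideal R} {y : R} (hy : y ∈ P)
    (h : ∀ p ∈ associatedPrimes R (QT P L), ∃ r ∉ p, r * y ∈ L) : y ∈ L := by
  rw [← qt_mk_eq_zero (P := P) y hy]
  by_contra hne
  obtain ⟨p, hp, hle⟩ := exists_le_isAssociatedPrime_of_isNoetherianRing R _ hne
  obtain ⟨r, hr, hry⟩ := h p hp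
  apply hr
  apply hle
  have h1 : r • (Submodule.Quotient.mk ⟨y, hy⟩ : QT P L) = 0 := by
    rw [← Submodule.Quotient.mk_smul]
    exact (qt_mk_eq_zero (r * y) (P.mul_mem_left r hy)).2 hry
  exact (Submodule.mem_colon_singleton).2 (by simpa using h1)

/-- `(a_0, …, a_{k-1})` -/
def JJ (a : ℕ → R) : ℕ → Ideal R
  | 0 => ⊥
  | k+1 => JJ a k ⊔ Ideal.span {a k}

/-- `(a_0, …, a_{k-1}) : I` -/
def KK (a : ℕ → R) (I : Ideal R) (k : ℕ) : Ideal R where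
  carrier := {r | ∀ x ∈ I, r * x ∈ JJ a k}
  add_mem' := by
    intro r s hr hs x hx
    rw [add_mul]; exact add_mem (hr x hx) (hs x hx)
  zero_mem' := by intro x _; simp
  smul_mem' := by
    intro c r hr x hx
    rw [smul_eq_mul, mul_assoc]; exact Ideal.mul_mem_left _ _ (hr x hx)

lemma mem_KK {a : ℕ → R} {I : Ideal R} {k : ℕ} {r : R} :
    r ∈ KK a I k ↔ ∀ x ∈ I, r * x ∈ JJ a k := Iff.rfl

lemma mem_JJ_succ {a : ℕ → R} {k : ℕ} {y : R} :
    y ∈ JJ a (k+1) ↔ ∃ z ∈ JJ a k, ∃ c, z + a k * c = y := by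
  rw [JJ, Submodule.mem_sup]
  constructor
  · rintro ⟨z, hz, w, hw, rfl⟩
    obtain ⟨c, rfl⟩ := Ideal.mem_span_singleton.1 hw
    exact ⟨z, hz, c, rfl⟩
  · rintro ⟨z, hz, c, rfl⟩
    exact ⟨z, hz, _, Ideal.mem_span_singleton.2 ⟨c, rfl⟩, rfl⟩

lemma JJ_mono {a : ℕ → R} {k l : ℕ} (h : k ≤ l) : JJ a k ≤ JJ a l := by
  induction h with
  | refl => exact le_rfl
  | step _ ih => exact ih.trans le_sup_left

lemma mem_JJ_self {a : ℕ → R} (k : ℕ) : a k ∈ JJ a (k+1) :=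
  mem_JJ_succ.2 ⟨0, zero_mem _, 1, by simp⟩

lemma KK_mono {a : ℕ → R} {I : Ideal R} {k l : ℕ} (h : k ≤ l) : KK a I k ≤ KK a I l :=
  fun _ hr x hx => JJ_mono h (hr x hx)

lemma JJ_le_KK {a : ℕ → R} {I : Ideal R} {k : ℕ} : JJ a k ≤ KK a I k :=
  fun _ hr x _ => Ideal.mul_mem_right x _ hr

lemma JJ_le {a : ℕ → R} {I : Ideal R} {s : ℕ} (ha : ∀ k < s, a k ∈ I) {k : ℕ} (hk : k ≤ s) :
    JJ a k ≤ I := by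
  induction k with
  | zero => exact bot_le
  | succ k ih => exact sup_le (ih (by omega)) ((Ideal.span_singleton_le_iff_mem _).2 (ha k (by omega)))

/-- the d-sequence lemma, localized at a multiplicative set -/
lemma dseq_loc (S : Submonoid R) (a : ℕ → R) (I : Ideal R) (n : ℕ) (ha : ∀ k < n, a k ∈ I)
    (h1 : ∀ k < n, ∀ y ∈ I, y ∈ KK a I k → y ∈ JJ a k)
    (h2 : ∀ k < n, ∀ y, a k * y ∈ JJ a k → y ∈ KK a I k)
    (r : R) (hrS : r ∈ S) (hr : ∀ x ∈ I, r * x ∈ JJ a n) :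
    ∀ (j m k : ℕ), k + m = n → ∀ y ∈ JJ a k, y ∈ I ^ (j+1) → ∃ t ∈ S, t * y ∈ JJ a k * I ^ j := by
  intro j
  induction j with
  | zero =>
    intro m k hk y hy _
    exact ⟨1, S.one_mem, by simpa using hy⟩
  | succ j ihj =>
    intro m
    induction m with
    | zero =>
      intro k hk y hy hyI
      obtain rfl : k = n := by omega
      refine ⟨r, hrS, ?_⟩
      have : Ideal.span {r} * I ≤ JJ a k := Ideal.span_singleton_mul_le_iff.2 hr
      have h3 : Ideal.span {r} * I ^ (j+1+1) ≤ JJ a k * I ^ (j+1) := by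
        rw [pow_succ' I (j+1), ← mul_assoc]
        exact Ideal.mul_mono_left this
      exact h3 (Ideal.mul_mem_mul (Ideal.mem_span_singleton_self r) hyI)
    | succ m ihm =>
      intro k hk y hy hyI
      obtain ⟨t, ht, hty⟩ := ihm (k+1) (by omega) y (JJ_mono (Nat.le_succ k) hy) hyI
      rw [JJ, Ideal.sup_mul, Submodule.mem_sup] at hty
      obtain ⟨u, hu, w, hw, huw⟩ := hty
      obtain ⟨v, hv, rfl⟩ := Ideal.mem_span_singleton_mul.1 hw
      have hav : a k * v ∈ JJ a k := by
        have : a k * v = t * y - u := by rw [← huw]; ring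
        rw [this]
        have hle : JJ a k * I ^ (j+1) ≤ JJ a k := Ideal.mul_le_left
        exact sub_mem (Ideal.mul_mem_left _ _ hy) (hle hu)
      have hvK := h2 k (by omega) v hav
      have hvI : v ∈ I := Ideal.pow_le_self (Nat.succ_ne_zero j) hv
      have hvJ := h1 k (by omega) v hvI hvK
      obtain ⟨t', ht', htv⟩ := ihj (m+1) k hk v hvJ hv
      refine ⟨t' * t, S.mul_mem ht' ht, ?_⟩
      have e : t' * t * y = t' * u + a k * (t' * v) := by
        rw [mul_assoc, ← huw]; ring
      rw [e]
      refine add_mem (Ideal.mul_mem_left _ _ hu) ?_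
      have : a k * (t' * v) ∈ I * (JJ a k * I ^ j) := by
        have hak : a k ∈ I := ha k (by omega)
        exact Submodule.mul_mem_mul hak htv
      have e2 : I * (JJ a k * I ^ j) = JJ a k * I ^ (j+1) := by
        rw [pow_succ' I j, mul_left_comm]
      rwa [e2] at this

end Core

-- Part 5
section Core2

open CategoryTheory Abelian IsLocalRing Pointwise

variable {R : Type u} [CommRing R]

/-- `R/L` as a subquotient. -/
def qtTop (L : Ideal R) : QT ⊤ L ≃ₗ[R] (R ⧸ L) :=
  Submodule.Quotient.equiv _ _ Submodule.topEquiv (by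
    ext x
    simp only [Submodule.mem_map, Submodule.mem_comap]
    constructor
    · rintro ⟨y, hy, rfl⟩; exact hy
    · intro hx; exact ⟨⟨x, trivial⟩, hx, rfl⟩)

lemma ann_qt (P L : Ideal R) : L ≤ Module.annihilator R (QT P L) := by
  intro x hx
  rw [Module.mem_annihilator]
  intro y
  obtain ⟨y, hy, rfl⟩ := qt_surj y
  rw [← Submodule.Quotient.mk_smul]
  exact (qt_mk_eq_zero (x * y) (P.mul_mem_left x hy)).2 (L.mul_mem_right _ hx)

lemma ext_step [IsLocalRing R] {ω W ω' : Type u} [AddCommGroup ω] [Module R ω] [AddCommGroup W] [Module R W]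
    [AddCommGroup ω'] [Module R ω'] {fa : ω →ₗ[R] W} {g : W →ₗ[R] ω'}
    (hf : Function.Injective fa) (he : Function.Exact fa g) (hg : Function.Surjective g)
    (i : ℕ) (hW : XV R W R (i+1)) (K K' I : Ideal R) (a : R)
    (e : EE R ω R i ≃ₗ[R] (R ⧸ K))
    (hK' : ∀ x, (∀ b ∈ I, ∃ c, x * b - a * c ∈ K) → x ∈ K')
    (hann : K' ≤ Module.annihilator R ω')
    (hfb : ∀ b ∈ I, ∃ fb : ω →ₗ[R] W, a • fb = b • fa) :
    Nonempty (EE R ω' R (i+1) ≃ₗ[R] (R ⧸ K')) := by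
  let π : R →ₗ[R] EE R ω' R (i+1) :=
    (delE hf he hg R i).comp (e.symm.toLinearMap.comp K.mkQ)
  have hπ : Function.Surjective π := by
    intro y
    obtain ⟨z, hz⟩ := (preE_exact_right hf he hg R i y).1 (Subsingleton.elim _ _)
    obtain ⟨w, hw⟩ := Submodule.mkQ_surjective K (e z)
    refine ⟨w, ?_⟩
    change delE hf he hg R i (e.symm (K.mkQ w)) = y
    rw [hw, LinearEquiv.symm_apply_apply, hz]
  have hker : LinearMap.ker π = K' := by
    apply le_antisymm
    · intro x hx
      have hx : delE hf he hg R i (e.symm (K.mkQ x)) = 0 := hx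
      obtain ⟨ξ, hξ⟩ := (preE_exact_left hf he hg R i _).1 hx
      apply hK'
      intro b hb
      obtain ⟨fb, hfb⟩ := hfb b hb
      have h1 : a • preE fb R i ξ = b • e.symm (K.mkQ x) := by
        rw [← hξ, ← preE_smul, ← preE_smul, hfb]
      obtain ⟨c, hc⟩ := Submodule.mkQ_surjective K (e (preE fb R i ξ))
      refine ⟨c, ?_⟩
      have h2 := congrArg e h1
      rw [map_smul, map_smul, LinearEquiv.apply_symm_apply, ← hc, ← map_smul, ← map_smul] at h2
      have h3 := (Submodule.Quotient.eq K).1 h2.symm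
      rw [mul_comm x b]
      exact h3
    · intro x hx
      rw [LinearMap.mem_ker]
      have : π x = x • π 1 := by rw [← map_smul]; simp
      rw [this]
      exact smul_ext_zero (hann hx) _ _
  exact ⟨((Submodule.quotEquivOfEq _ _ hker.symm).trans (π.quotKerEquivOfSurjective hπ)).symm⟩

variable [IsLocalRing R] [IsNoetherianRing R]

lemma ass_le {d k : ℕ} (hd : ringKrullDim R = d) {M : Type u} [AddCommGroup M] [Module R M]
    [Module.Finite R M] (h : ∀ e, e + k ≤ d → dp R M e) (p : Ideal R)
    (hp : p ∈ associatedPrimes R M) : p.height ≤ k := by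
  by_cases hk : k ≤ d
  · have h1 := ass_height hd (h (d - k) (by omega)) p hp
    have h2 : p.height + ((d - k : ℕ) : ℕ∞) ≤ (k : ℕ∞) + ((d - k : ℕ) : ℕ∞) := by
      refine h1.trans ?_
      have : d = k + (d - k) := by omega
      exact_mod_cast this.le
    exact (ENat.add_le_add_iff_right (ENat.natCast_ne_top _)).1 h2
  · have h1 := ass_height hd (n := 0) (N := M) (fun i hi => by omega) p hp
    simp only [Nat.cast_zero, add_zero] at h1
    exact h1.trans (by exact_mod_cast (by omega : d ≤ k))

lemma reg_of_ass {L : Ideal R} {a : R} (h : ∀ p ∈ associatedPrimes R (QT ⊤ L), a ∉ p) (y : R)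
    (hy : a * y ∈ L) : y ∈ L := by
  have hr : IsSMulRegular (QT ⊤ L) a := by
    by_contra hc
    have : a ∈ {r | IsSMulRegular (QT ⊤ L) r}ᶜ := hc
    rw [← biUnion_associatedPrimes_eq_compl_regular] at this
    simp only [Set.mem_iUnion] at this
    obtain ⟨p, hp, hap⟩ := this
    exact h p hp hap
  have h1 : a • (Submodule.Quotient.mk ⟨y, trivial⟩ : QT ⊤ L) = 0 := by
    rw [← Submodule.Quotient.mk_smul]
    exact (qt_mk_eq_zero (P := ⊤) (a * y) trivial).2 hy
  have h2 : (Submodule.Quotient.mk ⟨y, trivial⟩ : QT ⊤ L) = 0 := hr (by simpa using h1)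
  exact (qt_mk_eq_zero (P := ⊤) y trivial).1 h2

/-- Hypotheses of the core theorem. -/
structure CoreHyp (R : Type u) [CommRing R] [IsLocalRing R] [IsNoetherianRing R]
    (I : Ideal R) (a : ℕ → R) (d g s : ℕ) : Prop where
  G : GorL R d
  hI : ∀ p : Ideal R, p.IsPrime → I ≤ p → (g : ℕ∞) ≤ p.height
  hg : 1 ≤ g
  ha : ∀ k < s, a k ∈ I
  hG : ∀ k ≤ s, ∀ p : Ideal R, p.IsPrime → I ≤ p → p.height ≤ k →
    ∃ r, r ∉ p ∧ ∀ x ∈ I, r * x ∈ JJ a k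
  hA : ∀ k < s, ∀ p ∈ associatedPrimes R (QT ⊤ (KK a I k)), ¬ I ≤ p → a k ∉ p
  hH : ∀ j, 1 ≤ j → j + g ≤ s → ∀ e, e + g + j ≤ d + 2 → dp R ↥(I ^ j) e

variable {I : Ideal R} {a : ℕ → R} {d g s : ℕ}

namespace CoreHyp

lemma height_I (H : CoreHyp R I a d g s) {k : ℕ} (hk : k ≤ s) (p : Ideal R) (hp : p.IsPrime)
    (hK : KK a I k ≤ p) (hIp : I ≤ p) : ((k + 1 : ℕ) : ℕ∞) ≤ p.height := by
  by_contra! h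
  have h1 : p.height ≤ k := by
    have : ((k+1 : ℕ) : ℕ∞) = (k : ℕ∞) + 1 := by norm_cast
    rw [this] at h
    exact Order.le_of_lt_add_one h
  obtain ⟨r, hr, hx⟩ := H.hG k hk p hp hIp h1
  exact hr (hK hx)

lemma height_K (H : CoreHyp R I a d g s) {k : ℕ} (hk : k ≤ s) : ∀ (p : Ideal R) (_ : p.IsPrime)
    (_ : KK a I k ≤ p), (k : ℕ∞) ≤ p.height := by
  induction k with
  | zero => intro p _ _; simp
  | succ k ih =>
    intro p hp hK
    obtain ⟨q, hq, hqp⟩ := Ideal.exists_minimalPrimes_le ((KK_mono (Nat.le_succ k)).trans hK)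
    have hqP : q.IsPrime := hq.1.1
    by_cases hIq : I ≤ q
    · exact (H.height_I (by omega) q hqP hq.1.2 hIq).trans (Ideal.height_mono hqp)
    · have hass : q ∈ associatedPrimes R (QT ⊤ (KK a I k)) := by
        apply Module.associatedPrimes.minimalPrimes_annihilator_subset_associatedPrimes
        rw [(qtTop (KK a I k)).annihilator_eq, Ideal.annihilator_quotient]
        exact hq
      have hak := H.hA k (by omega) q hass hIq
      have hlt : q < p := by
        refine lt_of_le_of_ne hqp ?_
        rintro rfl
        exact hak (hK (JJ_le_KK (mem_JJ_self k)))
      have h1 := Ideal.height_add_one_le_of_lt_of_isPrime hlt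
      refine le_trans ?_ h1
      push_cast
      exact add_le_add_left (ih (by omega) q hqP hq.1.2) 1

lemma dimLE_K (H : CoreHyp R I a d g s) {k : ℕ} (hk : k ≤ s) (P : Ideal R) (e : ℕ)
    (he : k + e = d) : dimLE R (QT P (KK a I k)) e := by
  intro p hp
  have h1 := H.height_K hk p.asIdeal p.2 ((ann_qt P _).trans hp)
  have h2 := height_add_coheight_le H.G.dim p
  have h3 : (k : ℕ∞) + Order.coheight p ≤ (k : ℕ∞) + (e : ℕ∞) :=
    (add_le_add_left h1 _).trans (h2.trans (by exact_mod_cast he.symm.le))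
  exact (ENat.add_le_add_iff_left (ENat.natCast_ne_top _)).1 h3

/-- The inductive statement. -/
structure St (I : Ideal R) (a : ℕ → R) (d g s i : ℕ) : Prop where
  dpK : ∀ k ≤ i, ∀ e, e + k ≤ d → dp R (QT ⊤ (KK a I k)) e
  KI : ∀ k ≤ i + 1, k ≤ s → ∀ y ∈ I, y ∈ KK a I k → y ∈ JJ a k
  ext : Nonempty (EE R (QT (I ^ (i + 1 - g)) (KK a I i)) R i ≃ₗ[R] (R ⧸ KK a I i))

lemma reg (H : CoreHyp R I a d g s) {k : ℕ} (hk : k < s)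
    (h : ∀ e, e + k ≤ d → dp R (QT ⊤ (KK a I k)) e) (y : R) (hy : a k * y ∈ KK a I k) :
    y ∈ KK a I k := by
  refine reg_of_ass (fun p hp => ?_) y hy
  refine H.hA k hk p hp (fun hIp => ?_)
  have h1 := ass_le H.G.dim h p hp
  have h2 : KK a I k ≤ p := by
    refine (ann_qt ⊤ _).trans ?_
    rw [← Submodule.annihilator_top]
    exact hp.annihilator_le
  have h3 := H.height_I (by omega) p hp.isPrime h2 hIp
  have h4 : ((k + 1 : ℕ) : ℕ∞) ≤ k := h3.trans h1
  have h5 : k + 1 ≤ k := by exact_mod_cast h4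
  omega

/-- `(K_k + a_k) : I ⊆ K_{k+1}` -/
lemma KK_succ (H : CoreHyp R I a d g s) {k : ℕ} (hk : k < s)
    (hKI : ∀ y ∈ I, y ∈ KK a I k → y ∈ JJ a k) (x : R)
    (hx : ∀ b ∈ I, ∃ c, x * b - a k * c ∈ KK a I k) : x ∈ KK a I (k+1) := by
  intro b hb
  obtain ⟨c, hc⟩ := hx b hb
  refine mem_JJ_succ.2 ⟨_, hKI _ ?_ hc, c, by ring⟩
  exact sub_mem (I.mul_mem_left _ hb) (I.mul_mem_right _ (H.ha k hk))

/-- dp of the quotient `P'/(K_k + a_k P)` -/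
lemma dp_C {k : ℕ}
    (hreg : ∀ y, a k * y ∈ KK a I k → y ∈ KK a I k) (P P' : Ideal R)
    (hP : ∀ x ∈ P, a k * x ∈ P') {e : ℕ} (h1 : dp R (QT P (KK a I k)) (e+1))
    (h2 : dp R (QT P' (KK a I k)) e) :
    dp R (QT P' (KK a I k ⊔ Ideal.span {a k} * P)) e := by
  refine dp_right (f := mulQ (a k) hP (fun x _ hx => Ideal.mul_mem_left _ _ hx))
    (g := mulQ 1 (fun x hx => by simpa using hx)
      (fun x _ hx => by rw [one_mul]; exact Submodule.mem_sup_left hx)) ?_ ?_ ?_ h2 h1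
  · exact mulQ_injective _ _ _ (fun x _ hx => hreg x hx)
  · refine mulQ_exact _ _ _ _ _ ?_ ?_
    · intro y hy hy'
      obtain ⟨z, hz, w, hw, rfl⟩ := Submodule.mem_sup.1 hy'
      obtain ⟨v, hv, rfl⟩ := Ideal.mem_span_singleton_mul.1 hw
      exact ⟨v, hv, by simpa using hz⟩
    · intro x hx
      exact Submodule.mem_sup_right (Ideal.mul_mem_mul (Ideal.mem_span_singleton_self _) hx)
  · exact mulQ_one_surj _ _


/-- exactness claim at `(k, j)` inside the induction -/
lemma claim (H : CoreHyp R I a d g s) {i : ℕ} (hi : i + 1 ≤ s) (S : St I a d g s i) {k : ℕ}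
    (hk : k ≤ i) (j : ℕ)
    (hdp : ∀ e, e + (i + 1) ≤ d →
      dp R (QT (I ^ (j+1)) (KK a I k ⊔ Ideal.span {a k} * I ^ j)) e)
    (y : R) (hy : y ∈ I ^ (j+1)) (hyK : y ∈ KK a I (k+1)) :
    y ∈ KK a I k ⊔ Ideal.span {a k} * I ^ j := by
  have hyI : y ∈ I := Ideal.pow_le_self (Nat.succ_ne_zero j) hy
  have hyJ := S.KI (k+1) (by omega) (by omega) y hyI hyK
  refine ass_check hy (fun p hp => ?_)
  have hpp : p.IsPrime := hp.isPrime
  have hh := ass_le H.G.dim hdp p hp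
  by_cases hIp : I ≤ p
  · obtain ⟨h, hh'⟩ := ENat.ne_top_iff_exists.1 (hh.trans_lt (ENat.natCast_lt_top _)).ne
    rw [← hh'] at hh
    have hhi : h ≤ i + 1 := by exact_mod_cast hh
    obtain ⟨r, hr, hrI⟩ := H.hG h (by omega) p hpp hIp hh'.symm.le
    by_cases hhk : h ≤ k
    · refine ⟨r, hr, Submodule.mem_sup_left ?_⟩
      exact Ideal.mul_mem_right _ _ (fun x hx => JJ_mono hhk (hrI x hx))
    · obtain ⟨t, ht, hty⟩ := dseq_loc p.primeCompl a I h (fun l hl => H.ha l (by omega))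
        (fun l hl => S.KI l (by omega) (by omega))
        (fun l hl z hz => H.reg (by omega) (S.dpK l (by omega)) z (JJ_le_KK hz))
        r hr hrI j (h - (k+1)) (k+1) (by omega) y hyJ hy
      refine ⟨t, ht, ?_⟩
      rw [JJ, Ideal.sup_mul] at hty
      have hle : JJ a k * I ^ j ⊔ Ideal.span {a k} * I ^ j ≤ KK a I k ⊔ Ideal.span {a k} * I ^ j :=
        sup_le_sup_right (Ideal.mul_le_left.trans JJ_le_KK) _
      exact hle hty
  · obtain ⟨b, hb, hbp⟩ := Set.not_subset.1 hIp
    refine ⟨b ^ j, fun h => hbp (hpp.mem_of_pow_mem j h), ?_⟩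
    obtain ⟨z, hz, c, rfl⟩ := mem_JJ_succ.1 hyJ
    rw [mul_add]
    refine add_mem (Submodule.mem_sup_left (Ideal.mul_mem_left _ _ (JJ_le_KK hz)))
      (Submodule.mem_sup_right ?_)
    have : b ^ j * (a k * c) = a k * (b ^ j * c) := by ring
    rw [this]
    exact Ideal.mul_mem_mul (Ideal.mem_span_singleton_self _)
      (Ideal.mul_mem_right _ _ (Ideal.pow_mem_pow hb j))

lemma dp_top {P L : Ideal R} (hP : P = ⊤) {e : ℕ} (h : dp R (QT ⊤ L) e) : dp R (QT P L) e := by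
  subst hP; exact h

lemma K0 (H : CoreHyp R I a d g s) (x : R) (hx : x ∈ KK a I 0) : x = 0 := by
  have hx' : x ∈ (⊥ : Ideal R) := by
    refine ass_check (P := ⊤) trivial (fun p hp => ?_)
    have hpp : p.IsPrime := hp.isPrime
    have e : QT (⊤ : Ideal R) ⊥ ≃ₗ[R] R := (qtTop ⊥).trans (Submodule.quotEquivOfEqBot _ rfl)
    have h1 := ass_le (k := 0) H.G.dim (fun e' he' => dp_congr e.symm (dp_mono (by omega) H.G.dpR))
      p hp
    have h2 : ¬ I ≤ p := fun hIp => by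
      have := (H.hI p hpp hIp).trans h1
      have h3 : g ≤ 0 := by exact_mod_cast this
      have := H.hg
      omega
    obtain ⟨b, hb, hbp⟩ := Set.not_subset.1 h2
    refine ⟨b, hbp, ?_⟩
    rw [mul_comm]
    exact hx b hb
  simpa using hx'

/-- depth of `M_{k,j}` -/
lemma dpM (H : CoreHyp R I a d g s) {i : ℕ} (hi : i + 2 ≤ s) (S : St I a d g s i) (k : ℕ) :
    k ≤ i → ∀ j, j + g ≤ i + 2 → ∀ e, e + k ≤ d → (1 ≤ j → e + g + j ≤ d + 2) →
    dp R (QT (I ^ j) (KK a I k)) e := by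
  induction k with
  | zero =>
    intro _ j hj e he hej
    rcases Nat.eq_zero_or_pos j with rfl | hj0
    · exact dp_top (by simp) (S.dpK 0 (by omega) e he)
    · have h1 := H.hH j hj0 (by omega) e (hej hj0)
      refine dp_congr (Submodule.quotEquivOfEqBot _ ?_).symm h1
      rw [Submodule.eq_bot_iff]
      intro x hx
      exact Subtype.ext (H.K0 _ hx)
  | succ k ih =>
    intro hk j hj e he hej
    rcases Nat.eq_zero_or_pos j with rfl | hj0
    · exact dp_top (by simp) (S.dpK _ hk e he)
    · obtain ⟨j, rfl⟩ : ∃ j', j = j' + 1 := ⟨j - 1, by omega⟩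
      have hC : ∀ e, e + (k+1) ≤ d → e + g + (j+1) ≤ d + 2 →
          dp R (QT (I ^ (j+1)) (KK a I k ⊔ Ideal.span {a k} * I ^ j)) e := by
        intro e he hej
        refine dp_C (fun y hy => H.reg (by omega) (S.dpK k (by omega)) y hy) _ _ ?_
          (ih (by omega) j (by omega) (e+1) (by omega) (by omega))
          (ih (by omega) (j+1) (by omega) e (by omega) (by omega))
        intro x hx
        rw [pow_succ']
        exact Ideal.mul_mem_mul (H.ha k (by omega)) hx
      have hcl := H.claim (by omega) S (k := k) (by omega) j
        (fun e he => hC e (by omega) (by omega))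
      refine dp_congr (Submodule.quotEquivOfEq _ _ ?_) (hC e he (hej (by omega)))
      ext ⟨y, hy⟩
      constructor
      · intro h
        have h : y ∈ KK a I k ⊔ Ideal.span {a k} * I ^ j := h
        refine (sup_le (KK_mono (Nat.le_succ k)) ?_ : _ ≤ KK a I (k+1)) h
        refine Ideal.mul_le_left.trans ((Ideal.span_singleton_le_iff_mem _).2 ?_)
        exact JJ_le_KK (mem_JJ_self k)
      · intro h
        exact hcl y hy h


lemma dp_Ctop (H : CoreHyp R I a d g s) {k : ℕ} (hk : k < s)
    (h : ∀ e, e + k ≤ d → dp R (QT ⊤ (KK a I k)) e) (e : ℕ) (he : e + (k+1) ≤ d) :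
    dp R (QT ⊤ (KK a I k ⊔ Ideal.span {a k} * ⊤)) e :=
  dp_C (fun y hy => H.reg hk h y hy) ⊤ ⊤ (fun _ _ => trivial) (h (e+1) (by omega))
    (h e (by omega))

lemma JJ_succ_le (k : ℕ) : JJ a (k+1) ≤ KK a I k ⊔ Ideal.span {a k} * ⊤ := by
  rw [JJ, Ideal.mul_top]
  exact sup_le_sup_right JJ_le_KK _

lemma KIstep (H : CoreHyp R I a d g s) {k : ℕ} (hk : k < s)
    (h : ∀ e, e + k ≤ d → dp R (QT ⊤ (KK a I k)) e)
    (hKI : ∀ y ∈ I, y ∈ KK a I k → y ∈ JJ a k) (y : R) (hy : y ∈ I) (hyK : y ∈ KK a I (k+1)) :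
    y ∈ JJ a (k+1) := by
  have h1 : y ∈ KK a I k ⊔ Ideal.span {a k} * ⊤ := by
    refine ass_check (P := ⊤) trivial (fun p hp => ?_)
    have hpp : p.IsPrime := hp.isPrime
    have hh := ass_le H.G.dim (H.dp_Ctop hk h) p hp
    by_cases hIp : I ≤ p
    · obtain ⟨r, hr, hrI⟩ := H.hG (k+1) (by omega) p hpp hIp hh
      exact ⟨r, hr, JJ_succ_le k (hrI y hy)⟩
    · obtain ⟨b, hb, hbp⟩ := Set.not_subset.1 hIp
      refine ⟨b, hbp, JJ_succ_le k ?_⟩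
      rw [mul_comm]
      exact hyK b hb
  rw [Ideal.mul_top] at h1
  obtain ⟨z, hz, w, hw, rfl⟩ := Submodule.mem_sup.1 h1
  obtain ⟨c, rfl⟩ := Ideal.mem_span_singleton.1 hw
  refine mem_JJ_succ.2 ⟨z, hKI z ?_ hz, c, rfl⟩
  have := sub_mem hy (I.mul_mem_right c (H.ha k hk))
  simpa using this

lemma step (H : CoreHyp R I a d g s) {i : ℕ} (hi : i + 2 ≤ s) (S : St I a d g s i) :
    St I a d g s (i+1) := by
  have hregi := H.reg (by omega) (S.dpK i le_rfl)
  have hmul : ∀ b ∈ I, ∀ x ∈ I ^ (i + 1 - g), b * x ∈ I ^ (i + 1 + 1 - g) := by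
    intro b hb x hx
    by_cases hgi : g ≤ i + 1
    · rw [show i + 1 + 1 - g = (i + 1 - g) + 1 by omega, pow_succ']
      exact Ideal.mul_mem_mul hb hx
    · rw [show i + 1 + 1 - g = 0 by omega]; simp
  have haI : a i ∈ I := H.ha i (by omega)
  have hω : ∀ e, e + i ≤ d → dp R (QT (I ^ (i + 1 - g)) (KK a I i)) e := by
    intro e he
    by_cases hgi : g ≤ i + 1
    · exact H.dpM hi S i le_rfl _ (by omega) e he (by omega)
    · exact dp_top (by rw [show i + 1 - g = 0 by omega]; simp) (S.dpK i le_rfl e he)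
  have hW : ∀ e, e + i ≤ d → dp R (QT (I ^ (i + 1 + 1 - g)) (KK a I i)) e := by
    intro e he
    by_cases hgi : g ≤ i + 1
    · exact H.dpM hi S i le_rfl _ (by omega) e he (by omega)
    · exact dp_top (by rw [show i + 1 + 1 - g = 0 by omega]; simp) (S.dpK i le_rfl e he)
  have key : ∀ y ∈ I ^ (i + 1 + 1 - g), y ∈ KK a I (i+1) →
      ∃ x ∈ I ^ (i + 1 - g), y - a i * x ∈ KK a I i := by
    intro y hy hyK
    have h1 : y ∈ KK a I i ⊔ Ideal.span {a i} * I ^ (i + 1 - g) := by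
      by_cases hgi : g ≤ i + 1
      · have e1 : i + 1 + 1 - g = (i + 1 - g) + 1 := by omega
        rw [e1] at hy
        refine H.claim (by omega) S le_rfl _ ?_ y hy hyK
        intro e he
        rw [← e1]
        exact dp_C hregi _ _ (hmul _ haI) (hω _ (by omega)) (hW _ (by omega))
      · have e1 : i + 1 - g = 0 := by omega
        rw [e1, pow_zero, Ideal.one_eq_top]
        refine ass_check (P := ⊤) trivial (fun p hp => ?_)
        have hpp : p.IsPrime := hp.isPrime
        have hh := ass_le H.G.dim (H.dp_Ctop (by omega) (S.dpK i le_rfl)) p hp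
        have hIp : ¬ I ≤ p := fun hIp => by
          have := (H.hI p hpp hIp).trans hh
          have : g ≤ i + 1 := by exact_mod_cast this
          omega
        obtain ⟨b, hb, hbp⟩ := Set.not_subset.1 hIp
        refine ⟨b, hbp, JJ_succ_le i ?_⟩
        rw [mul_comm]
        exact hyK b hb
    obtain ⟨z, hz, w, hw, rfl⟩ := Submodule.mem_sup.1 h1
    obtain ⟨v, hv, rfl⟩ := Ideal.mem_span_singleton_mul.1 hw
    exact ⟨v, hv, by simpa using hz⟩
  have haK : a i ∈ KK a I (i+1) := JJ_le_KK (mem_JJ_self i)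
  let fm : ∀ b ∈ I, QT (I ^ (i + 1 - g)) (KK a I i) →ₗ[R] QT (I ^ (i + 1 + 1 - g)) (KK a I i) :=
    fun b hb => mulQ b (hmul b hb) (fun x _ hx => Ideal.mul_mem_left _ _ hx)
  let gm : QT (I ^ (i + 1 + 1 - g)) (KK a I i) →ₗ[R] QT (I ^ (i + 1 + 1 - g)) (KK a I (i+1)) :=
    mulQ 1 (fun x hx => by simpa using hx)
      (fun x _ hx => by rw [one_mul]; exact KK_mono (Nat.le_succ i) hx)
  have hf : Function.Injective (fm (a i) haI) := mulQ_injective _ _ _ (fun x _ hx => hregi x hx)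
  have he : Function.Exact (fm (a i) haI) gm :=
    mulQ_exact _ _ _ _ _ key (fun x _ => Ideal.mul_mem_right _ _ haK)
  have hg : Function.Surjective gm := mulQ_one_surj _ _
  have hXV : XV R (QT (I ^ (i + 1 + 1 - g)) (KK a I i)) R (i+1) := by
    by_cases hid : i ≤ d
    · exact H.G.ext_vanish (d - i) _ (hW _ (by omega)) _ (by omega)
    · exact H.G.inj _ _ (by omega)
  obtain ⟨e⟩ := S.ext
  have hext := ext_step hf he hg i hXV (KK a I i) (KK a I (i+1)) I (a i) e
    (H.KK_succ (by omega) (S.KI i (by omega) (by omega))) (ann_qt _ _)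
    (fun b hb => ⟨fm b hb, by
      apply LinearMap.ext
      intro y
      obtain ⟨y, hy, rfl⟩ := qt_surj y
      rw [LinearMap.smul_apply, LinearMap.smul_apply]
      simp only [fm]
      rw [mulQ_mk, mulQ_mk, ← Submodule.Quotient.mk_smul, ← Submodule.Quotient.mk_smul]
      refine congrArg _ (Subtype.ext ?_)
      change a i * (b * y) = b * (a i * y)
      ring⟩)
  have hdpK : ∀ k ≤ i + 1, ∀ e, e + k ≤ d → dp R (QT ⊤ (KK a I k)) e := by
    intro k hk e' he'
    rcases hk.lt_or_eq with hk | rfl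
    · exact S.dpK k (by omega) e' he'
    · obtain ⟨e2⟩ := hext
      have h1 := H.G.dp_ext (d - (i+1)) (i+1) (by omega)
        (QT (I ^ (i + 1 + 1 - g)) (KK a I (i+1)))
        (dp_right hf he hg (hW _ (by omega)) (hω _ (by omega)))
        (H.dimLE_K (by omega) _ _ (by omega))
      exact dp_mono (by omega) (dp_congr (e2.trans (qtTop _).symm) h1)
  refine ⟨hdpK, ?_, hext⟩
  intro k hk hks
  rcases hk.lt_or_eq with hk | rfl
  · exact S.KI k (by omega) hks
  · exact H.KIstep (by omega) (hdpK (i+1) le_rfl) (S.KI (i+1) le_rfl (by omega))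

lemma base (H : CoreHyp R I a d g s) : St I a d g s 0 := by
  have hbot : KK a I 0 = ⊥ := (Submodule.eq_bot_iff _).2 H.K0
  have e : QT (⊤ : Ideal R) (KK a I 0) ≃ₗ[R] R :=
    (qtTop _).trans (Submodule.quotEquivOfEqBot _ hbot)
  have h0 : ∀ k ≤ 0, ∀ e, e + k ≤ d → dp R (QT ⊤ (KK a I k)) e := by
    intro k hk e' he'
    obtain rfl : k = 0 := by omega
    exact dp_congr e.symm (dp_mono (by omega) H.G.dpR)
  have hK0 : ∀ y ∈ I, y ∈ KK a I 0 → y ∈ JJ a 0 := by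
    intro y _ hy
    rw [H.K0 y hy]; exact zero_mem _
  refine ⟨h0, ?_, ?_⟩
  · intro k hk hks
    rcases Nat.eq_zero_or_pos k with rfl | hk0
    · exact hK0
    · obtain rfl : k = 0 + 1 := by omega
      exact H.KIstep (by omega) (h0 0 le_rfl) hK0
  · have hP : I ^ (0 + 1 - g) = ⊤ := by
      have := H.hg
      rw [show 0 + 1 - g = 0 by omega]; simp
    have e2 : QT (I ^ (0 + 1 - g)) (KK a I 0) ≃ₗ[R] R := by rw [hP]; exact e
    exact ⟨(congrE e2.symm R 0).trans
      ((EE0 R R).trans (Submodule.quotEquivOfEqBot _ hbot).symm)⟩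

lemma St_all (H : CoreHyp R I a d g s) (i : ℕ) (hi : i + 1 ≤ s) : St I a d g s i := by
  induction i with
  | zero => exact H.base
  | succ i ih => exact H.step hi (ih (by omega))

/-- Core conclusions. -/
theorem dpK' (H : CoreHyp R I a d g s) (k : ℕ) (hk : k < s) (e : ℕ) (he : e + k ≤ d) :
    dp R (QT ⊤ (KK a I k)) e := (H.St_all k hk).dpK k le_rfl e he

theorem reg' (H : CoreHyp R I a d g s) (k : ℕ) (hk : k < s) (y : R)
    (hy : a k * y ∈ KK a I k) : y ∈ KK a I k := H.reg hk (H.dpK' k hk) y hy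

theorem KI' (H : CoreHyp R I a d g s) (k : ℕ) (hk : k ≤ s) (y : R) (hy : y ∈ I)
    (hyK : y ∈ KK a I k) : y ∈ JJ a k := by
  rcases Nat.eq_zero_or_pos k with rfl | hk0
  · rw [H.K0 y hyK]; exact zero_mem _
  · obtain ⟨k, rfl⟩ : ∃ k', k = k' + 1 := ⟨k - 1, by omega⟩
    exact (H.St_all k hk).KI (k+1) le_rfl hk y hy hyK

end CoreHyp

end Core2

-- Part 6
section Sel

open IsLocalRing Pointwise

variable {R : Type u} [CommRing R]

/-- General elements: avoidance of finitely many ideals. -/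
lemma avoid [IsLocalRing R] (hinf : Infinite (ResidueField R)) (I : Ideal R) (𝒩 : Set (Ideal R)) (hfin : 𝒩.Finite) :
    (∀ N ∈ 𝒩, ¬ I ≤ N) → ∃ x ∈ I, ∀ N ∈ 𝒩, x ∉ N := by
  induction 𝒩, hfin using Set.Finite.induction_on with
  | empty => intro _; exact ⟨0, zero_mem _, by simp⟩
  | @insert N0 𝒩 hN0 hfin ih =>
    intro h
    obtain ⟨x, hx, hxN⟩ := ih (fun N hN => h N (Set.mem_insert_of_mem _ hN))
    obtain ⟨y, hy, hyN⟩ := Set.not_subset.1 (h N0 (Set.mem_insert _ _))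
    let c : ResidueField R → R := fun z => (residue_surjective z).choose
    have hc : ∀ z, residue R (c z) = z := fun z => (residue_surjective z).choose_spec
    have hunit : ∀ z w, z ≠ w → IsUnit (c z - c w) := by
      intro z w hzw
      rw [← residue_ne_zero_iff_isUnit, map_sub, hc, hc]
      exact sub_ne_zero.2 hzw
    by_contra hcon
    push Not at hcon
    have h1 : ∀ z, ∃ N ∈ insert N0 𝒩, x + c z * y ∈ N := fun z =>
      hcon _ (add_mem hx (I.mul_mem_left _ hy))
    choose F hF1 hF2 using h1
    have hfin' : (insert N0 𝒩).Finite := hfin.insert N0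
    have : Finite ↥(insert N0 𝒩) := hfin'
    obtain ⟨z, w, hzw, hzw'⟩ := Finite.exists_ne_map_eq_of_infinite
      (fun z => (⟨F z, hF1 z⟩ : ↥(insert N0 𝒩)))
    have hFF : F z = F w := congrArg Subtype.val hzw'
    have hz := hF2 z
    have hw := hF2 w
    rw [← hFF] at hw
    have hyF : y ∈ F z := by
      have := sub_mem hz hw
      rw [show x + c z * y - (x + c w * y) = (c z - c w) * y by ring] at this
      obtain ⟨u, hu⟩ := hunit z w hzw
      rw [← hu] at this
      have h2 := (F z).mul_mem_left (↑u⁻¹ : R) this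
      simpa using h2
    have hxF : x ∈ F z := by
      have := sub_mem hz ((F z).mul_mem_left (c z) hyF)
      simpa using this
    rcases Set.mem_insert_iff.1 (hF1 z) with h3 | h3
    · rw [h3] at hyF; exact hyN hyF
    · exact hxN _ h3 hxF

/-- locally generated by `t` elements modulo `J` -/
def GenAt (I J p : Ideal R) (t : ℕ) : Prop :=
  ∃ r, r ∉ p ∧ ∃ f : Fin t → R, (∀ i, f i ∈ I) ∧ ∀ x ∈ I, r * x ∈ J ⊔ Ideal.span (Set.range f)

/-- ideal defining the locus of non-generation by `t` elements -/
def aT (I J : Ideal R) (t : ℕ) : Ideal R :=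
  Ideal.span {r | ∃ f : Fin t → R, (∀ i, f i ∈ I) ∧ ∀ x ∈ I, r * x ∈ J ⊔ Ideal.span (Set.range f)}

lemma genAt_iff (I J p : Ideal R) (t : ℕ) : GenAt I J p t ↔ ¬ aT I J t ≤ p := by
  unfold aT GenAt
  rw [Ideal.span_le, Set.not_subset]
  constructor
  · rintro ⟨r, h1, h2⟩; exact ⟨r, h2, h1⟩
  · rintro ⟨r, h1, h2⟩; exact ⟨r, h2, h1⟩

lemma GenAt.succ {I J p : Ideal R} {t : ℕ} (h : GenAt I J p t) : GenAt I J p (t+1) := by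
  obtain ⟨r, hr, f, hf, hx⟩ := h
  refine ⟨r, hr, Fin.cons 0 f, ?_, fun x hxI => ?_⟩
  · intro i
    refine Fin.cases ?_ (fun j => ?_) i
    · simp
    · simpa using hf j
  · have h1 : Ideal.span (Set.range f) ≤ Ideal.span (Set.range (Fin.cons 0 f : Fin (t+1) → R)) := by
      apply Ideal.span_mono
      rintro _ ⟨i, rfl⟩
      exact ⟨i.succ, by simp⟩
    exact sup_le_sup_left h1 J (hx x hxI)

lemma GenAt.mono {I J J' p : Ideal R} {t t' : ℕ} (h : GenAt I J p t) (ht : t ≤ t') (hJ : J ≤ J') :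
    GenAt I J' p t' := by
  have h1 : GenAt I J' p t := by
    obtain ⟨r, hr, f, hf, hx⟩ := h
    exact ⟨r, hr, f, hf, fun x hxI => sup_le_sup_right hJ _ (hx x hxI)⟩
  clear h
  induction ht with
  | refl => exact h1
  | step _ ih => exact ih.succ

lemma GenAt.zero {I J p : Ideal R} (h : GenAt I J p 0) : ∃ r, r ∉ p ∧ ∀ x ∈ I, r * x ∈ J := by
  obtain ⟨r, hr, f, hf, hx⟩ := h
  refine ⟨r, hr, fun x hxI => ?_⟩
  have := hx x hxI
  rwa [Set.range_eq_empty, Ideal.span_empty, sup_bot_eq] at this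

/-- `{x : x ∈ J + pI locally at p}` -/
def NP (I J : Ideal R) (p : PrimeSpectrum R) : Ideal R where
  carrier := {x | ∃ r, r ∉ p.asIdeal ∧ r * x ∈ J ⊔ p.asIdeal * I}
  add_mem' := by
    rintro x y ⟨r, hr, hx⟩ ⟨s, hs, hy⟩
    refine ⟨r * s, p.2.mul_notMem hr hs, ?_⟩
    have : r * s * (x + y) = s * (r * x) + r * (s * y) := by ring
    rw [this]
    exact add_mem (Ideal.mul_mem_left _ _ hx) (Ideal.mul_mem_left _ _ hy)
  zero_mem' := ⟨1, p.2.one_notMem, by simp⟩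
  smul_mem' := by
    rintro c x ⟨r, hr, hx⟩
    refine ⟨r, hr, ?_⟩
    have : r * (c • x) = c * (r * x) := by rw [smul_eq_mul]; ring
    rw [this]
    exact Ideal.mul_mem_left _ _ hx

/-- uniform multiplier for a finitely generated ideal -/
lemma uniform_mult {I L p : Ideal R} (hp : p.IsPrime) (hI : I.FG)
    (h : ∀ x ∈ I, ∃ r, r ∉ p ∧ r * x ∈ L) : ∃ r, r ∉ p ∧ ∀ x ∈ I, r * x ∈ L := by
  obtain ⟨S, rfl⟩ := hI
  have h1 : ∀ T : Finset R, T ⊆ S → ∃ r, r ∉ p ∧ ∀ x ∈ T, r * x ∈ L := by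
    classical
    intro T
    induction T using Finset.induction_on with
    | empty => intro _; exact ⟨1, hp.one_notMem, by simp⟩
    | insert b T _ ih =>
      intro hT
      obtain ⟨r, hr, hrT⟩ := ih (fun x hx => hT (Finset.mem_insert_of_mem hx))
      obtain ⟨s, hs, hsb⟩ := h b (Ideal.subset_span (hT (Finset.mem_insert_self _ _)))
      refine ⟨r * s, hp.mul_notMem hr hs, fun x hx => ?_⟩
      rcases Finset.mem_insert.1 hx with rfl | hx
      · rw [mul_assoc]; exact Ideal.mul_mem_left _ _ hsb
      · rw [mul_comm r s, mul_assoc]; exact Ideal.mul_mem_left _ _ (hrT x hx)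
  obtain ⟨r, hr, hrS⟩ := h1 S le_rfl
  refine ⟨r, hr, fun x hx => ?_⟩
  refine Submodule.span_induction (p := fun x _ => r * x ∈ L) ?_ ?_ ?_ ?_ hx
  · intro x hx; exact hrS x hx
  · simp
  · intro x y _ _ h1 h2; rw [mul_add]; exact add_mem h1 h2
  · intro c x _ h1; rw [smul_eq_mul, mul_left_comm]; exact Ideal.mul_mem_left _ _ h1

lemma not_le_NP [IsNoetherianRing R] {I J : Ideal R} (hJI : J ≤ I) (p : PrimeSpectrum R)
    (h : ¬ GenAt I J p.asIdeal 0) : ¬ I ≤ NP I J p := by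
  intro hle
  apply h
  obtain ⟨r, hr, hrI⟩ := uniform_mult (L := J ⊔ p.asIdeal * I) p.2 (IsNoetherian.noetherian I)
    (fun x hx => hle hx)
  let M := QT I J
  have hrange : LinearMap.range (r • (LinearMap.id : M →ₗ[R] M)) ≤ p.asIdeal • ⊤ := by
    rintro _ ⟨y, rfl⟩
    obtain ⟨y, hy, rfl⟩ := qt_surj y
    obtain ⟨z, hz, w, hw, hzw⟩ := Submodule.mem_sup.1 (hrI y hy)
    have hwI : w ∈ I := Ideal.mul_le_right hw
    have e1 : (r • (LinearMap.id : M →ₗ[R] M)) (Submodule.Quotient.mk ⟨y, hy⟩)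
        = (Submodule.Quotient.mk ⟨w, hwI⟩ : M) := by
      rw [LinearMap.smul_apply, LinearMap.id_apply, ← Submodule.Quotient.mk_smul,
        ← sub_eq_zero, ← Submodule.Quotient.mk_sub]
      refine (qt_mk_eq_zero (r * y - w) (sub_mem (I.mul_mem_left _ hy) hwI)).2 ?_
      rw [← hzw]; simpa using hz
    rw [e1]
    have key : ∀ w (hw : w ∈ p.asIdeal * I), ∃ hwI : w ∈ I,
        (Submodule.Quotient.mk ⟨w, hwI⟩ : M) ∈ p.asIdeal • (⊤ : Submodule R M) := by
      intro w hw
      refine Submodule.mul_induction_on hw ?_ ?_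
      · intro m hm n hn
        refine ⟨I.mul_mem_left _ hn, ?_⟩
        have : (Submodule.Quotient.mk ⟨m * n, I.mul_mem_left _ hn⟩ : M)
          = m • Submodule.Quotient.mk ⟨n, hn⟩ := rfl
        rw [this]
        exact Submodule.smul_mem_smul hm trivial
      · rintro x y ⟨hx, hx'⟩ ⟨hy, hy'⟩
        exact ⟨add_mem hx hy, add_mem hx' hy'⟩
    exact (key w hw).2
  obtain ⟨P, hP1, -, hP2, hP3⟩ :=
    LinearMap.exists_monic_and_natDegree_eq_and_coeff_mem_pow_and_aeval_eq_zero R _ _ hrange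
  refine ⟨P.eval r, ?_, Fin.elim0, fun i => i.elim0, fun x hx => Submodule.mem_sup_left ?_⟩
  · rw [Polynomial.eval_eq_sum_range, Finset.sum_range_succ]
    intro hmem
    apply hr
    have h1 : ∑ i ∈ Finset.range P.natDegree, P.coeff i * r ^ i ∈ p.asIdeal := by
      refine Ideal.sum_mem _ (fun i hi => Ideal.mul_mem_right _ _ ?_)
      have hi' := Finset.mem_range.1 hi
      exact Ideal.pow_le_self (by omega) (hP2 i)
    have h2 := (Ideal.add_mem_iff_right _ h1).1 hmem
    rw [hP1.coeff_natDegree, one_mul] at h2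
    exact p.2.mem_of_pow_mem _ h2
  · have h1 : (Polynomial.aeval (r • (LinearMap.id : M →ₗ[R] M))) P
        (Submodule.Quotient.mk ⟨x, hx⟩) = 0 := by rw [hP3]; rfl
    have h2 : r • (LinearMap.id : M →ₗ[R] M) = algebraMap R (Module.End R M) r := rfl
    rw [h2, Polynomial.aeval_algebraMap_apply, Polynomial.aeval_def] at h1
    have h3 : (Submodule.Quotient.mk ⟨P.eval r * x, I.mul_mem_left _ hx⟩ : M) = 0 := by
      rw [← h1]; simp [Polynomial.eval₂_id]; rfl
    exact (qt_mk_eq_zero _ _).1 h3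

/-- dropping a generator -/
lemma GenAt.drop {I J : Ideal R} (p : PrimeSpectrum R) {t : ℕ} (h : GenAt I J p.asIdeal (t+1))
    {b : R} (hb : b ∉ NP I J p) (hbI : b ∈ I) : GenAt I (J ⊔ Ideal.span {b}) p.asIdeal t := by
  obtain ⟨r, hr, f, hf, hx⟩ := h
  obtain ⟨j, hj, w, hw, hjw⟩ := Submodule.mem_sup.1 (hx b hbI)
  obtain ⟨c, rfl⟩ := (Ideal.mem_span_range_iff_exists_fun).1 hw
  have : ∃ i, c i ∉ p.asIdeal := by
    by_contra hcon
    push Not at hcon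
    refine hb ⟨r, hr, ?_⟩
    rw [← hjw]
    refine add_mem (Submodule.mem_sup_left hj) (Submodule.mem_sup_right ?_)
    exact Ideal.sum_mem _ (fun i _ => Ideal.mul_mem_mul (hcon i) (hf i))
  obtain ⟨i, hi⟩ := this
  refine ⟨c i * r, p.2.mul_notMem hi hr, fun l => f (i.succAbove l), fun l => hf _, fun x hxI => ?_⟩
  set L := J ⊔ Ideal.span {b} ⊔ Ideal.span (Set.range fun l => f (i.succAbove l)) with hL
  have hJL : J ≤ L := le_sup_left.trans le_sup_left
  have hbL : b ∈ L := Submodule.mem_sup_left (Submodule.mem_sup_right (Ideal.mem_span_singleton_self b))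
  have hoL : ∀ l, f (i.succAbove l) ∈ L := fun l =>
    Submodule.mem_sup_right (Ideal.subset_span ⟨l, rfl⟩)
  have hciL : c i * f i ∈ L := by
    rw [Fin.sum_univ_succAbove _ i] at hjw
    have : c i * f i = r * b - j - ∑ l, c (i.succAbove l) * f (i.succAbove l) := by
      rw [← hjw]; ring
    rw [this]
    exact sub_mem (sub_mem (Ideal.mul_mem_left _ _ hbL) (hJL hj))
      (Ideal.sum_mem _ (fun l _ => Ideal.mul_mem_left _ _ (hoL l)))
  rw [mul_assoc]
  obtain ⟨j', hj', w', hw', hjw'⟩ := Submodule.mem_sup.1 (hx x hxI)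
  obtain ⟨c', rfl⟩ := (Ideal.mem_span_range_iff_exists_fun).1 hw'
  rw [← hjw', mul_add, Fin.sum_univ_succAbove _ i, mul_add]
  refine add_mem (Ideal.mul_mem_left _ _ (hJL hj')) (add_mem ?_ ?_)
  · rw [show c i * (c' i * f i) = c' i * (c i * f i) by ring]
    exact Ideal.mul_mem_left _ _ hciL
  · exact Ideal.mul_mem_left _ _ (Ideal.sum_mem _ (fun l _ => Ideal.mul_mem_left _ _ (hoL l)))

/-- the invariant step -/
lemma inv_step [IsNoetherianRing R] {I J : Ideal R} (hJI : J ≤ I) {k ℓ : ℕ}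
    (hinv : ∀ p : PrimeSpectrum R, I ≤ p.asIdeal → ∀ h : ℕ, p.asIdeal.height = h → h ≤ ℓ →
      GenAt I J p.asIdeal (h - k)) {b : R} (hbI : b ∈ I)
    (hb : ∀ t < ℓ, ∀ p : PrimeSpectrum R, p.asIdeal ∈ (aT I J t ⊔ I).minimalPrimes →
      ¬ I ≤ NP I J p → b ∉ NP I J p) :
    ∀ p : PrimeSpectrum R, I ≤ p.asIdeal → ∀ h : ℕ, p.asIdeal.height = h → h ≤ ℓ →
      GenAt I (J ⊔ Ideal.span {b}) p.asIdeal (h - (k+1)) := by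
  intro p hIp h hh hl
  have h0 := hinv p hIp h hh hl
  by_cases hk : h ≤ k
  · exact h0.mono (by omega) le_sup_left
  by_cases hbad : GenAt I J p.asIdeal (h - (k+1))
  · exact hbad.mono le_rfl le_sup_left
  have hle : aT I J (h - (k+1)) ≤ p.asIdeal := by
    by_contra hc; exact hbad ((genAt_iff _ _ _ _).2 hc)
  have hmin : p.asIdeal ∈ (aT I J (h - (k+1)) ⊔ I).minimalPrimes := by
    have hpp := p.2
    obtain ⟨q, hq, hqp⟩ := Ideal.exists_minimalPrimes_le (sup_le hle hIp)
    have hqP : q.IsPrime := hq.1.1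
    rcases hqp.eq_or_lt with rfl | hlt
    · exact hq
    · exfalso
      have h1 := Ideal.height_add_one_le_of_lt_of_isPrime hlt
      rw [hh] at h1
      obtain ⟨h', hh'⟩ := ENat.ne_top_iff_exists.1
        ((le_self_add.trans h1).trans_lt (ENat.natCast_lt_top _)).ne
      rw [← hh'] at h1
      have h2 : h' + 1 ≤ h := by exact_mod_cast h1
      have h3 := hinv ⟨q, hqP⟩ (le_sup_right.trans hq.1.2) h' hh'.symm (by omega)
      exact (genAt_iff _ _ _ _).1 (h3.mono (show h' - k ≤ h - (k+1) by omega) le_rfl)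
        (le_sup_left.trans hq.1.2)
  have hnb := hb (h - (k+1)) (by omega) p hmin
    (not_le_NP hJI p (fun hc => hbad (hc.mono (by omega) le_rfl)))
  rw [show h - k = (h - (k+1)) + 1 by omega] at h0
  exact h0.drop p hnb hbI

end Sel

-- Part 7
section ReesGr

open IsLocalRing Pointwise Polynomial

variable {R : Type u} [CommRing R]

/-- `b ↦ b t` -/
def tL (I : Ideal R) : I →ₗ[R] reesAlgebra I where
  toFun b := ⟨monomial 1 b.1, reesAlgebra.monomial_mem.2 (by simp)⟩
  map_add' x y := Subtype.ext (by simp)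
  map_smul' r x := Subtype.ext (by simp [smul_monomial])

@[simp] lemma tL_val (I : Ideal R) (b : I) : (tL I b : R[X]) = monomial 1 b.1 := rfl

/-- homogeneous components -/
def hc {I : Ideal R} (f : reesAlgebra I) (n : ℕ) : reesAlgebra I :=
  ⟨monomial n (f.1.coeff n), reesAlgebra.monomial_mem.2 (f.2 n)⟩

lemma hc_val {I : Ideal R} (f : reesAlgebra I) (n : ℕ) :
    (hc f n : R[X]) = monomial n (f.1.coeff n) := rfl

lemma sum_hc {I : Ideal R} (f : reesAlgebra I) :
    ∑ n ∈ Finset.range (f.1.natDegree + 1), hc f n = f := by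
  apply Subtype.ext
  rw [AddSubmonoidClass.coe_finsetSum]
  exact (f.1.as_sum_range' _ (Nat.lt_succ_self _)).symm

/-- the ambient grading homomorphism -/
def Theta (R : Type u) [CommRing R] : R[X] →+* R[X][X] :=
  eval₂RingHom ((C : R[X] →+* R[X][X]).comp C) (C X * X)

lemma Theta_monomial (n : ℕ) (r : R) : Theta R (monomial n r) = monomial n (monomial n r) := by
  simp only [Theta, coe_eval₂RingHom, eval₂_monomial, RingHom.comp_apply]
  rw [mul_pow, ← C_pow, ← mul_assoc, ← C_mul, C_mul_X_pow_eq_monomial, C_mul_X_pow_eq_monomial]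

lemma Theta_coeff (f : R[X]) (n : ℕ) : (Theta R f).coeff n = monomial n (f.coeff n) := by
  induction f using Polynomial.induction_on' with
  | add p q hp hq => rw [map_add, coeff_add, hp, hq, coeff_add, map_add]
  | monomial m r =>
    rw [Theta_monomial, coeff_monomial, coeff_monomial]
    split_ifs with h
    · rw [h]
    · simp

/-- the grading map on elements -/
def thFun {I : Ideal R} (f : reesAlgebra I) : (reesAlgebra I)[X] :=
  ∑ n ∈ Finset.range (f.1.natDegree + 1), monomial n (hc f n)

lemma thFun_coeff {I : Ideal R} (f : reesAlgebra I) (n : ℕ) : (thFun f).coeff n = hc f n := by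
  unfold thFun
  rw [finsetSum_coeff]
  simp only [coeff_monomial, Finset.sum_ite_eq', Finset.mem_range]
  split_ifs with h
  · rfl
  · apply Subtype.ext
    rw [hc_val, coeff_eq_zero_of_natDegree_lt (by omega)]; simp

/-- coefficientwise inclusion -/
abbrev valM (I : Ideal R) : (reesAlgebra I)[X] →+* R[X][X] :=
  mapRingHom (reesAlgebra I).val.toRingHom

lemma valM_injective (I : Ideal R) : Function.Injective (valM I) :=
  map_injective _ Subtype.val_injective

lemma valM_thFun {I : Ideal R} (f : reesAlgebra I) : valM I (thFun f) = Theta R f.1 := by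
  ext1 n
  rw [coe_mapRingHom, coeff_map, thFun_coeff, Theta_coeff]
  rfl

/-- the grading homomorphism -/
def th (I : Ideal R) : reesAlgebra I →+* (reesAlgebra I)[X] where
  toFun := thFun
  map_one' := valM_injective I (by rw [valM_thFun, map_one]; exact map_one _)
  map_mul' f g := valM_injective I (by rw [valM_thFun, map_mul, valM_thFun, valM_thFun]; exact map_mul _ _ _)
  map_zero' := valM_injective I (by rw [valM_thFun, map_zero]; exact map_zero _)
  map_add' f g := valM_injective I (by rw [valM_thFun, map_add, valM_thFun, valM_thFun]; exact map_add _ _ _)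

lemma th_coeff {I : Ideal R} (f : reesAlgebra I) (n : ℕ) : (th I f).coeff n = hc f n :=
  thFun_coeff f n

/-- homogeneous core -/
def core {I : Ideal R} (Q : Ideal (reesAlgebra I)) : Ideal (reesAlgebra I) :=
  (Q.map C).comap (th I)

lemma mem_core {I : Ideal R} {Q : Ideal (reesAlgebra I)} {f : reesAlgebra I} :
    f ∈ core Q ↔ ∀ n, hc f n ∈ Q := by
  unfold core
  rw [Ideal.mem_comap, Ideal.mem_map_C_iff]
  simp only [th_coeff]

lemma core_le {I : Ideal R} (Q : Ideal (reesAlgebra I)) : core Q ≤ Q := by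
  intro f hf
  rw [← sum_hc f]
  exact Ideal.sum_mem _ (fun n _ => mem_core.1 hf n)

lemma core_prime {I : Ideal R} (Q : Ideal (reesAlgebra I)) [hQ : Q.IsPrime] : (core Q).IsPrime := by
  unfold core
  have : (Q.map (C : (reesAlgebra I) →+* (reesAlgebra I)[X])).IsPrime := Ideal.isPrime_map_C_of_isPrime
  exact Ideal.comap_isPrime _ _

lemma hc_algebraMap {I : Ideal R} (r : R) (n : ℕ) :
    hc (algebraMap R (reesAlgebra I) r) n = if n = 0 then algebraMap R (reesAlgebra I) r else 0 := by
  apply Subtype.ext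
  rw [hc_val]
  have : ((algebraMap R (reesAlgebra I) r : reesAlgebra I) : R[X]) = C r := rfl
  rw [this, coeff_C]
  split_ifs with h
  · rw [this, h, monomial_zero_left]
  · simp

lemma hc_tL {I : Ideal R} (b : I) (n : ℕ) :
    hc (tL I b) n = if n = 1 then tL I b else 0 := by
  apply Subtype.ext
  rw [hc_val, tL_val, coeff_monomial]
  split_ifs with h h' h'
  · rw [tL_val, ← h]
  · omega
  · omega
  · simp

lemma hc_zero {I : Ideal R} (f : reesAlgebra I) :
    hc f 0 = algebraMap R (reesAlgebra I) (f.1.coeff 0) := by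
  apply Subtype.ext
  rw [hc_val, monomial_zero_left]; rfl

variable [IsLocalRing R]

/-- `mA` -/
def mA (I : Ideal R) : Ideal (reesAlgebra I) :=
  (maximalIdeal R).map (algebraMap R (reesAlgebra I))

/-- `mA + (a_0 t, …, a_{k-1} t)` -/
def LL {I : Ideal R} (a : ℕ → I) : ℕ → Ideal (reesAlgebra I)
  | 0 => mA I
  | k+1 => LL a k ⊔ Ideal.span {tL I (a k)}

/-- the homogeneous maximal ideal -/
def MM (I : Ideal R) : Ideal (reesAlgebra I) :=
  (maximalIdeal R).comap (constantCoeff.comp (reesAlgebra I).val.toRingHom)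

lemma mem_MM {I : Ideal R} {f : reesAlgebra I} : f ∈ MM I ↔ f.1.coeff 0 ∈ maximalIdeal R := by
  rfl

instance MM_prime (I : Ideal R) : (MM I).IsPrime := Ideal.comap_isPrime _ _

lemma LL_mono {I : Ideal R} (a : ℕ → I) {k l : ℕ} (h : k ≤ l) : LL a k ≤ LL a l := by
  induction h with
  | refl => exact le_rfl
  | step _ ih => exact ih.trans le_sup_left

lemma mA_le_LL {I : Ideal R} (a : ℕ → I) (k : ℕ) : mA I ≤ LL a k := LL_mono a (Nat.zero_le k)

lemma LL_le_core {I : Ideal R} (a : ℕ → I) (k : ℕ) (Q : Ideal (reesAlgebra I)) (h : LL a k ≤ Q) :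
    LL a k ≤ core Q := by
  induction k with
  | zero =>
    refine Ideal.map_le_iff_le_comap.2 (fun r hr => ?_)
    rw [Ideal.mem_comap, mem_core]
    intro n
    rw [hc_algebraMap]
    split_ifs
    · exact h (Ideal.mem_map_of_mem _ hr)
    · exact zero_mem _
  | succ k ih =>
    refine sup_le (ih (le_sup_left.trans h)) ((Ideal.span_singleton_le_iff_mem _).2 ?_)
    rw [mem_core]
    intro n
    rw [hc_tL]
    split_ifs
    · exact h (Submodule.mem_sup_right (Ideal.mem_span_singleton_self _))
    · exact zero_mem _

lemma core_le_MM {I : Ideal R} (Q : Ideal (reesAlgebra I)) (hQ : Q ≠ ⊤) : core Q ≤ MM I := by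
  intro f hf
  rw [mem_MM]
  by_contra hc0
  have h1 := mem_core.1 hf 0
  rw [hc_zero] at h1
  have hu : IsUnit (f.1.coeff 0) := by
    by_contra h; exact hc0 ((mem_maximalIdeal _).2 h)
  exact hQ (Ideal.eq_top_of_isUnit_mem _ h1 (hu.map _))

lemma minimal_le_MM {I : Ideal R} (a : ℕ → I) (k : ℕ) (Q : Ideal (reesAlgebra I))
    (hQ : Q ∈ (LL a k).minimalPrimes) : Q ≤ MM I := by
  have hp : Q.IsPrime := hQ.1.1
  have h1 : Q ≤ core Q := hQ.2 ⟨core_prime Q, LL_le_core a k Q hQ.1.2⟩ (core_le Q)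
  exact h1.trans (core_le_MM Q hp.ne_top)

/-- the degree one part of `Q` as an ideal of `R` -/
def NQ {I : Ideal R} (Q : Ideal (reesAlgebra I)) : Ideal R :=
  ((Q.restrictScalars R).comap (tL I)).map I.subtype

lemma mem_NQ {I : Ideal R} {Q : Ideal (reesAlgebra I)} (b : I) : (b : R) ∈ NQ Q ↔ tL I b ∈ Q := by
  unfold NQ
  rw [Submodule.mem_map]
  constructor
  · rintro ⟨c, hc, hcb⟩
    have : c = b := Subtype.ext hcb
    rw [← this]; exact hc
  · intro h; exact ⟨b, h, rfl⟩

/-- every prime over `LL a ℓ` contains `It` -/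
lemma red_of_general {I : Ideal R} {ℓ : ℕ} (a : ℕ → I)
    (hγ : ∀ k < ℓ, ∀ Q ∈ (LL a k).minimalPrimes, ¬ I ≤ NQ Q → (a k : R) ∉ NQ Q)
    (hchain : ∀ Q : ℕ → Ideal (reesAlgebra I), (∀ k ≤ ℓ, (Q k).IsPrime ∧ mA I ≤ Q k) →
      (∀ k < ℓ, Q k < Q (k+1)) → ¬ Q ℓ < MM I)
    (P : Ideal (reesAlgebra I)) (hP : P.IsPrime) (hLP : LL a ℓ ≤ P) : I ≤ NQ P := by
  obtain ⟨Q, hQ, hQP⟩ := Ideal.exists_minimalPrimes_le hLP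
  suffices h : I ≤ NQ Q by
    intro b hb
    exact (mem_NQ ⟨b, hb⟩).2 (hQP ((mem_NQ ⟨b, hb⟩).1 (h hb)))
  by_contra hcon
  have hex : ∀ n ≤ ℓ, ∃ q : ℕ → Ideal (reesAlgebra I), q ℓ = Q ∧
      (∀ k, ℓ ≤ k + n → k ≤ ℓ → q k ∈ (LL a k).minimalPrimes ∧ q k ≤ Q) ∧
      (∀ k, ℓ ≤ k + n → k < ℓ → q k < q (k+1)) := by
    intro n
    induction n with
    | zero =>
      intro _
      refine ⟨fun _ => Q, rfl, fun k h1 h2 => ?_, fun k h1 h2 => by omega⟩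
      obtain rfl : k = ℓ := by omega
      exact ⟨hQ, le_rfl⟩
    | succ n ih =>
      intro hn
      obtain ⟨q, hq0, hq1, hq2⟩ := ih (by omega)
      obtain ⟨m, hm⟩ : ∃ m, ℓ = m + n + 1 := ⟨ℓ - n - 1, by omega⟩
      have hm1 := hq1 (m+1) (by omega) (by omega)
      have hmP : (q (m+1)).IsPrime := hm1.1.1.1
      obtain ⟨q', hq', hq'le⟩ := Ideal.exists_minimalPrimes_le
        ((LL_mono a (Nat.le_succ m)).trans hm1.1.1.2)
      have hlt : q' < q (m+1) := by
        refine lt_of_le_of_ne hq'le ?_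
        rintro rfl
        have h1 : ¬ I ≤ NQ (q (m+1)) := by
          intro hle
          apply hcon
          intro b hb
          exact (mem_NQ ⟨b, hb⟩).2 (hm1.2 ((mem_NQ ⟨b, hb⟩).1 (hle hb)))
        refine hγ m (by omega) _ hq' h1 ((mem_NQ _).2 (hm1.1.1.2 ?_))
        exact Submodule.mem_sup_right (Ideal.mem_span_singleton_self _)
      refine ⟨Function.update q m q', ?_, ?_, ?_⟩
      · rw [Function.update_of_ne (by omega)]; exact hq0
      · intro k h1 h2
        by_cases hkm : k = m
        · subst hkm
          rw [Function.update_self]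
          exact ⟨hq', hq'le.trans hm1.2⟩
        · rw [Function.update_of_ne hkm]
          exact hq1 k (by omega) h2
      · intro k h1 h2
        by_cases hkm : k = m
        · subst hkm
          rw [Function.update_self, Function.update_of_ne (by omega)]
          exact hlt
        · rw [Function.update_of_ne hkm, Function.update_of_ne (by omega)]
          exact hq2 k (by omega) h2
  obtain ⟨q, hq0, hq1, hq2⟩ := hex ℓ le_rfl
  refine hchain q (fun k hk => ?_) (fun k hk => hq2 k (by omega) hk) ?_
  · have := (hq1 k (by omega) hk).1
    exact ⟨this.1.1, (mA_le_LL a k).trans this.1.2⟩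
  · rw [hq0]
    refine lt_of_le_of_ne (minimal_le_MM a ℓ Q hQ) ?_
    intro he
    apply hcon
    intro b hb
    refine (mem_NQ ⟨b, hb⟩).2 ?_
    rw [he, mem_MM, tL_val]
    simp [coeff_monomial]

end ReesGr

-- Part 8
section MainLocal

open IsLocalRing Pointwise Polynomial

/-- The hypotheses over a ring with infinite residue field. -/
structure MainHyp (R : Type u) [CommRing R] [IsLocalRing R] [IsNoetherianRing R]
    (I : Ideal R) (d g ℓ : ℕ) : Prop where
  G : GorL R d
  hI : ∀ p : Ideal R, p.IsPrime → I ≤ p → (g : ℕ∞) ≤ p.height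
  hIm : I ≤ maximalIdeal R
  hg : 1 ≤ g
  hinf : Infinite (ResidueField R)
  hGen : ∀ p : PrimeSpectrum R, I ≤ p.asIdeal → ∀ h : ℕ, p.asIdeal.height = h → h ≤ ℓ →
      GenAt I ⊥ p.asIdeal h
  hH : ∀ j, 1 ≤ j → j + g ≤ ℓ → ∀ e, e + g + j ≤ d + 2 → dp R ↥(I ^ j) e
  hchain : ∀ Q : ℕ → Ideal (reesAlgebra I), (∀ k ≤ ℓ, (Q k).IsPrime ∧ mA I ≤ Q k) →
      (∀ k < ℓ, Q k < Q (k+1)) → ¬ Q ℓ < MM I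

variable {R : Type u} [CommRing R] [IsLocalRing R] [IsNoetherianRing R]
variable {I : Ideal R} {d g ℓ : ℕ}

/-- the bad ideals at a stage -/
def badSet (I : Ideal R) (ℓ : ℕ) (J : Ideal R) (L : Ideal (reesAlgebra I)) : Set (Ideal R) :=
  (⋃ t ∈ Finset.range ℓ, (fun p : PrimeSpectrum R => NP I J p) ''
    {p | p.asIdeal ∈ (aT I J t ⊔ I).minimalPrimes}) ∪
  associatedPrimes R (QT ⊤ (J.colon (I : Set R))) ∪ (NQ '' L.minimalPrimes)

lemma badSet_finite (I : Ideal R) (ℓ : ℕ) (J : Ideal R) (L : Ideal (reesAlgebra I)) :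
    (badSet I ℓ J L).Finite := by
  unfold badSet
  refine ((Set.Finite.biUnion (Finset.finite_toSet _) (fun t _ => ?_)).union
    (associatedPrimes.finite R _)).union ?_
  · apply Set.Finite.image
    have := Ideal.finite_minimalPrimes_of_isNoetherianRing R (aT I J t ⊔ I)
    refine Set.Finite.of_finite_image (f := PrimeSpectrum.asIdeal) (this.subset ?_) ?_
    · rintro _ ⟨p, hp, rfl⟩; exact hp
    · intro p _ q _ h; exact PrimeSpectrum.ext h
  · apply Set.Finite.image
    exact Ideal.finite_minimalPrimes_of_isNoetherianRing _ L

lemma exists_pick (hinf : Infinite (ResidueField R)) (I : Ideal R) (ℓ : ℕ) (J : Ideal R)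
    (L : Ideal (reesAlgebra I)) :
    ∃ b : I, ∀ N ∈ badSet I ℓ J L, ¬ I ≤ N → (b : R) ∉ N := by
  obtain ⟨x, hx, h⟩ := avoid hinf I {N | N ∈ badSet I ℓ J L ∧ ¬ I ≤ N}
    ((badSet_finite I ℓ J L).subset (fun N h => h.1)) (fun N h => h.2)
  exact ⟨⟨x, hx⟩, fun N h1 h2 => h N ⟨h1, h2⟩⟩

lemma exists_general (hinf : Infinite (ResidueField R)) (I : Ideal R) (ℓ : ℕ) :
    ∃ a : ℕ → I, ∀ k, ∀ N ∈ badSet I ℓ (JJ (fun k => (a k : R)) k) (LL a k), ¬ I ≤ N →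
      (a k : R) ∉ N := by
  choose pick hpick using fun (s : Ideal R × Ideal (reesAlgebra I)) => exists_pick hinf I ℓ s.1 s.2
  let st : ℕ → Ideal R × Ideal (reesAlgebra I) := fun n => Nat.rec (⊥, mA I)
    (fun _ s => (s.1 ⊔ Ideal.span {(pick s : R)}, s.2 ⊔ Ideal.span {tL I (pick s)})) n
  have h : ∀ k, JJ (fun k => (pick (st k) : R)) k = (st k).1 ∧ LL (fun k => pick (st k)) k = (st k).2 := by
    intro k
    induction k with
    | zero => exact ⟨rfl, rfl⟩
    | succ k ih => rw [JJ, LL, ih.1, ih.2]; exact ⟨rfl, rfl⟩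
  refine ⟨fun k => pick (st k), fun k => ?_⟩
  rw [(h k).1, (h k).2]
  exact hpick (st k)

lemma KK_eq_colon (a : ℕ → R) (I : Ideal R) (k : ℕ) : KK a I k = (JJ a k).colon (I : Set R) := by
  ext r
  rw [mem_KK, Submodule.mem_colon]
  rfl

lemma coeff_LL {I : Ideal R} (a : ℕ → I) (k : ℕ) : ∀ f ∈ LL a k, ∀ n,
    f.1.coeff (n+1) ∈ maximalIdeal R * I ^ (n+1) ⊔ JJ (fun k => (a k : R)) k * I ^ n := by
  induction k with
  | zero =>
    intro f hf n
    refine Submodule.mem_sup_left ?_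
    have : mA I ≤ (({ carrier := {f : reesAlgebra I | ∀ n, f.1.coeff n ∈ maximalIdeal R * I ^ n}
                      zero_mem' := fun n => by simp
                      add_mem' := fun {f g} hf hg n => by
                        simpa using add_mem (hf n) (hg n)
                      smul_mem' := fun c f hf n => by
                        change (c.1 * f.1).coeff n ∈ _
                        rw [coeff_mul]
                        refine Ideal.sum_mem _ (fun x hx => ?_)
                        rw [Finset.HasAntidiagonal.mem_antidiagonal] at hx
                        rw [← hx, pow_add, mul_left_comm]
                        exact Ideal.mul_mem_mul (c.2 x.1) (hf x.2) } : Ideal (reesAlgebra I))) := by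
      refine Ideal.map_le_iff_le_comap.2 (fun r hr n => ?_)
      change (C r).coeff n ∈ _
      rw [coeff_C]
      split_ifs with h
      · rw [h]; simpa using hr
      · exact zero_mem _
    exact this hf (n+1)
  | succ k ih =>
    intro f hf n
    rw [LL] at hf
    obtain ⟨f1, hf1, w, hw, rfl⟩ := Submodule.mem_sup.1 hf
    obtain ⟨c, rfl⟩ := Ideal.mem_span_singleton.1 hw
    change (f1.1 + (tL I (a k)).1 * c.1).coeff (n+1) ∈ _
    rw [coeff_add]
    refine add_mem ?_ ?_
    · have hmono : JJ (fun k => (a k : R)) k * I ^ n ≤ JJ (fun k => (a k : R)) (k+1) * I ^ n :=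
        Ideal.mul_mono_left (JJ_mono (Nat.le_succ k))
      exact (sup_le (le_sup_left) (hmono.trans le_sup_right) : _ ≤ _) (ih f1 hf1 n)
    · refine Submodule.mem_sup_right ?_
      rw [tL_val, ← C_mul_X_eq_monomial, mul_assoc, coeff_C_mul, X_mul, coeff_mul_X]
      exact Ideal.mul_mem_mul (mem_JJ_self (a := fun k => (a k : R)) k) (c.2 n)

lemma tL_prod_mem (I : Ideal R) (L : Ideal (reesAlgebra I)) (N : ℕ)
    (h : (Ideal.span (Set.range (tL I))) ^ N ≤ L) (y : R) (hy : y ∈ I ^ N) :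
    (⟨monomial N y, reesAlgebra.monomial_mem.2 hy⟩ : reesAlgebra I) ∈ L := by
  apply h
  clear h
  induction N generalizing y with
  | zero => simp
  | succ N ih =>
    have key : ∀ y (hy : y ∈ I ^ N * I), ∃ z : reesAlgebra I, z.1 = monomial (N+1) y ∧ 
        z ∈ (Ideal.span (Set.range (tL I))) ^ (N+1) := by
      intro y hy
      refine Submodule.mul_induction_on hy ?_ ?_
      · intro m hm n hn
        refine ⟨_, ?_, Ideal.mul_mem_mul (ih m hm) (Ideal.subset_span ⟨⟨n, hn⟩, rfl⟩)⟩
        change monomial N m * monomial 1 n = _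
        rw [monomial_mul_monomial]
      · rintro x y ⟨z, hz1, hz2⟩ ⟨w, hw1, hw2⟩
        refine ⟨z + w, ?_, add_mem hz2 hw2⟩
        change z.1 + w.1 = _
        rw [hz1, hw1, map_add]
    obtain ⟨z, hz1, hz2⟩ := key y (by rwa [← pow_succ])
    have : z = ⟨monomial (N+1) y, reesAlgebra.monomial_mem.2 hy⟩ := Subtype.ext hz1
    rwa [← this]

lemma pow_le_JJ {I : Ideal R} (a : ℕ → I)
    (h : ∀ P : Ideal (reesAlgebra I), P.IsPrime → LL a ℓ ≤ P → I ≤ NQ P) :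
    ∃ N, I ^ (N+1) ≤ JJ (fun k => (a k : R)) ℓ := by
  have h1 : Ideal.span (Set.range (tL I)) ≤ (LL a ℓ).radical := by
    rw [Ideal.radical_eq_sInf]
    refine le_sInf ?_
    rintro P ⟨hLP, hP⟩
    rw [Ideal.span_le]
    rintro _ ⟨b, rfl⟩
    exact (mem_NQ b).1 (h P hP hLP b.2)
  obtain ⟨N, hN⟩ := Ideal.exists_pow_le_of_le_radical_of_fg h1 (IsNoetherian.noetherian _)
  refine ⟨N, ?_⟩
  have h2 : I ^ (N+1) ≤ JJ (fun k => (a k : R)) ℓ ⊔ maximalIdeal R • I ^ (N+1) := by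
    intro y hy
    have := tL_prod_mem I (LL a ℓ) (N+1) ((Ideal.pow_le_pow_right (Nat.le_succ N)).trans hN) y hy
    have h3 := coeff_LL a ℓ _ this N
    simp only [coeff_monomial, if_true] at h3
    exact (sup_le le_sup_right (Ideal.mul_le_left.trans le_sup_left) :
      maximalIdeal R * I ^ (N+1) ⊔ JJ (fun k => (a k : R)) ℓ * I ^ N ≤ _) h3
  exact Submodule.le_of_le_smul_of_le_jacobson_bot (IsNoetherian.noetherian _)
    (by rw [IsLocalRing.jacobson_eq_maximalIdeal _ bot_ne_top]) h2

theorem MainHyp.exists_core (H : MainHyp R I d g ℓ) :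
    ∃ a : ℕ → I, CoreHyp R I (fun k => (a k : R)) d g ℓ ∧ I ≤ JJ (fun k => (a k : R)) ℓ ∧ 1 ≤ ℓ := by
  obtain ⟨a, ha⟩ := exists_general H.hinf I ℓ
  set a' : ℕ → R := fun k => (a k : R) with ha'
  have hinv : ∀ k, ∀ p : PrimeSpectrum R, I ≤ p.asIdeal → ∀ h : ℕ, p.asIdeal.height = h → h ≤ ℓ →
      GenAt I (JJ a' k) p.asIdeal (h - k) := by
    intro k
    induction k with
    | zero => exact H.hGen
    | succ k ih =>
      refine inv_step (JJ_le (s := k) (fun j _ => (a j).2) le_rfl) ih (a k).2 ?_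
      intro t ht p hp
      refine ha k (NP I (JJ a' k) p) (Or.inl (Or.inl ?_))
      simp only [Set.mem_iUnion]
      exact ⟨t, Finset.mem_range.2 ht, p, hp, rfl⟩
  have HC : CoreHyp R I a' d g ℓ :=
    { G := H.G, hI := H.hI, hg := H.hg, ha := fun k _ => (a k).2
      hG := by
        intro k hk p hp hIp hh
        obtain ⟨h, hh'⟩ := ENat.ne_top_iff_exists.1 (ne_top_of_le_ne_top (ENat.natCast_ne_top k) hh)
        rw [← hh'] at hh
        have hhk : h ≤ k := by exact_mod_cast hh
        have := hinv k ⟨p, hp⟩ hIp h hh'.symm (by omega)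
        rw [Nat.sub_eq_zero_of_le hhk] at this
        exact this.zero
      hA := by
        intro k hk p hp
        refine ha k p (Or.inl (Or.inr ?_))
        rwa [← KK_eq_colon a' I k]
      hH := H.hH }
  have hred := red_of_general (ℓ := ℓ) a (fun k _ Q hQ => ha k (NQ Q) (Or.inr ⟨Q, hQ, rfl⟩)) H.hchain
  obtain ⟨N, hN⟩ := pow_le_JJ (ℓ := ℓ) a hred
  have hcont : ∀ p : Ideal R, p.IsPrime → JJ a' ℓ ≤ p → I ≤ p := by
    intro p hp hle
    exact hp.le_of_pow_le (hN.trans hle)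
  have hl : 1 ≤ ℓ := by
    by_contra hl
    obtain rfl : ℓ = 0 := by omega
    obtain ⟨p, hp⟩ : (minimalPrimes R).Nonempty := by
      obtain ⟨p, hp, _⟩ := Ideal.exists_minimalPrimes_le (bot_le : (⊥ : Ideal R) ≤ maximalIdeal R)
      exact ⟨p, hp⟩
    have hpp : p.IsPrime := hp.1.1
    have h1 := H.hI p hpp (hcont p hpp bot_le)
    rw [Ideal.height_eq_zero_iff.2 hp] at h1
    have := H.hg
    have : g ≤ 0 := by exact_mod_cast h1
    omega
  refine ⟨a, HC, ?_, hl⟩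
  obtain ⟨k, rfl⟩ : ∃ k, ℓ = k + 1 := ⟨ℓ - 1, by omega⟩
  intro y hy
  have hk : k < k + 1 := Nat.lt_succ_self k
  have h1 : y ∈ KK a' I k ⊔ Ideal.span {a' k} * ⊤ := by
    refine ass_check (P := ⊤) trivial (fun p hp => ?_)
    have hpp : p.IsPrime := hp.isPrime
    have hh := ass_le HC.G.dim (HC.dp_Ctop hk (HC.dpK' k hk)) p hp
    have hJp : JJ a' (k+1) ≤ p := by
      refine (CoreHyp.JJ_succ_le (I := I) k).trans ?_
      refine (ann_qt ⊤ _).trans ?_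
      exact le_of_eq_of_le Submodule.annihilator_top.symm (IsAssociatedPrime.annihilator_le hp)
    obtain ⟨r, hr, hrI⟩ := HC.hG (k+1) le_rfl p hpp (hcont p hpp hJp) hh
    exact ⟨r, hr, CoreHyp.JJ_succ_le k (hrI y hy)⟩
  rw [Ideal.mul_top] at h1
  obtain ⟨z, hz, w, hw, rfl⟩ := Submodule.mem_sup.1 h1
  obtain ⟨c, rfl⟩ := Ideal.mem_span_singleton.1 hw
  refine mem_JJ_succ.2 ⟨z, HC.KI' k (by omega) z ?_ hz, c, rfl⟩
  have := sub_mem hy (I.mul_mem_right c (HC.ha k hk))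
  simpa using this

end MainLocal

-- Part 9
section LinType

open IsLocalRing Pointwise Polynomial

variable {R : Type u} [CommRing R]

theorem linType_abs {I : Ideal R} {a : ℕ → R} {ℓ : ℕ} (ha : ∀ k < ℓ, a k ∈ I) (hIJ : I ≤ JJ a ℓ)
    (hreg : ∀ k < ℓ, ∀ y, a k * y ∈ KK a I k → y ∈ KK a I k)
    (hKI : ∀ k ≤ ℓ, ∀ y ∈ I, y ∈ KK a I k → y ∈ JJ a k)
    {S : Type v} [CommRing S] [Algebra R S] (lam : I →ₗ[R] S) (ε : S →ₐ[R] R[X])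
    (hε : ∀ x : I, ε (lam x) = monomial 1 (x : R))
    (hgen : ∀ z : S, z ∈ ⨆ n : ℕ, (LinearMap.range lam) ^ n) :
    ∀ z : S, ε z = 0 → z = 0 := by
  set V := LinearMap.range lam with hV
  have h_int : ∀ j k, k ≤ ℓ → ∀ y ∈ JJ a k, y ∈ I ^ (j+1) → y ∈ JJ a k * I ^ j := by
    intro j k hk y hy hyI
    obtain ⟨t, ht, h⟩ := dseq_loc (⊥ : Submonoid R) a I ℓ ha (fun k hk => hKI k hk.le)
      (fun k hk y hy => hreg k hk y (JJ_le_KK hy)) 1 (Submonoid.mem_bot.2 rfl)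
      (fun x hx => by rw [one_mul]; exact hIJ hx) j (ℓ - k) k (by omega) y hy hyI
    rw [Submonoid.mem_bot.1 ht, one_mul] at h
    exact h
  -- images
  have hVn : ∀ n, ∀ z ∈ V ^ n, ∃ y ∈ I ^ n, ε z = monomial n y := by
    intro n
    induction n with
    | zero =>
      intro z hz
      rw [pow_zero] at hz
      obtain ⟨r, rfl⟩ := Submodule.mem_one.1 hz
      refine ⟨r, by simp, ?_⟩
      rw [AlgHom.commutes]; rfl
    | succ n ih =>
      intro z hz
      rw [pow_succ] at hz
      refine Submodule.mul_induction_on hz ?_ ?_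
      · rintro m hm _ ⟨x, rfl⟩
        obtain ⟨y, hy, hy'⟩ := ih m hm
        refine ⟨y * x, ?_, ?_⟩
        · rw [pow_succ]; exact Ideal.mul_mem_mul hy x.2
        · rw [map_mul, hy', hε, monomial_mul_monomial]
      · rintro z w ⟨y, hy, hy'⟩ ⟨x, hx, hx'⟩
        exact ⟨y + x, add_mem hy hx, by rw [map_add, hy', hx', map_add]⟩
  let U : ℕ → Submodule R S := fun i => Submodule.map lam (Submodule.comap I.subtype (JJ a i))
  have hUV : ∀ i, U i ≤ V := fun i => by
    rintro _ ⟨x, _, rfl⟩; exact ⟨x, rfl⟩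
  have hUn : ∀ i ≤ ℓ, ∀ n, ∀ z ∈ U i * V ^ n, ∃ y ∈ JJ a i * I ^ n, ε z = monomial (n+1) y := by
    intro i hi n z hz
    refine Submodule.mul_induction_on hz ?_ ?_
    · rintro _ ⟨x, hx, rfl⟩ w hw
      obtain ⟨y, hy, hy'⟩ := hVn n w hw
      refine ⟨x * y, Ideal.mul_mem_mul hx hy, ?_⟩
      rw [map_mul, hy', hε, monomial_mul_monomial, add_comm 1 n]
    · rintro z w ⟨y, hy, hy'⟩ ⟨x, hx, hx'⟩
      exact ⟨y + x, add_mem hy hx, by rw [map_add, hy', hx', map_add]⟩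
  have hVsurj : ∀ n, ∀ y ∈ I ^ n, ∃ z ∈ V ^ n, ε z = monomial n y := by
    intro n
    induction n with
    | zero =>
      intro y _
      refine ⟨algebraMap R S y, ?_, ?_⟩
      · rw [pow_zero]; exact Submodule.mem_one.2 ⟨y, rfl⟩
      · rw [AlgHom.commutes]; rfl
    | succ n ih =>
      intro y hy
      rw [pow_succ] at hy
      refine Submodule.mul_induction_on hy ?_ ?_
      · intro m hm x hx
        obtain ⟨z, hz, hz'⟩ := ih m hm
        refine ⟨z * lam ⟨x, hx⟩, ?_, ?_⟩
        · rw [pow_succ]; exact Submodule.mul_mem_mul hz ⟨_, rfl⟩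
        · rw [map_mul, hz', hε, monomial_mul_monomial]
      · rintro y x ⟨z, hz, hz'⟩ ⟨w, hw, hw'⟩
        exact ⟨z + w, add_mem hz hw, by rw [map_add, hz', hw', map_add]⟩
  have hUsurj : ∀ i ≤ ℓ, ∀ n, ∀ y ∈ JJ a i * I ^ n, ∃ z ∈ U i * V ^ n, ε z = monomial (n+1) y := by
    intro i hi n y hy
    refine Submodule.mul_induction_on hy ?_ ?_
    · intro m hm x hx
      obtain ⟨z, hz, hz'⟩ := hVsurj n x hx
      refine ⟨lam ⟨m, JJ_le ha hi hm⟩ * z, Submodule.mul_mem_mul ⟨_, hm, rfl⟩ hz, ?_⟩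
      rw [map_mul, hz', hε, monomial_mul_monomial, add_comm 1 n]
    · rintro y x ⟨z, hz, hz'⟩ ⟨w, hw, hw'⟩
      exact ⟨z + w, add_mem hz hw, by rw [map_add, hz', hw', map_add]⟩
  have hU0 : U 0 = ⊥ := by
    rw [eq_bot_iff]
    rintro _ ⟨x, hx, rfl⟩
    have : x = 0 := Subtype.ext hx
    rw [this, map_zero]; exact zero_mem _
  have hUl : U ℓ = V := by
    refine le_antisymm (hUV ℓ) ?_
    rintro _ ⟨x, rfl⟩
    exact ⟨x, hIJ x.2, rfl⟩
  have hUsucc : ∀ i, i < ℓ → ∀ n, ∀ z ∈ U (i+1) * V ^ n, ∃ hi : a i ∈ I, ∃ w ∈ V ^ n, ∃ h ∈ U i * V ^ n,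
      z = lam ⟨a i, hi⟩ * w + h := by
    intro i hi n z hz
    refine ⟨ha i hi, ?_⟩
    refine Submodule.mul_induction_on hz ?_ ?_
    · rintro _ ⟨x, hx, rfl⟩ w hw
      obtain ⟨y, hy, c, hc⟩ := mem_JJ_succ.1 hx
      refine ⟨c • w, Submodule.smul_mem _ _ hw, lam ⟨y, JJ_le ha hi.le hy⟩ * w,
        Submodule.mul_mem_mul ⟨_, hy, rfl⟩ hw, ?_⟩
      have : x = c • (⟨a i, ha i hi⟩ : I) + ⟨y, JJ_le ha hi.le hy⟩ := by
        apply Subtype.ext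
        change (x : R) = c * a i + y
        have hc' : (x : R) = y + a i * c := by first | exact hc | exact hc.symm
        rw [hc']; ring
      rw [this, map_add, map_smul, add_mul, smul_mul_assoc, mul_smul_comm]
    · rintro z z' ⟨w, hw, h, hh, rfl⟩ ⟨w', hw', h', hh', rfl⟩
      exact ⟨w + w', add_mem hw hw', h + h', add_mem hh hh', by ring⟩
  have hmono : ∀ {n} {y : R}, monomial n y = (0 : R[X]) → y = 0 := fun {n y} h =>
    (monomial_eq_zero_iff _ _).1 h
  have main : ∀ n, ∀ z ∈ V ^ n, ε z = 0 → z = 0 := by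
    intro n
    induction n with
    | zero =>
      intro z hz h0
      rw [pow_zero] at hz
      obtain ⟨r, rfl⟩ := Submodule.mem_one.1 hz
      rw [AlgHom.commutes] at h0
      have : r = 0 := C_eq_zero.1 h0
      rw [this, map_zero]
    | succ n ih =>
      have hi : ∀ i ≤ ℓ, ∀ z ∈ U i * V ^ n, ε z = 0 → z = 0 := by
        intro i
        induction i with
        | zero =>
          intro _ z hz _
          rw [hU0, Submodule.bot_mul] at hz
          simpa using hz
        | succ i ihi =>
          intro hil z hz h0
          obtain ⟨haiI, w, hw, h, hh, rfl⟩ := hUsucc i hil n z hz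
          obtain ⟨y, hy, hy'⟩ := hVn n w hw
          obtain ⟨x, hx, hx'⟩ := hUn i (by omega) n h hh
          rw [map_add, map_mul, hε, hy', hx', monomial_mul_monomial, add_comm 1 n, ← map_add] at h0
          have h1 : a i * y + x = 0 := hmono h0
          have h2 : a i * y ∈ JJ a i := by
            rw [eq_neg_of_add_eq_zero_left h1]
            exact neg_mem (Ideal.mul_le_left hx)
          refine ihi (by omega) _ (add_mem ?_ hh) (by
            rw [map_add, map_mul, hε, hy', hx', monomial_mul_monomial, add_comm 1 n, ← map_add, h1,
              map_zero])
          rcases n with _ | n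
          · rw [pow_zero] at hw
            obtain ⟨r, rfl⟩ := Submodule.mem_one.1 hw
            rw [AlgHom.commutes] at hy'
            have hry : r = y := by
              have : C r = C y := hy'
              exact C_injective this
            subst hry
            rw [mul_comm (lam _), ← Algebra.smul_def, ← map_smul, pow_zero, mul_one]
            refine ⟨_, ?_, rfl⟩
            change r * a i ∈ JJ a i
            rwa [mul_comm]
          · have h3 : y ∈ KK a I i := hreg i hil y (JJ_le_KK h2)
            have h4 := hKI i (by omega) y ((Ideal.pow_le_self (Nat.succ_ne_zero n)) hy) h3
            have h5 := h_int n i (by omega) y h4 hy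
            obtain ⟨w', hw', hw''⟩ := hUsurj i (by omega) n y h5
            have h6 : w = w' := by
              rw [← sub_eq_zero]
              refine ih _ (sub_mem hw ?_) (by rw [map_sub, hy', hw'', sub_self])
              rw [pow_succ']
              exact mul_le_mul' (hUV i) (le_refl (V ^ n)) hw'
            rw [h6, pow_succ', ← mul_assoc, mul_comm (U i) V, mul_assoc]
            exact Submodule.mul_mem_mul ⟨_, rfl⟩ hw'
      intro z hz
      refine hi ℓ le_rfl z ?_
      rwa [hUl, ← pow_succ']
  intro z hz
  obtain ⟨f, hf, rfl⟩ := (Submodule.mem_iSup_iff_exists_finsupp _ _).1 (hgen z)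
  rw [Finsupp.sum]
  refine Finset.sum_eq_zero (fun n hn => main n _ (hf n) ?_)
  obtain ⟨y, hy, hy'⟩ := hVn n _ (hf n)
  have : (ε (f.sum fun _ xi => xi)).coeff n = y := by
    rw [Finsupp.sum, map_sum, finsetSum_coeff, Finset.sum_eq_single n]
    · rw [hy']; simp
    · intro b _ hb
      obtain ⟨x, hx, hx'⟩ := hVn b _ (hf b)
      rw [hx', coeff_monomial, if_neg hb]
    · intro h; exact absurd hn h
  rw [hz] at this
  rw [hy', ← this]; simp

end LinType

-- Part 10
section ExtOne

open CategoryTheory CategoryTheory.Abelian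

variable {R : Type u} [CommRing R] {A B C N : Type u} [AddCommGroup A] [Module R A]
  [AddCommGroup B] [Module R B] [AddCommGroup C] [Module R C] [AddCommGroup N] [Module R N]
  {f : A →ₗ[R] B} {g : B →ₗ[R] C}

lemma exists_mk0 (x : EE R A N 0) : ∃ φ : A →ₗ[R] N, x = Ext.mk₀ (ModuleCat.ofHom φ) := by
  obtain ⟨y, hy⟩ := Ext.addEquiv₀.symm.surjective x
  exact ⟨y.hom, hy.symm⟩

lemma mk0_inj {φ ψ : A →ₗ[R] N} (h : Ext.mk₀ (ModuleCat.ofHom φ) = Ext.mk₀ (ModuleCat.ofHom ψ)) :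
    φ = ψ := by
  have : ModuleCat.ofHom φ = ModuleCat.ofHom ψ := Ext.addEquiv₀.symm.injective h
  exact congrArg ModuleCat.Hom.hom this

lemma preE_mk0 (ψ : B →ₗ[R] N) : preE f N 0 (Ext.mk₀ (ModuleCat.ofHom ψ)) =
    Ext.mk₀ (ModuleCat.ofHom (ψ ∘ₗ f)) := by
  simp [preE, ModuleCat.ofHom_comp]

lemma extend_of_XV1 (hf : Function.Injective f) (he : Function.Exact f g)
    (hg : Function.Surjective g) (h : XV R C N 1) (φ : A →ₗ[R] N) :
    ∃ ψ : B →ₗ[R] N, ψ ∘ₗ f = φ := by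
  have h1 : delE hf he hg N 0 (Ext.mk₀ (ModuleCat.ofHom φ)) = 0 := Subsingleton.elim (h := h) _ _
  obtain ⟨y, hy⟩ := (preE_exact_left hf he hg N 0 _).1 h1
  obtain ⟨ψ, rfl⟩ := exists_mk0 y
  rw [preE_mk0] at hy
  exact ⟨ψ, mk0_inj hy⟩

lemma XV1_of_extend (hf : Function.Injective f) (he : Function.Exact f g)
    (hg : Function.Surjective g) (hB : XV R B N 1)
    (h : ∀ φ : A →ₗ[R] N, ∃ ψ : B →ₗ[R] N, ψ ∘ₗ f = φ) : XV R C N 1 := by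
  refine subsingleton_of_forall_eq 0 fun x => ?_
  have h1 : preE g N 1 x = 0 := Subsingleton.elim (h := hB) _ _
  obtain ⟨y, hy⟩ := (preE_exact_right hf he hg N 0 _).1 h1
  obtain ⟨φ, rfl⟩ := exists_mk0 y
  obtain ⟨ψ, rfl⟩ := h φ
  rw [← hy, (preE_exact_left hf he hg N 0 _).2 ⟨_, preE_mk0 ψ⟩]

end ExtOne

section FlatExt

open IsLocalRing Pointwise RingTheory.Sequence

variable {R R' : Type u} [CommRing R] [CommRing R'] [Algebra R R'] [Module.Flat R R']
  [IsNoetherianRing R] [IsNoetherianRing R']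

lemma XV_baseChange (i : ℕ) : ∀ (N : Type u) [AddCommGroup N] [Module R N] [Module.Finite R N],
    XV R N R (i+1) → XV R' (R' ⊗[R] N) R' (i+1) := by
  induction i with
  | zero =>
    intro N _ _ _ h
    obtain ⟨n, π, hπ⟩ := Module.Finite.exists_fin' R N
    set Z := LinearMap.ker π
    have he : Function.Exact Z.subtype π := LinearMap.exact_subtype_ker_map π
    have hf : Function.Injective Z.subtype := Subtype.val_injective
    have hf' : Function.Injective (Z.subtype.baseChange R') := 
      Module.Flat.lTensor_preserves_injective_linearMap (M := R') Z.subtype hf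
    have he' : Function.Exact (Z.subtype.baseChange R') (π.baseChange R') :=
      lTensor_exact R' he hπ
    have hg' : Function.Surjective (π.baseChange R') := LinearMap.lTensor_surjective R' hπ
    refine XV1_of_extend hf' he' hg' (XV_projective 0) (fun φ => ?_)
    let φ0 : Z →ₗ[R] R' := (φ.restrictScalars R) ∘ₗ (TensorProduct.mk R R' Z 1)
    have : Module.FinitePresentation R Z := Module.finitePresentation_of_finite R Z
    obtain ⟨k, h₂, h₃, hh⟩ := Module.Flat.exists_factorization_of_finitePresentation φ0
    have : ∀ j : Fin k, ∃ ψ : (Fin n → R) →ₗ[R] R, ψ ∘ₗ Z.subtype = (Finsupp.lapply j) ∘ₗ h₂ :=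
      fun j => extend_of_XV1 hf he hπ h _
    choose ψ hψ using this
    let Ψ : (Fin n → R) →ₗ[R] (Fin k →₀ R) :=
      (Finsupp.linearEquivFunOnFinite R R (Fin k)).symm.toLinearMap ∘ₗ LinearMap.pi ψ
    have hΨ : Ψ ∘ₗ Z.subtype = h₂ := by
      ext z j
      exact LinearMap.congr_fun (hψ j) z
    refine ⟨LinearMap.liftBaseChange R' (h₃ ∘ₗ Ψ), ?_⟩
    apply LinearMap.restrictScalars_injective R
    apply TensorProduct.ext'
    intro r z
    simp only [LinearMap.coe_restrictScalars, LinearMap.comp_apply, LinearMap.baseChange_tmul,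
      LinearMap.liftBaseChange_tmul]
    have h1 : Ψ (Z.subtype z) = h₂ z := LinearMap.congr_fun hΨ z
    rw [h1]
    have h2 : h₃ (h₂ z) = φ (1 ⊗ₜ z) := (LinearMap.congr_fun hh z).symm
    rw [h2, ← map_smul, TensorProduct.smul_tmul', smul_eq_mul, mul_one]
  | succ i ih =>
    intro N _ _ _ h
    obtain ⟨n, π, hπ⟩ := Module.Finite.exists_fin' R N
    set Z := LinearMap.ker π
    have he : Function.Exact Z.subtype π := LinearMap.exact_subtype_ker_map π
    have hf : Function.Injective Z.subtype := Subtype.val_injective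
    have hf' : Function.Injective (Z.subtype.baseChange R') := 
      Module.Flat.lTensor_preserves_injective_linearMap (M := R') Z.subtype hf
    have he' : Function.Exact (Z.subtype.baseChange R') (π.baseChange R') :=
      lTensor_exact R' he hπ
    have hg' : Function.Surjective (π.baseChange R') := LinearMap.lTensor_surjective R' hπ
    exact XV_right_con hf' he' hg' (XV_projective (i+1))
      (ih Z (XV_left_con hf he hπ (XV_projective i) h))

variable [IsLocalRing R] [IsLocalRing R']

lemma dp_baseChange (hm : (maximalIdeal R).map (algebraMap R R') ≤ maximalIdeal R') {n : ℕ}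
    {M N : Type u} [AddCommGroup M] [Module R M]
    [Module.Finite R M] [AddCommGroup N] [Module R N] [Module R' N] [IsScalarTower R R' N]
    {f : M →ₗ[R] N} (hf : IsBaseChange R' f) (h : dp R M n) : dp R' N n := by
  obtain ⟨rs, h1, h2, h3⟩ := exists_weaklyRegular n M h
  have := dp_of_weaklyRegular (rs.map (algebraMap R R')) (by
    intro r hr
    obtain ⟨s, hs, rfl⟩ := List.mem_map.1 hr
    exact hm (Ideal.mem_map_of_mem _ (h2 s hs))) N (h3.of_flat_of_isBaseChange hf)
  rwa [List.length_map, h1] at this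

lemma height_under_le (P : Ideal R') [P.IsPrime] : (P.under R).height ≤ P.height := by
  rw [Ideal.height_eq_height_add_of_liesOver_of_hasGoingDown (P.under R) P]
  exact le_self_add

lemma dim_eq (hm : (maximalIdeal R).map (algebraMap R R') = maximalIdeal R') :
    ringKrullDim R' = ringKrullDim R := by
  rw [← maximalIdeal_height_eq_ringKrullDim, ← maximalIdeal_height_eq_ringKrullDim]
  have h0 : (maximalIdeal R').LiesOver (maximalIdeal R) := ⟨by
    refine (maximalIdeal.isMaximal R).eq_of_le (Ideal.IsPrime.ne_top inferInstance) ?_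
    exact Ideal.map_le_iff_le_comap.1 hm.le⟩
  rw [Ideal.height_eq_height_add_of_liesOver_of_hasGoingDown (maximalIdeal R) (maximalIdeal R'), hm,
    Ideal.map_quotient_self]
  simp

/-- base change of an ideal -/
def idealBC (I : Ideal R) : I →ₗ[R] ↥(I.map (algebraMap R R')) where
  toFun x := ⟨algebraMap R R' x, Ideal.mem_map_of_mem _ x.2⟩
  map_add' x y := Subtype.ext (by simp)
  map_smul' r x := Subtype.ext (by simp [Algebra.smul_def])

lemma idealBC_isBaseChange (I : Ideal R) : IsBaseChange R' (idealBC (R' := R') I) := by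
  let φ : R' ⊗[R] I →ₗ[R'] ↥(I.map (algebraMap R R')) := LinearMap.liftBaseChange R' (idealBC I)
  have hφ : ∀ r x, (φ (r ⊗ₜ x) : R') = r * algebraMap R R' x := by
    intro r x
    simp only [φ, LinearMap.liftBaseChange_tmul]
    rfl
  have hinj : Function.Injective φ := by
    have h1 : Function.Injective (I.subtype.lTensor R') :=
      Module.Flat.lTensor_preserves_injective_linearMap I.subtype Subtype.val_injective
    have h2 : Function.Injective ((TensorProduct.rid R R') ∘ (I.subtype.lTensor R')) :=
      (TensorProduct.rid R R').injective.comp h1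
    have h3 : ∀ z, (TensorProduct.rid R R') (I.subtype.lTensor R' z) = (φ z : R') := by
      intro z
      induction z with
      | zero => simp
      | add x y hx hy => rw [map_add, map_add, hx, hy, map_add]; rfl
      | tmul r x =>
        rw [hφ]
        simp [Algebra.smul_def, mul_comm]
    intro x y hxy
    apply h2
    simp only [Function.comp_apply, h3, hxy]
  have hsurj : Function.Surjective φ := by
    have : ∀ y ∈ I.map (algebraMap R R'), ∃ z, (φ z : R') = y := by
      intro y hy
      refine Submodule.span_induction ?_ ?_ ?_ ?_ hy
      · rintro _ ⟨x, hx, rfl⟩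
        exact ⟨1 ⊗ₜ ⟨x, hx⟩, by rw [hφ]; simp⟩
      · exact ⟨0, by simp⟩
      · rintro _ _ _ _ ⟨z, rfl⟩ ⟨w, rfl⟩; exact ⟨z + w, by rw [map_add]; rfl⟩
      · rintro a _ _ ⟨z, rfl⟩; exact ⟨a • z, by rw [map_smul]; rfl⟩
    rintro ⟨y, hy⟩
    obtain ⟨z, hz⟩ := this y hy
    exact ⟨z, Subtype.ext hz⟩
  refine IsBaseChange.of_equiv (LinearEquiv.ofBijective φ ⟨hinj, hsurj⟩) (fun x => ?_)
  apply Subtype.ext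
  exact (hφ 1 x).trans (by rw [one_mul]; rfl)

lemma gorL_baseChange (hm : (maximalIdeal R).map (algebraMap R R') = maximalIdeal R') {d : ℕ}
    (G : GorL R d) : GorL R' d := by
  refine gorL_of_resfield (by rw [dim_eq hm, G.dim])
    (dp_baseChange hm.le (IsBaseChange.linearMap R R') G.dpR) d ?_
  intro j hj
  obtain ⟨j, rfl⟩ : ∃ i, j = i + 1 := ⟨j - 1, by omega⟩
  have := XV_baseChange (R' := R') j (R ⧸ maximalIdeal R) (G.inj _ _ hj)
  refine XV_congr_left ?_ this
  refine (Algebra.TensorProduct.quotIdealMapEquivTensorQuot R'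
    (maximalIdeal R)).symm.toLinearEquiv ≪≫ₗ ?_
  exact Submodule.quotEquivOfEq _ _ hm

end FlatExt

-- Part 11
section GenericExt

open IsLocalRing Pointwise Polynomial

variable (R : Type u) [CommRing R] [IsLocalRing R]

/-- the extension of the maximal ideal to the polynomial ring -/
abbrev mC : Ideal R[X] := (maximalIdeal R).map (C : R →+* R[X])

instance mC_prime : (mC R).IsPrime := Ideal.isPrime_map_C_of_isPrime

/-- the local ring `R(X)` -/
abbrev Rp : Type u := Localization.AtPrime (mC R)

instance Rp_flat : Module.Flat R (Rp R) := by
  have : Module.Flat R[X] (Rp R) := IsLocalization.flat _ (mC R).primeCompl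
  exact Module.Flat.trans R R[X] (Rp R)

instance Rp_noeth [IsNoetherianRing R] : IsNoetherianRing (Rp R) :=
  IsLocalization.isNoetherianRing (mC R).primeCompl _ inferInstance

lemma algebraMap_Rp (r : R) : algebraMap R (Rp R) r = algebraMap R[X] (Rp R) (C r) := rfl

lemma map_Rp (J : Ideal R) : J.map (algebraMap R (Rp R)) = (J.map C).map (algebraMap R[X] (Rp R)) := by
  rw [Ideal.map_map]; rfl

lemma hm_Rp : (maximalIdeal R).map (algebraMap R (Rp R)) = maximalIdeal (Rp R) := by
  rw [map_Rp]
  exact Localization.AtPrime.map_eq_maximalIdeal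

lemma mem_mRp {f : R[X]} : algebraMap R[X] (Rp R) f ∈ maximalIdeal (Rp R) ↔
    ∀ n, f.coeff n ∈ maximalIdeal R := by
  rw [IsLocalization.AtPrime.to_map_mem_maximal_iff (Rp R) (mC R), Ideal.mem_map_C_iff]

lemma inf_Rp : Infinite (ResidueField (Rp R)) := by
  refine Infinite.of_injective (fun n : ℕ => residue (Rp R) (algebraMap R[X] (Rp R) (X ^ n))) ?_
  intro n m h
  by_contra hnm
  have h1 : residue (Rp R) (algebraMap R[X] (Rp R) (X ^ n - X ^ m)) = 0 := by
    rw [map_sub, map_sub]; exact sub_eq_zero.2 h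
  rw [residue_eq_zero_iff, mem_mRp] at h1
  have h2 := h1 n
  rw [coeff_sub, coeff_X_pow_self, coeff_X_pow, if_neg hnm, sub_zero] at h2
  exact (Ideal.ne_top_iff_one _).1 (maximalIdeal.isMaximal R).ne_top h2

variable {R} (I : Ideal R)

/-- extended ideal -/
abbrev Ip : Ideal (Rp R) := I.map (algebraMap R (Rp R))

lemma mem_Ip_pow (k : ℕ) (y : Rp R) (hy : y ∈ (Ip I) ^ k) :
    ∃ s : (mC R).primeCompl, ∃ f : R[X], (∀ n, f.coeff n ∈ I ^ k) ∧
      algebraMap R[X] (Rp R) s * y = algebraMap R[X] (Rp R) f := by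
  rw [← Ideal.map_pow, map_Rp] at hy
  obtain ⟨⟨a, s⟩, h⟩ := (IsLocalization.mem_map_algebraMap_iff (mC R).primeCompl (Rp R)).1 hy
  exact ⟨s, a, Ideal.mem_map_C_iff.1 a.2, by rw [mul_comm]; exact h⟩

lemma mem_Ip_pow' (k : ℕ) (f : R[X]) (hf : ∀ n, f.coeff n ∈ I ^ k) :
    algebraMap R[X] (Rp R) f ∈ (Ip I) ^ k := by
  rw [← Ideal.map_pow, map_Rp]
  exact Ideal.mem_map_of_mem _ (Ideal.mem_map_C_iff.2 hf)

/-- the map `A → A'` -/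
def phA : reesAlgebra I →+* reesAlgebra (Ip I) :=
  ((mapRingHom (algebraMap R (Rp R))).comp (reesAlgebra I).val.toRingHom).codRestrict
    (reesAlgebra (Ip I)).toSubring (fun f => by
      intro n
      change (map _ f.1).coeff n ∈ _
      rw [coeff_map, ← Ideal.map_pow]
      exact Ideal.mem_map_of_mem _ (f.2 n))

/-- the map `A[X] → A'` -/
def psA : (reesAlgebra I)[X] →+* reesAlgebra (Ip I) :=
  eval₂RingHom (phA I) (algebraMap (Rp R) _ (algebraMap R[X] (Rp R) X))

/-- `T^k`-coefficient -/
def cofT (k : ℕ) (F : (reesAlgebra I)[X]) : R[X] :=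
  ∑ n ∈ F.support, monomial n ((F.coeff n).1.coeff k)

lemma cofT_coeff (k n : ℕ) (F : (reesAlgebra I)[X]) :
    (cofT I k F).coeff n = (F.coeff n).1.coeff k := by
  unfold cofT
  rw [finsetSum_coeff]
  simp only [coeff_monomial, Finset.sum_ite_eq']
  split_ifs with h
  · rfl
  · rw [notMem_support_iff.1 h]; rfl

lemma psA_coeff (k : ℕ) (F : (reesAlgebra I)[X]) :
    (psA I F).1.coeff k = algebraMap R[X] (Rp R) (cofT I k F) := by
  induction F using Polynomial.induction_on' with
  | add p q hp hq =>
    have : cofT I k (p + q) = cofT I k p + cofT I k q := by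
      ext n
      simp [cofT_coeff]
    rw [this, map_add, map_add, ← hp, ← hq]
    exact coeff_add _ _ _
  | monomial n f =>
    have h1 : cofT I k (monomial n f) = monomial n (f.1.coeff k) := by
      ext m
      rw [cofT_coeff, coeff_monomial, coeff_monomial]
      split_ifs <;> rfl
    rw [h1]
    have h2 : psA I (monomial n f) = (algebraMap R[X] (Rp R) X) ^ n • phA I f := by
      unfold psA
      rw [coe_eval₂RingHom, eval₂_monomial, ← map_pow, Algebra.smul_def, mul_comm]
    rw [h2]
    change ((algebraMap R[X] (Rp R) X) ^ n • (map (algebraMap R (Rp R)) f.1)).coeff k = _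
    rw [coeff_smul, coeff_map, algebraMap_Rp, ← map_pow, smul_eq_mul, ← map_mul, mul_comm,
      C_mul_X_pow_eq_monomial]

/-- `R[X] → A[X]` -/
abbrev RXA : R[X] →+* (reesAlgebra I)[X] := mapRingHom (algebraMap R (reesAlgebra I))

lemma psA_RXA (f : R[X]) : psA I (RXA I f) = algebraMap (Rp R) _ (algebraMap R[X] (Rp R) f) := by
  have : (psA I).comp (RXA I) =
      (algebraMap (Rp R) (reesAlgebra (Ip I))).comp (algebraMap R[X] (Rp R)) := by
    ext r
    · simp only [psA, RingHom.comp_apply, coe_mapRingHom, map_C, coe_eval₂RingHom, eval₂_C]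
      change (map (algebraMap R (Rp R)) (C r : R[X])).coeff _ = (C (algebraMap R (Rp R) r) : (Rp R)[X]).coeff _
      rw [map_C]
    · simp [psA]
  exact congrArg (fun g => g f) this

lemma cofT_RXA_mul (k : ℕ) (s : R[X]) (F : (reesAlgebra I)[X]) :
    cofT I k (RXA I s * F) = s * cofT I k F := by
  ext n
  rw [cofT_coeff, coeff_mul, coeff_mul]
  rw [AddSubmonoidClass.coe_finsetSum, finsetSum_coeff]
  refine Finset.sum_congr rfl fun x _ => ?_
  rw [cofT_coeff, coe_mapRingHom, coeff_map]
  change (C (s.coeff x.1) * (F.coeff x.2).1).coeff k = _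
  rw [coeff_C_mul]

lemma cofT_ext (F : (reesAlgebra I)[X]) (h : ∀ k, cofT I k F = 0) : F = 0 := by
  ext1 n
  apply Subtype.ext
  ext k
  rw [← cofT_coeff, h]; simp

/-- the submonoid inverted in `A[X]` -/
abbrev SA : Submonoid (reesAlgebra I)[X] := (mC R).primeCompl.map (RXA I)

/-- algebra structure -/
abbrev algA : Algebra (reesAlgebra I)[X] (reesAlgebra (Ip I)) := (psA I).toAlgebra

attribute [local instance] algA

lemma exists_common (k : ℕ) (c : ℕ → Rp R) (hc : ∀ i, c i ∈ Ip I ^ i) :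
    ∃ s : (mC R).primeCompl, ∃ F : (reesAlgebra I)[X],
      (∀ i < k, algebraMap R[X] (Rp R) (cofT I i F) = algebraMap R[X] (Rp R) s * c i) ∧
      ∀ i, k ≤ i → cofT I i F = 0 := by
  induction k with
  | zero => 
    refine ⟨1, 0, by simp, fun i _ => ?_⟩
    ext n; rw [cofT_coeff]; simp
  | succ k ih =>
    obtain ⟨s, F, h1, h2⟩ := ih
    obtain ⟨t, f, h3, h4⟩ := mem_Ip_pow I k (c k) (hc k)
    let H : (reesAlgebra I)[X] := ∑ n ∈ f.support, monomial n
      (⟨monomial k (f.coeff n), reesAlgebra.monomial_mem.2 (h3 n)⟩ : reesAlgebra I)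
    have hH : ∀ i, cofT I i H = if i = k then f else 0 := by
      intro i
      ext n
      rw [cofT_coeff]
      have : H.coeff n = (⟨monomial k (f.coeff n), reesAlgebra.monomial_mem.2 (h3 n)⟩ : reesAlgebra I) := by
        simp only [H, finsetSum_coeff, coeff_monomial, Finset.sum_ite_eq']
        split_ifs with h
        · rfl
        · apply Subtype.ext
          simp [notMem_support_iff.1 h]
      rw [this, coeff_monomial]
      split_ifs with ha hb hb
      · rfl
      · exact absurd ha.symm hb
      · exact absurd hb.symm ha
      · simp
    have hadd : ∀ i, cofT I i (RXA I t * F + RXA I s * H) = t * cofT I i F + s * cofT I i H := by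
      intro i
      rw [← cofT_RXA_mul, ← cofT_RXA_mul]
      ext n; simp [cofT_coeff]
    refine ⟨s * t, RXA I t * F + RXA I s * H, fun i hi => ?_, fun i hi => ?_⟩
    · rw [hadd, hH]
      by_cases hik : i = k
      · subst hik
        rw [h2 i le_rfl, if_pos rfl, mul_zero, zero_add, map_mul, ← h4, Submonoid.coe_mul, map_mul,
          mul_assoc]
      · rw [if_neg hik, mul_zero, add_zero, map_mul, h1 i (by omega), Submonoid.coe_mul, map_mul]
        ring
    · rw [hadd, hH, if_neg (by omega), h2 i (by omega), mul_zero, mul_zero, zero_add]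

lemma killer (k : ℕ) (F : (reesAlgebra I)[X]) (h : ∀ i, algebraMap R[X] (Rp R) (cofT I i F) = 0) :
    ∃ s : (mC R).primeCompl, ∀ i < k, (s : R[X]) * cofT I i F = 0 := by
  induction k with
  | zero => exact ⟨1, by simp⟩
  | succ k ih =>
    obtain ⟨s, hs⟩ := ih
    obtain ⟨t, ht⟩ := (IsLocalization.map_eq_zero_iff (mC R).primeCompl (Rp R) _).1 (h k)
    refine ⟨s * t, fun i hi => ?_⟩
    rw [Submonoid.coe_mul]
    by_cases hik : i = k
    · subst hik; rw [mul_assoc, ht, mul_zero]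
    · rw [mul_right_comm, hs i (by omega), zero_mul]

lemma cofT_bound (F : (reesAlgebra I)[X]) : ∃ k, ∀ i, k ≤ i → cofT I i F = 0 := by
  induction F using Polynomial.induction_on' with
  | add p q hp hq =>
    obtain ⟨k, hk⟩ := hp
    obtain ⟨l, hl⟩ := hq
    refine ⟨k + l, fun i hi => ?_⟩
    have : cofT I i (p + q) = cofT I i p + cofT I i q := by
      ext n
      simp [cofT_coeff]
    rw [this, hk i (by omega), hl i (by omega), add_zero]
  | monomial n f =>
    refine ⟨f.1.natDegree + 1, fun i hi => ?_⟩
    ext m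
    rw [cofT_coeff, coeff_monomial]
    split_ifs
    · rw [coeff_eq_zero_of_natDegree_lt (by omega)]; simp
    · simp

instance locA : IsLocalization (SA I) (reesAlgebra (Ip I)) where
  map_units := by
    rintro ⟨_, s, hs, rfl⟩
    change IsUnit (psA I (RXA I s))
    rw [psA_RXA]
    exact (IsLocalization.map_units (Rp R) (⟨s, hs⟩ : (mC R).primeCompl)).map _
  surj := by
    intro f
    obtain ⟨s, F, h1, h2⟩ := exists_common I (f.1.natDegree + 1) f.1.coeff f.2
    refine ⟨⟨F, ⟨RXA I s, s, s.2, rfl⟩⟩, ?_⟩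
    change f * psA I (RXA I s) = psA I F
    rw [psA_RXA, mul_comm, ← Algebra.smul_def]
    apply Subtype.ext
    ext k
    rw [psA_coeff]
    change ((algebraMap R[X] (Rp R) s) • f.1).coeff k = _
    rw [coeff_smul, smul_eq_mul]
    by_cases hk : k < f.1.natDegree + 1
    · rw [h1 k hk]
    · rw [h2 k (by omega), coeff_eq_zero_of_natDegree_lt (by omega), mul_zero, map_zero]
  exists_of_eq := by
    intro F G h
    have h1 : psA I (F - G) = 0 := (RingHom.map_sub (psA I) F G).trans (sub_eq_zero.2 h)
    obtain ⟨k, hk⟩ := cofT_bound I (F - G)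
    obtain ⟨s, hs⟩ := killer I k (F - G) (fun i => by rw [← psA_coeff, h1]; simp)
    refine ⟨⟨RXA I s, s, s.2, rfl⟩, ?_⟩
    change RXA I s * F = RXA I s * G
    refine sub_eq_zero.1 ((mul_sub (RXA I s) F G).symm.trans ?_)
    apply cofT_ext
    intro i
    rw [cofT_RXA_mul]
    by_cases hi : i < k
    · exact hs i hi
    · rw [hk i (by omega), mul_zero]

lemma comap_MM : (MM (Ip I)).comap (algebraMap (reesAlgebra I)[X] (reesAlgebra (Ip I))) =
    (MM I).map C := by
  ext F
  rw [Ideal.mem_comap, Ideal.mem_map_C_iff, mem_MM]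
  change (psA I F).1.coeff 0 ∈ _ ↔ _
  rw [psA_coeff, mem_mRp]
  simp only [cofT_coeff, mem_MM]

end GenericExt

-- Part 12
section ChainPoly

open Polynomial

lemma chain_poly {A : Type u} [CommRing A] [IsNoetherianRing A] (J : Ideal A) (ℓ : ℕ)
    (hdim : ringKrullDim (A ⧸ J) ≤ ℓ) (M : Ideal A) [M.IsPrime] 
    (P : ℕ → Ideal A[X]) (hP : ∀ k ≤ ℓ, (P k).IsPrime ∧ J.map C ≤ P k)
    (hlt : ∀ k < ℓ, P k < P (k+1)) : ¬ P ℓ < M.map C := by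
  intro h
  have hMp : (M.map (C : A →+* A[X])).IsPrime := Ideal.isPrime_map_C_of_isPrime
  have hM' : (M.comap (constantCoeff : A[X] →+* A)).IsPrime := Ideal.comap_isPrime _ _
  have hlast : M.map C < M.comap (constantCoeff : A[X] →+* A) := by
    refine lt_of_le_of_ne (Ideal.map_le_iff_le_comap.2 fun x hx => ?_) fun he => ?_
    · simpa [Ideal.mem_comap] using hx
    · have h1 : (X : A[X]) ∈ M.comap (constantCoeff : A[X] →+* A) := by simp [Ideal.mem_comap]
      rw [← he, Ideal.mem_map_C_iff] at h1
      have := h1 1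
      rw [coeff_X_one] at this
      exact (Ideal.ne_top_iff_one _).1 (Ideal.IsPrime.ne_top inferInstance) this
  let F : ℕ → Ideal A[X] := fun k => if k ≤ ℓ then P k else
    if k = ℓ + 1 then M.map C else M.comap (constantCoeff : A[X] →+* A)
  have hF : ∀ k, (F k).IsPrime := by
    intro k
    simp only [F]
    split_ifs with h1 h2
    · exact (hP k h1).1
    · exact hMp
    · exact hM'
  have hFl : ∀ k < ℓ + 2, F k < F (k+1) := by
    intro k hk
    simp only [F]
    by_cases h1 : k < ℓ
    · rw [if_pos (by omega), if_pos (by omega)]; exact hlt k h1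
    · by_cases h2 : k = ℓ
      · subst h2; simpa using h
      · have : k = ℓ + 1 := by omega
        subst this; simpa using hlast
  have hFJ : ∀ k, J.map C ≤ F k := by
    intro k
    have hl := (hP ℓ le_rfl).2
    simp only [F]
    split_ifs with h1 h2
    · exact (hP k h1).2
    · exact hl.trans h.le
    · exact hl.trans (h.le.trans hlast.le)
  let s : LTSeries (PrimeSpectrum.zeroLocus ((J.map C : Ideal A[X]) : Set A[X])) :=
    LTSeries.mk (ℓ + 2) (fun i => ⟨⟨F i, hF i⟩, hFJ i⟩) (by
      rw [Fin.strictMono_iff_lt_succ]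
      intro i
      change F i < F (i + 1)
      exact hFl i i.2)
  have h1 := Order.LTSeries.length_le_krullDim s
  rw [← ringKrullDim_quotient] at h1
  have h2 : ringKrullDim (A[X] ⧸ (J.map C : Ideal A[X])) = ringKrullDim (A ⧸ J) + 1 := by
    rw [← ringKrullDim_eq_of_ringEquiv (Ideal.polynomialQuotientEquivQuotientPolynomial J)]
    exact Polynomial.ringKrullDim_of_isNoetherianRing
  rw [h2] at h1
  have h3 : ((ℓ + 2 : ℕ) : WithBot ℕ∞) ≤ (ℓ + 1 : ℕ) := by
    refine h1.trans ?_
    push_cast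
    gcongr
  have h4 : ℓ + 2 ≤ ℓ + 1 := by exact_mod_cast h3
  omega

end ChainPoly

section Pre

open IsLocalRing Pointwise Polynomial

/-- The hypotheses over the original ring. -/
structure PreHyp (R : Type u) [CommRing R] [IsLocalRing R] [IsNoetherianRing R]
    (I : Ideal R) (d g ℓ : ℕ) : Prop where
  G : GorL R d
  hI : ∀ p : Ideal R, p.IsPrime → I ≤ p → (g : ℕ∞) ≤ p.height
  hIm : I ≤ maximalIdeal R
  hg : 1 ≤ g
  hGen : ∀ p : PrimeSpectrum R, I ≤ p.asIdeal → ∀ h : ℕ, p.asIdeal.height = h → h ≤ ℓ →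
      GenAt I ⊥ p.asIdeal h
  hH : ∀ j, 1 ≤ j → j + g ≤ ℓ → ∀ e, e + g + j ≤ d + 2 → dp R ↥(I ^ j) e
  hdim : ringKrullDim (reesAlgebra I ⧸ mA I) ≤ ℓ

variable {R : Type u} [CommRing R] [IsLocalRing R] [IsNoetherianRing R]
variable {I : Ideal R} {d g ℓ : ℕ}

lemma GenAt_mono {J p : Ideal R} {t s : ℕ} (h : t ≤ s) (H : GenAt I J p t) : GenAt I J p s := by
  obtain ⟨r, hr, f, hf, hx⟩ := H
  refine ⟨r, hr, fun i => if h : i.1 < t then f ⟨i, h⟩ else 0, fun i => ?_, fun x hxI => ?_⟩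
  · dsimp only
    split_ifs
    · exact hf _
    · exact zero_mem _
  · refine (sup_le_sup_left (Ideal.span_le.2 ?_) J) (hx x hxI)
    rintro _ ⟨i, rfl⟩
    refine Ideal.subset_span ⟨⟨i, by omega⟩, ?_⟩
    simp

attribute [local instance] algA

theorem PreHyp.main (H : PreHyp R I d g ℓ) : MainHyp (Rp R) (Ip I) d g ℓ where
  G := gorL_baseChange (hm_Rp R) H.G
  hI := by
    intro P hP hIP
    refine (H.hI (P.under R) inferInstance ?_).trans (height_under_le P)
    exact Ideal.map_le_iff_le_comap.1 hIP
  hIm := by rw [← hm_Rp]; exact Ideal.map_mono H.hIm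
  hg := H.hg
  hinf := inf_Rp R
  hGen := by
    intro P hIP h hh hl
    have h1 := height_under_le (R := R) P.asIdeal
    rw [hh] at h1
    obtain ⟨h', hh'⟩ := ENat.ne_top_iff_exists.1 (ne_top_of_le_ne_top (ENat.natCast_ne_top h) h1)
    rw [← hh'] at h1
    have h2 : h' ≤ h := by exact_mod_cast h1
    obtain ⟨r, hr, f, hf, hx⟩ := H.hGen ⟨P.asIdeal.under R, inferInstance⟩
      (Ideal.map_le_iff_le_comap.1 hIP) h' hh'.symm (by omega)
    refine GenAt_mono h2 ⟨algebraMap R (Rp R) r, hr, fun i => algebraMap R (Rp R) (f i),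
      fun i => Ideal.mem_map_of_mem _ (hf i), fun x hxI => ?_⟩
    have h3 : Ip I ≤ ((⊥ : Ideal (Rp R)) ⊔ Ideal.span (Set.range fun i => algebraMap R (Rp R) (f i))).colon
        ({algebraMap R (Rp R) r} : Set (Rp R)) := by
      refine Ideal.map_le_iff_le_comap.2 fun y hy => ?_
      rw [Ideal.mem_comap, Submodule.mem_colon_singleton, smul_eq_mul, mul_comm, ← map_mul, bot_sup_eq]
      have := Ideal.mem_map_of_mem (algebraMap R (Rp R)) (hx y hy)
      rwa [bot_sup_eq, Ideal.map_span, ← Set.range_comp] at this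
    have := h3 hxI
    rwa [Submodule.mem_colon_singleton, smul_eq_mul, mul_comm] at this
  hH := by
    intro j h1 h2 e he
    have := dp_baseChange (hm_Rp R).le (idealBC_isBaseChange (R' := Rp R) (I ^ j)) (H.hH j h1 h2 e he)
    rwa [Ideal.map_pow] at this
  hchain := by
    intro Q hQ hlt hlast
    have hcl : ∀ P P' : Ideal (reesAlgebra (Ip I)), P < P' →
        P.comap (algebraMap (reesAlgebra I)[X] _) < P'.comap (algebraMap (reesAlgebra I)[X] _) := by
      intro P P' h
      exact (IsLocalization.orderEmbedding (SA I) (reesAlgebra (Ip I))).lt_iff_lt.2 h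
    refine chain_poly (mA I) ℓ H.hdim (MM I)
      (fun k => (Q k).comap (algebraMap (reesAlgebra I)[X] _)) (fun k hk => ?_)
      (fun k hk => hcl _ _ (hlt k hk)) (by rw [← comap_MM]; exact hcl _ _ hlast)
    have := (hQ k hk).1
    refine ⟨Ideal.comap_isPrime _ _, ?_⟩
    unfold mA
    rw [Ideal.map_map, Ideal.map_le_iff_le_comap]
    intro r hr
    rw [Ideal.mem_comap, Ideal.mem_comap]
    change psA I (C (algebraMap R _ r)) ∈ _
    have h1 : psA I (C (algebraMap R _ r)) = algebraMap (Rp R) _ (algebraMap R (Rp R) r) := by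
      have := psA_RXA I (C r)
      rwa [coe_mapRingHom, map_C] at this
    rw [h1]
    refine (hQ k hk).2 (Ideal.mem_map_of_mem _ ?_)
    rw [← hm_Rp]
    exact Ideal.mem_map_of_mem _ hr

end Pre

-- Part 13
section LinDesc

open IsLocalRing Pointwise Polynomial

lemma gen_mul {A S : Type u} [CommRing A] [CommRing S] [Algebra A S] (N : Submodule A S) (m : S)
    (hm : m ∈ N) (x : S) (hx : x ∈ ⨆ n : ℕ, N ^ n) : m * x ∈ ⨆ n : ℕ, N ^ n := by
  have : (⨆ n : ℕ, N ^ n) ≤ (⨆ n : ℕ, N ^ n).comap (LinearMap.mulLeft A m) := by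
    refine iSup_le fun n y hy => ?_
    rw [Submodule.mem_comap, LinearMap.mulLeft_apply]
    refine (le_iSup (fun n : ℕ => N ^ n) (n+1)) ?_
    rw [pow_succ']
    exact Submodule.mul_mem_mul hm hy
  exact this hx

lemma gen_bc {R R' M M' S : Type u} [CommRing R] [CommRing R'] [Algebra R R'] [CommRing S]
    [Algebra R S] [AddCommGroup M] [Module R M] [AddCommGroup M'] [Module R' M']
    (lam : M →ₗ[R] S) (lam' : M' →ₗ[R'] R' ⊗[R] S) (hl : ∀ x, ∃ y, lam' y = 1 ⊗ₜ lam x)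
    (hgen : ∀ z : S, z ∈ ⨆ n : ℕ, (LinearMap.range lam) ^ n) (z : R' ⊗[R] S) :
    z ∈ ⨆ n : ℕ, (LinearMap.range lam') ^ n := by
  have h1 : ∀ s : S, (1 : R') ⊗ₜ[R] s ∈ ⨆ n : ℕ, (LinearMap.range lam') ^ n := by
    intro s
    have hs : (⨆ n : ℕ, (LinearMap.range lam) ^ n) ≤
      ((⨆ n : ℕ, (LinearMap.range lam') ^ n).restrictScalars R).comap
        (TensorProduct.mk R R' S 1) := by
      refine iSup_le fun n s hs => ?_
      change (1 : R') ⊗ₜ[R] s ∈ ⨆ n : ℕ, (LinearMap.range lam') ^ n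
      refine Submodule.pow_induction_on_left (LinearMap.range lam)
        (C := fun s => (1 : R') ⊗ₜ[R] s ∈ ⨆ n : ℕ, (LinearMap.range lam') ^ n) ?_ ?_ ?_ hs
      · intro r
        have h0 : (1 : Submodule R' (R' ⊗[R] S)) ≤ ⨆ n : ℕ, (LinearMap.range lam') ^ n :=
          le_iSup (fun n : ℕ => (LinearMap.range lam') ^ n) 0
        apply h0
        rw [Submodule.mem_one]
        refine ⟨algebraMap R R' r, ?_⟩
        rw [Algebra.TensorProduct.algebraMap_apply, Algebra.algebraMap_eq_smul_one r, Algebra.algebraMap_eq_smul_one r,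
          Algebra.algebraMap_self_apply, TensorProduct.smul_tmul]
      · intro x y hx hy
        rw [TensorProduct.tmul_add]; exact add_mem hx hy
      · rintro _ ⟨x, rfl⟩ y hy
        obtain ⟨w, hw⟩ := hl x
        have := gen_mul (LinearMap.range lam') _ ⟨w, rfl⟩ _ hy
        rwa [hw, Algebra.TensorProduct.tmul_mul_tmul, one_mul] at this
    exact hs (hgen s)
  induction z with
  | zero => exact zero_mem _
  | add x y hx hy => exact add_mem hx hy
  | tmul r s =>
    have := Submodule.smul_mem _ r (h1 s)
    rwa [TensorProduct.smul_tmul', smul_eq_mul, mul_one] at this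

variable {R : Type u} [CommRing R] [IsLocalRing R] [IsNoetherianRing R]
variable {I : Ideal R} {d g ℓ : ℕ}

instance Rp_ff : Module.FaithfullyFlat R (Rp R) := by
  have : IsLocalHom (algebraMap R (Rp R)) := by
    exact ((IsLocalRing.local_hom_TFAE (algebraMap R (Rp R))).out 0 2).2 (hm_Rp R).le
  exact Module.FaithfullyFlat.of_flat_of_isLocalHom

theorem lin_desc {R' : Type u} [CommRing R'] [IsLocalRing R'] [IsNoetherianRing R'] [Algebra R R']
    [Module.FaithfullyFlat R R'] (a : ℕ → R') (hC : CoreHyp R' (I.map (algebraMap R R')) a d g ℓ)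
    (hJ : I.map (algebraMap R R') ≤ JJ a ℓ) {S : Type u} [CommRing S] [Algebra R S]
    (lam : I →ₗ[R] S) (ε : S →ₐ[R] R[X]) (hε : ∀ x, ε (lam x) = monomial 1 (x : R))
    (hgen : ∀ z : S, z ∈ ⨆ n : ℕ, (LinearMap.range lam) ^ n) : ∀ z, ε z = 0 → z = 0 := by
  let e := (idealBC_isBaseChange (R' := R') I).equiv
  have he : ∀ r x, ((e (r ⊗ₜ x) : I.map (algebraMap R R')) : R') = r * algebraMap R R' x := by
    intro r x
    rw [IsBaseChange.equiv_tmul]; rfl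
  let lam' : I.map (algebraMap R R') →ₗ[R'] R' ⊗[R] S := (lam.baseChange R') ∘ₗ e.symm.toLinearMap
  let ε' : R' ⊗[R] S →ₐ[R'] R'[X] := Algebra.TensorProduct.lift (Algebra.ofId R' R'[X])
    ((Polynomial.mapAlgHom (Algebra.ofId R R')).comp ε) (fun _ _ => Commute.all _ _)
  have hl : ∀ r x, lam' (e (r ⊗ₜ x)) = r ⊗ₜ lam x := by
    intro r x
    simp [lam']
  have hε1 : ∀ y : R' ⊗[R] I, ε' (lam' (e y)) = monomial 1 ((e y : I.map (algebraMap R R')) : R') := by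
    intro y
    induction y with
    | zero => simp
    | add x y hx hy => 
      rw [map_add, map_add, map_add, hx, hy, ← map_add]; rfl
    | tmul r x =>
      rw [hl, he, Algebra.TensorProduct.lift_tmul, AlgHom.comp_apply, hε]
      change C r * map (algebraMap R R') _ = _
      rw [map_monomial, C_mul_monomial]
  have hε' : ∀ x, ε' (lam' x) = monomial 1 (x : R') := by
    intro x
    obtain ⟨y, rfl⟩ := e.surjective x
    exact hε1 y
  have hgen' : ∀ z, z ∈ ⨆ n : ℕ, (LinearMap.range lam') ^ n :=
    gen_bc lam lam' (fun x => ⟨e (1 ⊗ₜ x), hl 1 x⟩) hgen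
  have key := linType_abs (hC.ha) hJ hC.reg' hC.KI' lam' ε' hε' hgen'
  intro z hz
  have h2 : (1 : R') ⊗ₜ[R] z = 0 := by
    apply key
    rw [Algebra.TensorProduct.lift_tmul, AlgHom.comp_apply, hz]; simp
  have h3 := Module.FaithfullyFlat.tensorProduct_mk_injective (A := R) (B := R') S
  apply h3
  rw [TensorProduct.mk_apply, h2, map_zero]

theorem PreHyp.linType (H : PreHyp R I d g ℓ) {S : Type u} [CommRing S] [Algebra R S]
    (lam : I →ₗ[R] S) (ε : S →ₐ[R] R[X]) (hε : ∀ x, ε (lam x) = monomial 1 (x : R))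
    (hgen : ∀ z : S, z ∈ ⨆ n : ℕ, (LinearMap.range lam) ^ n) : ∀ z, ε z = 0 → z = 0 := by
  obtain ⟨a, hC, hJ, -⟩ := H.main.exists_core
  exact lin_desc _ hC hJ lam ε hε hgen

end LinDesc

-- Part 14
section DpA

open CategoryTheory Abelian IsLocalRing Pointwise RingTheory.Sequence

variable {A : Type u} [CommRing A]

/-- Vanishing of `Ext^i(A/P, N)` for `i < n`. -/
def dpA (P : Ideal A) (N : Type u) [AddCommGroup N] [Module A N] (n : ℕ) : Prop :=
  ∀ i < n, XV A (A ⧸ P) N i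

variable {P : Ideal A} {N B C : Type u} [AddCommGroup N] [Module A N] [AddCommGroup B] [Module A B]
  [AddCommGroup C] [Module A C]

lemma dpA_of_reg {x : A} (hx : x ∈ P) {f : N →ₗ[A] N} {g : N →ₗ[A] C} (hfx : ∀ y, f y = x • y)
    (hf : Function.Injective f) (he : Function.Exact f g) (hg : Function.Surjective g) {n : ℕ}
    (h1 : dpA P C n) : dpA P N (n+1) := by
  obtain rfl : f = x • (LinearMap.id : N →ₗ[A] N) := LinearMap.ext hfx
  have key : ∀ i (e : EE A (A ⧸ P) N i),
      postE _ (x • (LinearMap.id : N →ₗ[A] N)) i e = 0 := by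
    intro i e
    rw [postE_smul_id]
    rw [← preE_smul_id]
    have h0 : x • (LinearMap.id : (A ⧸ P) →ₗ[A] (A ⧸ P)) = 0 := by
      refine LinearMap.ext fun b => ?_
      obtain ⟨b, rfl⟩ := Ideal.Quotient.mk_surjective b
      change Ideal.Quotient.mk P (x * b) = 0
      exact Ideal.Quotient.eq_zero_iff_mem.2 (P.mul_mem_right _ hx)
    rw [h0, preE_zero]
  rintro (_ | i) hi
  · refine subsingleton_of_forall_eq 0 fun e => ?_
    have : Mono (ModuleCat.ofHom (x • (LinearMap.id : N →ₗ[A] N))) :=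
      (ModuleCat.mono_iff_injective _).2 hf
    exact (Ext.postcomp_mk₀_injective_of_mono (ModuleCat.of A _) (ModuleCat.ofHom
      (x • (LinearMap.id : N →ₗ[A] N)))) ((key 0 e).trans (key 0 0).symm)
  · refine subsingleton_of_forall_eq 0 fun e => ?_
    obtain ⟨y, rfl⟩ := Ext.covariant_sequence_exact₁ _ (sesC_exact hf he hg) e (key _ e) rfl
    have : y = 0 := Subsingleton.elim (h := h1 i (by omega)) _ _
    rw [this]
    exact Ext.zero_comp (Y := (sesC _ _ he).X₃) _ _ _ _ _

lemma dpA_mid {f : N →ₗ[A] B} {g : B →ₗ[A] C} (hf : Function.Injective f)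
    (he : Function.Exact f g) (hg : Function.Surjective g) {n : ℕ}
    (h1 : dpA P N n) (h2 : dpA P C n) : dpA P B n :=
  fun i hi => XV_mid_cov hf he hg (h1 i hi) (h2 i hi)

lemma dpA_congr (e : N ≃ₗ[A] B) {n : ℕ} (h : dpA P N n) : dpA P B n :=
  fun i hi => XV_congr_right e (h i hi)

lemma dpA_of_weaklyRegular (rs : List A) (hm : ∀ r ∈ rs, r ∈ P) :
    ∀ (M : Type u) [AddCommGroup M] [Module A M], IsWeaklyRegular M rs → dpA P M rs.length := by
  induction rs with
  | nil => intro M _ _ _ i hi; simp at hi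
  | cons r rs ih =>
    intro M _ _ h
    rw [isWeaklyRegular_cons_iff] at h
    refine dpA_of_reg (hm r (by simp)) (f := r • LinearMap.id) (g := (r • (⊤ : Submodule A M)).mkQ)
      (fun _ => rfl) (smul_inj h.1) (smul_exact r M) (Submodule.mkQ_surjective _)
      (ih (fun r hr => hm r (by simp [hr])) _ h.2)

end DpA

section ReesCM

open IsLocalRing Pointwise Polynomial RingTheory.Sequence

variable {R : Type u} [CommRing R]

/-- elements of the Rees algebra with coefficients in `K` -/
def calK (I K : Ideal R) : Ideal (reesAlgebra I) where
  carrier := {f | ∀ n, f.1.coeff n ∈ K}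
  add_mem' := by
    intro f g hf hg n
    change (f.1 + g.1).coeff n ∈ K
    rw [coeff_add]; exact add_mem (hf n) (hg n)
  zero_mem' := by intro n; simp
  smul_mem' := by
    intro c f hf n
    change (c.1 * f.1).coeff n ∈ K
    rw [coeff_mul]
    exact Ideal.sum_mem _ fun x _ => K.mul_mem_left _ (hf _)

lemma mem_calK {I K : Ideal R} {f : reesAlgebra I} : f ∈ calK I K ↔ ∀ n, f.1.coeff n ∈ K := Iff.rfl

lemma tL_mul_coeff_zero {I : Ideal R} (b : I) (f : reesAlgebra I) :
    (tL I b * f).1.coeff 0 = 0 := by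
  change (monomial 1 b.1 * f.1).coeff 0 = 0
  rw [mul_coeff_zero, coeff_monomial]; simp

lemma tL_mul_coeff_succ {I : Ideal R} (b : I) (f : reesAlgebra I) (n : ℕ) :
    (tL I b * f).1.coeff (n+1) = b.1 * f.1.coeff n := by
  change (monomial 1 b.1 * f.1).coeff (n+1) = _
  rw [← C_mul_X_pow_eq_monomial, pow_one, mul_assoc, coeff_C_mul, coeff_X_mul]

/-- Valabrega–Valla property -/
lemma vv {I : Ideal R} {a : ℕ → R} {ℓ : ℕ} (ha : ∀ k < ℓ, a k ∈ I) (hIJ : I ≤ JJ a ℓ)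
    (hreg : ∀ k < ℓ, ∀ y, a k * y ∈ KK a I k → y ∈ KK a I k)
    (hKI : ∀ k ≤ ℓ, ∀ y ∈ I, y ∈ KK a I k → y ∈ JJ a k) (n : ℕ) :
    ∀ j i, i + j = ℓ → ∀ y ∈ I ^ (n+1), y ∈ JJ a i → y ∈ JJ a i * I ^ n := by
  induction n with
  | zero => intro j i _ y _ hy; simpa using hy
  | succ n ihn =>
    intro j
    induction j with
    | zero =>
      intro i hi y hy _
      obtain rfl : i = ℓ := by omega
      rw [pow_succ'] at hy
      exact Ideal.mul_mono_left hIJ hy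
    | succ j ih =>
      intro i hi y hy hyJ
      have h1 := ih (i+1) (by omega) y hy (JJ_mono (Nat.le_succ i) hyJ)
      rw [JJ, Ideal.sup_mul, Submodule.mem_sup] at h1
      obtain ⟨u, hu, w, hw, rfl⟩ := h1
      obtain ⟨b, hb, rfl⟩ := Ideal.mem_span_singleton_mul.1 hw
      refine add_mem hu ?_
      have h2 : a i * b ∈ JJ a i := by
        have := sub_mem hyJ (Ideal.mul_le_left hu)
        simpa using this
      have h3 := hreg i (by omega) b (JJ_le_KK h2)
      have hbI : b ∈ I := Ideal.pow_le_self (Nat.succ_ne_zero n) hb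
      have h4 := ihn (j+1) i hi b hb (hKI i (by omega) b hbI h3)
      have h5 := Ideal.mul_mem_mul h4 (ha i (by omega))
      rwa [mul_assoc, ← pow_succ, mul_comm b] at h5

variable [IsLocalRing R] [IsNoetherianRing R] {I : Ideal R} {d g ℓ : ℕ} {a : ℕ → I}

/-- constant coefficients in `K` -/
def calE (I K : Ideal R) : Ideal (reesAlgebra I) :=
  K.comap (constantCoeff.comp (reesAlgebra I).val.toRingHom)

lemma mem_calE {I K : Ideal R} {f : reesAlgebra I} : f ∈ calE I K ↔ f.1.coeff 0 ∈ K := Iff.rfl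

/-- the ideals `𝒦_i` -/
abbrev cK (a : ℕ → I) (i : ℕ) : Ideal (reesAlgebra I) := calK I (KK (fun k => (a k : R)) I i)

/-- the ideals `𝒦_i + x A` -/
abbrev cL (a : ℕ → I) (i : ℕ) : Ideal (reesAlgebra I) := cK a i ⊔ Ideal.span {tL I (a i)}

lemma cL_le (i : ℕ) : cL a i ≤ cK a (i+1) := by
  refine sup_le (fun f hf n => KK_mono (Nat.le_succ i) (hf n)) ?_
  rw [Ideal.span_le, Set.singleton_subset_iff]
  intro n
  rw [tL_val, coeff_monomial]
  split_ifs
  · exact JJ_le_KK (mem_JJ_self (a := fun k => (a k : R)) i)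
  · exact zero_mem _

lemma cL_calE (i : ℕ) : cL a i ≤ calE I (KK (fun k => (a k : R)) I i) := by
  refine sup_le (fun f hf => hf 0) ?_
  rw [Ideal.span_le, Set.singleton_subset_iff]
  change (tL I (a i)).1.coeff 0 ∈ KK (fun k => (a k : R)) I i
  rw [tL_val, coeff_monomial]
  simp

lemma mem_cL (H : CoreHyp R I (fun k => (a k : R)) d g ℓ) (hJ : I ≤ JJ (fun k => (a k : R)) ℓ)
    {i : ℕ} (hi : i < ℓ) {f : reesAlgebra I} (h1 : f ∈ cK a (i+1))
    (h0 : f.1.coeff 0 ∈ KK (fun k => (a k : R)) I i) : f ∈ cL a i := by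
  rw [← sum_hc f]
  refine Ideal.sum_mem _ fun n _ => ?_
  rcases n with _ | n
  · refine Ideal.mem_sup_left fun m => ?_
    rw [hc_val, coeff_monomial]
    split_ifs
    · exact h0
    · exact zero_mem _
  · have hfn := f.2 (n+1)
    have h2 := vv H.ha hJ H.reg' H.KI' n (ℓ - (i+1)) (i+1) (by omega) _ hfn
      (H.KI' (i+1) (by omega) _ (Ideal.pow_le_self (Nat.succ_ne_zero n) hfn) (h1 (n+1)))
    rw [JJ, Ideal.sup_mul, Submodule.mem_sup] at h2
    obtain ⟨u, hu, w, hw, huw⟩ := h2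
    obtain ⟨b, hb, rfl⟩ := Ideal.mem_span_singleton_mul.1 hw
    have huI : u ∈ I ^ (n+1) := by
      rw [pow_succ']
      exact Ideal.mul_mono_left (JJ_le H.ha hi.le) hu
    have : hc f (n+1) = (⟨monomial (n+1) u, reesAlgebra.monomial_mem.2 huI⟩ : reesAlgebra I) +
        tL I (a i) * (⟨monomial n b, reesAlgebra.monomial_mem.2 hb⟩ : reesAlgebra I) := by
      apply Subtype.ext
      rw [hc_val, ← huw]
      change _ = monomial (n+1) u + monomial 1 (a i : R) * monomial n b
      rw [monomial_mul_monomial, map_add, add_comm 1 n]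
    rw [this]
    refine add_mem (Ideal.mem_sup_left fun m => ?_) (Ideal.mem_sup_right
      (Ideal.mul_mem_right _ _ (Ideal.mem_span_singleton_self _)))
    change (monomial (n+1) u).coeff m ∈ _
    rw [coeff_monomial]
    split_ifs
    · exact JJ_le_KK (Ideal.mul_le_left hu)
    · exact zero_mem _

lemma qt_sub {S : Type u} [CommRing S] {P L : Ideal S} (h : P ≤ L) : Subsingleton (QT P L) := by
  refine subsingleton_of_forall_eq 0 fun y => ?_
  obtain ⟨f, hf, rfl⟩ := qt_surj y
  exact (qt_mk_eq_zero _ _).2 (h hf)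

lemma KK_top (hJ : I ≤ JJ (fun k => (a k : R)) ℓ) : KK (fun k => (a k : R)) I ℓ = ⊤ := by
  rw [Ideal.eq_top_iff_one]
  intro x hx
  rw [one_mul]; exact hJ hx

lemma dpKK (H : CoreHyp R I (fun k => (a k : R)) d g ℓ) (hJ : I ≤ JJ (fun k => (a k : R)) ℓ)
    {i : ℕ} (hi : i < ℓ) (e : ℕ) (he : e + i ≤ d) :
    dp R (QT (KK (fun k => (a k : R)) I (i+1)) (KK (fun k => (a k : R)) I i)) e := by
  rcases e with _ | n
  · intro i hi; omega
  set K := KK (fun k => (a k : R)) I i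
  set K' := KK (fun k => (a k : R)) I (i+1) with hK'
  have hle : K ≤ K' := KK_mono (Nat.le_succ i)
  have h2 : dp R (QT ⊤ K') n := by
    rcases Nat.lt_or_ge (i+1) ℓ with h | h
    · exact H.dpK' (i+1) h n (by omega)
    · obtain rfl : ℓ = i + 1 := by omega
      have : Subsingleton (QT ⊤ K') := by
        rw [hK', KK_top hJ]
        exact qt_sub le_rfl
      exact dp_subsingleton n
  refine dp_left (f := mulQ 1 (P := K') (L := K) (P' := ⊤) (L' := K) (fun _ _ => trivial) (fun x _ h => by simpa using h))
    (g := mulQ 1 (P := ⊤) (L := K) (P' := ⊤) (L' := K') (fun _ _ => trivial) (fun x _ h => by simpa using hle h))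
    (mulQ_injective _ _ _ (fun x _ h => by simpa using h))
    (mulQ_exact _ _ _ _ _ (fun y _ h => ⟨y, h, by simp⟩) (fun x h => by simpa using h))
    (mulQ_one_surj _ _) (H.dpK' i hi (n+1) (by omega)) h2

/-- constant coefficient map -/
def ccL (a : ℕ → I) (i : ℕ) : (cK a (i+1)) →ₗ[R] (KK (fun k => (a k : R)) I (i+1)) where
  toFun := fun f => ⟨f.1.1.coeff 0, f.2 0⟩
  map_add' := fun f g => Subtype.ext (coeff_add _ _ _)
  map_smul' := fun r f => Subtype.ext (coeff_smul _ _ _)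

/-- constant coefficient map to the subquotient -/
def ccM (a : ℕ → I) (i : ℕ) : (cK a (i+1)) →ₗ[R]
    QT (KK (fun k => (a k : R)) I (i+1)) (KK (fun k => (a k : R)) I i) :=
  (Submodule.mkQ _) ∘ₗ ccL a i

lemma ccM_ker (a : ℕ → I) (i : ℕ) :
    (Submodule.comap (cK a (i+1)).subtype (cL a i)).restrictScalars R ≤ LinearMap.ker (ccM a i) := by
  intro f hf
  exact (qt_mk_eq_zero _ _).2 (cL_calE i hf)

lemma wr_quot {S M N : Type u} [CommRing S] [Algebra R S] [AddCommGroup M] [Module S M] [Module R M]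
    [IsScalarTower R S M] [AddCommGroup N] [Module R N] (Q : Submodule S M) (φ : M →ₗ[R] N)
    (hs : Function.Surjective φ) (hk : ∀ x, φ x = 0 ↔ x ∈ Q) (rs : List R)
    (h : IsWeaklyRegular N rs) : IsWeaklyRegular (M ⧸ Q) (rs.map (algebraMap R S)) := by
  have e1 : (M ⧸ Q.restrictScalars R) ≃ₗ[R] N :=
    (Submodule.quotEquivOfEq _ _ (by ext x; exact (hk x).symm)).trans
      (φ.quotKerEquivOfSurjective hs)
  have e2 := (Submodule.Quotient.restrictScalarsEquiv R Q).symm.trans e1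
  exact (isWeaklyRegular_map_algebraMap_iff S _ rs).2 ((e2.isWeaklyRegular_congr rs).2 h)

lemma ccM_surj (a : ℕ → I) (i : ℕ) : Function.Surjective (ccM a i) := by
  intro y
  obtain ⟨r, hr, rfl⟩ := qt_surj y
  have hval : (algebraMap R (reesAlgebra I) r).1 = C r := rfl
  refine ⟨⟨algebraMap R (reesAlgebra I) r, fun n => ?_⟩, ?_⟩
  · rw [hval, coeff_C]; split_ifs
    · exact hr
    · exact zero_mem _
  · refine congrArg (Submodule.mkQ _) (Subtype.ext ?_)
    change (C r).coeff 0 = r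
    rw [coeff_C_zero]

lemma ccM_zero (H : CoreHyp R I (fun k => (a k : R)) d g ℓ) (hJ : I ≤ JJ (fun k => (a k : R)) ℓ)
    {i : ℕ} (hi : i < ℓ) (f : cK a (i+1)) :
    ccM a i f = 0 ↔ f ∈ Submodule.comap (cK a (i+1)).subtype (cL a i) :=
  ⟨fun h => mem_cL H hJ hi f.2 ((qt_mk_eq_zero _ (f.2 0)).1 h), fun h => ccM_ker a i h⟩

lemma alg_mem_MM {r : R} (hr : r ∈ maximalIdeal R) : algebraMap R (reesAlgebra I) r ∈ MM I := by
  rw [mem_MM]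
  change (C r).coeff 0 ∈ _
  rwa [coeff_C_zero]

lemma dpA_ccQ (H : CoreHyp R I (fun k => (a k : R)) d g ℓ) (hJ : I ≤ JJ (fun k => (a k : R)) ℓ)
    {i : ℕ} (hi : i < ℓ) (e : ℕ) (he : e + i ≤ d) : dpA (MM I) (QT (cK a (i+1)) (cL a i)) e := by
  obtain ⟨rs, h1, h2, h3⟩ := exists_weaklyRegular e _ (dpKK H hJ hi e he)
  have h5 := wr_quot (S := reesAlgebra I) (M := cK a (i+1))
    (N := QT (KK (fun k => (a k : R)) I (i+1)) (KK (fun k => (a k : R)) I i))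
    (Submodule.comap (cK a (i+1)).subtype (cL a i)) (ccM a i) (ccM_surj a i) (ccM_zero H hJ hi) rs h3
  have := dpA_of_weaklyRegular (P := MM I) _ (by
    intro r hr
    obtain ⟨s, hs, rfl⟩ := List.mem_map.1 hr
    exact alg_mem_MM (h2 s hs)) _ h5
  rwa [List.length_map, h1] at this

lemma dpA_step (H : CoreHyp R I (fun k => (a k : R)) d g ℓ) (hJ : I ≤ JJ (fun k => (a k : R)) ℓ) :
    ∀ j i, i + j = ℓ → ∀ e, e + i ≤ d + 1 → dpA (MM I) (QT ⊤ (cK a i)) e := by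
  intro j
  induction j with
  | zero =>
    intro i hi e _
    obtain rfl : i = ℓ := by omega
    have : Subsingleton (QT ⊤ (cK a i)) := by
      refine qt_sub ?_
      intro f _ n
      rw [KK_top hJ]; trivial
    exact fun _ _ => XV_of_subsingleton_right _
  | succ j ih =>
    intro i hi e he
    rcases e with _ | e
    · intro i hi; omega
    have h1 := ih (i+1) (by omega) e (by omega)
    have h2 := dpA_ccQ H hJ (i := i) (by omega) e (by omega)
    have hle := cL_le (a := a) i
    have h3 : dpA (MM I) (QT ⊤ (cL a i)) e :=
      dpA_mid (f := mulQ 1 (P := cK a (i+1)) (L := cL a i) (P' := ⊤) (L' := cL a i)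
          (fun _ _ => trivial) (fun x _ h => by rwa [one_mul]))
        (g := mulQ 1 (P := ⊤) (L := cL a i) (P' := ⊤) (L' := cK a (i+1)) (fun _ _ => trivial)
          (fun x _ h => by rw [one_mul]; exact hle h))
        (mulQ_injective _ _ _ (fun x _ h => by rwa [one_mul] at h))
        (mulQ_exact _ _ _ _ _ (fun y _ h => ⟨y, h, by rw [one_mul, sub_self]; exact zero_mem _⟩) 
          (fun x h => by rwa [one_mul]))
        (mulQ_one_surj _ _) h2 h1
    have hx : tL I (a i) ∈ MM I := by
      rw [mem_MM, tL_val, coeff_monomial]; simp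
    refine dpA_of_reg hx (f := mulQ (tL I (a i)) (P := ⊤) (L := cK a i) (P' := ⊤) (L' := cK a i)
          (fun _ _ => trivial) (fun x _ h => Ideal.mul_mem_left _ _ h))
        (g := mulQ 1 (P := ⊤) (L := cK a i) (P' := ⊤) (L' := cL a i) (fun _ _ => trivial)
          (fun x _ h => by rw [one_mul]; exact Ideal.mem_sup_left h)) ?_
        (mulQ_injective _ _ _ (fun f _ h n => ?_))
        (mulQ_exact _ _ _ _ _ (fun y _ h => ?_) 
          (fun x _ => Ideal.mem_sup_right (Ideal.mul_mem_right _ _ (Ideal.mem_span_singleton_self _))))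
        (mulQ_one_surj _ _) h3
    · intro y
      obtain ⟨y, hy, rfl⟩ := qt_surj y
      rfl
    · have := h (n+1)
      rw [tL_mul_coeff_succ] at this
      exact H.reg' i (by omega) _ this
    · obtain ⟨u, hu, w, hw, rfl⟩ := Submodule.mem_sup.1 h
      obtain ⟨c, rfl⟩ := Ideal.mem_span_singleton.1 hw
      exact ⟨c, trivial, by simpa using hu⟩

lemma cK_zero (H : CoreHyp R I (fun k => (a k : R)) d g ℓ) : cK a 0 = ⊥ := by
  rw [eq_bot_iff]
  intro f hf
  rw [Ideal.mem_bot]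
  apply Subtype.ext
  ext n
  have := hf n
  exact H.K0 _ this

lemma dpA_rees (H : CoreHyp R I (fun k => (a k : R)) d g ℓ) (hJ : I ≤ JJ (fun k => (a k : R)) ℓ) :
    dpA (MM I) (reesAlgebra I) (d+1) := by
  have := dpA_step H hJ ℓ 0 (by omega) (d+1) (by omega)
  rw [cK_zero H] at this
  exact dpA_congr ((qtTop ⊥).trans (Submodule.quotEquivOfEqBot ⊥ rfl)) this

end ReesCM

-- Part 15
section ChainDim

open IsLocalRing Pointwise

variable {S : Type u} [CommRing S]

/-- chains of primes above `J` have length at most `n` -/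
def chD (J : Ideal S) (n : ℕ) : Prop :=
  ∀ l : LTSeries (PrimeSpectrum S), J ≤ l.head.asIdeal → l.length ≤ n

lemma chD_of_dim {J : Ideal S} {n : ℕ} (h : ringKrullDim (S ⧸ J) ≤ n) : chD J n := by
  intro l hl
  rw [ringKrullDim_quotient] at h
  let l' : LTSeries (PrimeSpectrum.zeroLocus (R := S) J) :=
    { length := l.length
      toFun := fun i => ⟨l.toFun i, fun x hx => (LTSeries.head_le l i) (hl hx)⟩
      step := fun i => l.step i }
  have h1 := (Order.LTSeries.length_le_krullDim l').trans h
  exact_mod_cast h1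

lemma dim_of_chD {J : Ideal S} {n : ℕ} (h : chD J n) : ringKrullDim (S ⧸ J) ≤ n := by
  rw [ringKrullDim_quotient]
  refine iSup_le fun l => ?_
  have := h (l.map Subtype.val (Subtype.strictMono_coe _)) (fun x hx => l.head.2 hx)
  exact_mod_cast this

lemma chD_union {J J1 J2 : Ideal S} {n : ℕ} (h : J1 * J2 ≤ J) (h1 : chD J1 n) (h2 : chD J2 n) :
    chD J n := by
  intro l hl
  rcases (Ideal.IsPrime.mul_le l.head.2).1 (h.trans hl) with h3 | h3
  · exact h1 l h3
  · exact h2 l h3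

lemma chD_top (n : ℕ) : chD (⊤ : Ideal S) n := by
  intro l hl
  exact absurd (top_le_iff.1 hl) l.head.2.ne_top

lemma chD_step [IsLocalRing S] [IsNoetherianRing S] {J : Ideal S} {x : S} (hx : x ∈ maximalIdeal S)
    {n : ℕ} (h : chD (J ⊔ Ideal.span {x}) n) : chD J (n+1) := by
  by_cases hJ : J = ⊤
  · subst hJ; exact chD_top _
  have : Nontrivial (S ⧸ J) := Ideal.Quotient.nontrivial_iff.2 hJ
  have : IsLocalRing (S ⧸ J) := IsLocalRing.of_surjective' (Ideal.Quotient.mk J)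
    Ideal.Quotient.mk_surjective
  have hx' : Ideal.Quotient.mk J x ∈ maximalIdeal (S ⧸ J) := by
    rw [mem_maximalIdeal, mem_nonunits_iff]
    intro hu
    obtain ⟨y, hy⟩ := hu.exists_right_inv
    obtain ⟨y, rfl⟩ := Ideal.Quotient.mk_surjective y
    rw [← map_mul, ← map_one (Ideal.Quotient.mk J), Ideal.Quotient.eq] at hy
    have h1 := sub_mem (Ideal.mul_mem_right y _ hx) ((le_maximalIdeal hJ) hy)
    rw [sub_sub_cancel] at h1
    exact (Ideal.ne_top_iff_one _).1 (Ideal.IsPrime.ne_top inferInstance) h1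
  have h1 := ringKrullDim_le_ringKrullDim_quotSMulTop_succ hx'
  have h2 := dim_of_chD h
  set Q := (Ideal.Quotient.mk J x) • (⊤ : Ideal (S ⧸ J))
  let φ : S ⧸ (J ⊔ Ideal.span {x}) →+* (S ⧸ J) ⧸ Q :=
    Ideal.Quotient.lift _ ((Ideal.Quotient.mk Q).comp (Ideal.Quotient.mk J)) (by
      intro y hy
      obtain ⟨u, hu, w, hw, rfl⟩ := Submodule.mem_sup.1 hy
      obtain ⟨c, rfl⟩ := Ideal.mem_span_singleton.1 hw
      rw [RingHom.comp_apply, Ideal.Quotient.eq_zero_iff_mem, map_add,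
        Ideal.Quotient.eq_zero_iff_mem.2 hu, zero_add, map_mul]
      exact Submodule.smul_mem_pointwise_smul _ _ _ (Submodule.mem_top (x := Ideal.Quotient.mk J c)))
  have hφ : Function.Surjective φ := by
    intro y
    obtain ⟨y, rfl⟩ := Ideal.Quotient.mk_surjective y
    obtain ⟨y, rfl⟩ := Ideal.Quotient.mk_surjective y
    exact ⟨Ideal.Quotient.mk _ y, rfl⟩
  have h3 := ringKrullDim_le_of_surjective φ hφ
  refine chD_of_dim (h1.trans ?_)
  push_cast
  gcongr
  exact h3.trans h2

lemma chD_surj {T : Type u} [CommRing T] (φ : T →+* S) (K : Ideal T) (J : Ideal S)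
    (hK : ∀ x ∈ K, φ x ∈ J) (hs : ∀ y : S, ∃ x, y - φ x ∈ J) {n : ℕ} (h : chD K n) : chD J n := by
  let ψ : T ⧸ K →+* S ⧸ J := Ideal.Quotient.lift _ ((Ideal.Quotient.mk J).comp φ)
    (fun x hx => Ideal.Quotient.eq_zero_iff_mem.2 (hK x hx))
  have hψ : Function.Surjective ψ := by
    intro y
    obtain ⟨y, rfl⟩ := Ideal.Quotient.mk_surjective y
    obtain ⟨x, hx⟩ := hs y
    exact ⟨Ideal.Quotient.mk _ x, ((Ideal.Quotient.eq).2 hx).symm⟩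
  exact chD_of_dim ((ringKrullDim_le_of_surjective ψ hψ).trans (dim_of_chD h))

lemma mk_sub_mem {L : Type u} [CommRing L] [Algebra S L] {W : Submonoid S} [IsLocalization W L]
    (J : Ideal S) (f c : S) (s : W) (h : f - s.1 * c ∈ J) :
    IsLocalization.mk' L f s - algebraMap S L c ∈ J.map (algebraMap S L) := by
  have hu := IsLocalization.map_units L s
  rw [← (Ideal.unit_mul_mem_iff_mem _ hu), mul_sub, mul_comm, IsLocalization.mk'_spec,
    ← map_mul, ← map_sub]
  exact Ideal.mem_map_of_mem _ h

end ChainDim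

section ReesDim

open IsLocalRing Polynomial

variable {R : Type u} [CommRing R] [IsLocalRing R] [IsNoetherianRing R] {I : Ideal R} {d g ℓ : ℕ}
  {a : ℕ → I}

lemma chD_KK (H : CoreHyp R I (fun k => (a k : R)) d g ℓ) {i c : ℕ} (hi : i ≤ ℓ) (hc : i + c = d) :
    chD (KK (fun k => (a k : R)) I i) c := by
  intro l hl
  have h1 := H.height_K hi l.head.asIdeal l.head.2 hl
  have h2 := height_add_coheight_le H.G.dim l.head
  have h3 := Order.length_le_coheight_head (p := l)
  have h4 : (i : ℕ∞) + l.length ≤ d := (add_le_add h1 h3).trans h2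
  have h5 : i + l.length ≤ d := by exact_mod_cast h4
  omega

lemma KK_ne_top_le (H : CoreHyp R I (fun k => (a k : R)) d g ℓ) {i : ℕ} (hi : i ≤ ℓ)
    (h : KK (fun k => (a k : R)) I i ≠ ⊤) : i ≤ d := by
  have h1 := H.height_K hi _ inferInstance (le_maximalIdeal h)
  have h2 := height_add_coheight_le H.G.dim (closedPoint R)
  have : (i : ℕ∞) ≤ d := h1.trans (le_self_add.trans h2)
  exact_mod_cast this

abbrev LM (I : Ideal R) := Localization.AtPrime (MM I)

instance LM_noeth : IsNoetherianRing (LM I) :=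
  IsLocalization.isNoetherianRing (MM I).primeCompl _ inferInstance

lemma chD_calE (K : Ideal R) {n : ℕ} (h : chD K n) :
    chD ((calE I K).map (algebraMap (reesAlgebra I) (LM I))) n := by
  have hE : ∀ f : reesAlgebra I, f - algebraMap R _ (f.1.coeff 0) ∈ calE I K := by
    intro f
    rw [mem_calE]
    change (f.1 - C (f.1.coeff 0)).coeff 0 ∈ K
    simp
  refine chD_surj ((algebraMap (reesAlgebra I) (LM I)).comp (algebraMap R (reesAlgebra I))) K _ ?_ ?_ h
  · intro x hx
    refine Ideal.mem_map_of_mem _ ?_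
    rw [mem_calE]
    change (C x).coeff 0 ∈ K
    rwa [coeff_C_zero]
  · intro y
    obtain ⟨f, s, rfl⟩ := IsLocalization.exists_mk'_eq (MM I).primeCompl y
    have hs : IsUnit (s.1.1.coeff 0) := by
      by_contra hn
      exact s.2 ((mem_MM).2 hn)
    obtain ⟨t, ht⟩ := hs.exists_right_inv
    refine ⟨f.1.coeff 0 * t, ?_⟩
    refine mk_sub_mem (calE I K) f _ s ?_
    rw [mem_calE]
    change (f.1 - s.1.1 * C (f.1.coeff 0 * t)).coeff 0 ∈ K
    have : (f.1 - s.1.1 * C (f.1.coeff 0 * t)).coeff 0 = 0 := by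
      rw [coeff_sub, mul_coeff_zero, coeff_C_zero, mul_left_comm, ht, mul_one, sub_self]
    rw [this]; exact zero_mem _

lemma dim_step (H : CoreHyp R I (fun k => (a k : R)) d g ℓ) (hJ : I ≤ JJ (fun k => (a k : R)) ℓ) :
    ∀ j i, i + j = ℓ → ∀ c, i + c = d + 1 →
      chD ((cK a i).map (algebraMap (reesAlgebra I) (LM I))) c := by
  intro j
  have htop : ∀ i, KK (fun k => (a k : R)) I i = ⊤ → ∀ c,
      chD ((cK a i).map (algebraMap (reesAlgebra I) (LM I))) c := by
    intro i hi c
    have : cK a i = ⊤ := by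
      rw [eq_top_iff]; intro f _ n; rw [hi]; trivial
    rw [this, Ideal.map_top]
    exact chD_top c
  induction j with
  | zero =>
    intro i hi c hc
    obtain rfl : i = ℓ := by omega
    exact htop _ (KK_top hJ) c
  | succ j ih =>
    intro i hi c hc
    by_cases hK : KK (fun k => (a k : R)) I i = ⊤
    · exact htop i hK c
    have hid := KK_ne_top_le H (by omega) hK
    obtain ⟨c, rfl⟩ : ∃ b, c = b + 1 := ⟨c - 1, by omega⟩
    have hx : algebraMap _ (LM I) (tL I (a i)) ∈ maximalIdeal (LM I) := by
      rw [IsLocalization.AtPrime.to_map_mem_maximal_iff (LM I) (MM I)]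
      rw [mem_MM, tL_val, coeff_monomial]; simp
    refine chD_step hx ?_
    have h1 := chD_calE (I := I) _ (chD_KK H (i := i) (by omega) (c := c) (by omega))
    have h2 := ih (i+1) (by omega) c (by omega)
    refine chD_union ?_ h1 h2
    rw [← Ideal.map_mul, ← Set.image_singleton, ← Ideal.map_span, ← Ideal.map_sup]
    refine Ideal.map_mono ?_
    rw [Ideal.mul_le]
    intro f hf h hh
    refine mem_cL H hJ (by omega) (Ideal.mul_mem_left _ _ hh) ?_
    change (f.1 * h.1).coeff 0 ∈ _
    rw [mul_coeff_zero]
    exact Ideal.mul_mem_right _ _ hf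

lemma dim_LM (H : CoreHyp R I (fun k => (a k : R)) d g ℓ) (hJ : I ≤ JJ (fun k => (a k : R)) ℓ) :
    ringKrullDim (LM I) ≤ ((d + 1 : ℕ) : WithBot ℕ∞) := by
  have h := dim_step H hJ ℓ 0 (by omega) (d+1) (by omega)
  refine iSup_le fun l => ?_
  have h1 := h l (by rw [cK_zero H, Ideal.map_bot]; exact bot_le)
  exact_mod_cast h1

end ReesDim

-- Part 16
section CMbasic

open IsLocalRing Pointwise RingTheory.Sequence

/-- Cohen–Macaulay local ring (internal version) -/
def CMl (L : Type u) [CommRing L] [IsLocalRing L] : Prop :=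
  ∃ d : ℕ, ringKrullDim L = d ∧ dp L L d

lemma dim_fin (L : Type u) [CommRing L] [IsLocalRing L] [IsNoetherianRing L] :
    ∃ d : ℕ, ringKrullDim L = d := by
  rw [← maximalIdeal_height_eq_ringKrullDim]
  have h : (maximalIdeal L).height ≠ ⊤ := Ideal.height_ne_top (Ideal.IsPrime.ne_top inferInstance)
  obtain ⟨n, hn⟩ := ENat.ne_top_iff_exists.1 h
  exact ⟨n, by rw [← hn]; rfl⟩

lemma CMl_of_le {L : Type u} [CommRing L] [IsLocalRing L] [IsNoetherianRing L] {n : ℕ}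
    (h1 : ringKrullDim L ≤ n) (h2 : dp L L n) : CMl L := by
  obtain ⟨d, hd⟩ := dim_fin L
  refine ⟨d, hd, dp_mono ?_ h2⟩
  rw [hd] at h1
  exact_mod_cast h1

section Loc

variable {A L : Type u} [CommRing A] [CommRing L] [Algebra A L] [IsNoetherianRing A]
  (P : Ideal A) [P.IsPrime] [IsLocalization.AtPrime L P]

lemma XV_loc0 [IsLocalRing L] (h : XV A (A ⧸ P) A 0) : XV L (L ⧸ maximalIdeal L) L 0 := by
  refine XV0_of_hom (subsingleton_of_forall_eq 0 fun φ => ?_)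
  have hy : ∀ m ∈ P, algebraMap A L m * φ 1 = 0 := by
    intro m hm
    rw [← smul_eq_mul, ← map_smul]
    have : (algebraMap A L m) • (1 : L ⧸ maximalIdeal L) = 0 := by
      change Ideal.Quotient.mk _ (algebraMap A L m * 1) = 0
      rw [mul_one, Ideal.Quotient.eq_zero_iff_mem,
        IsLocalization.AtPrime.to_map_mem_maximal_iff L P]
      exact hm
    rw [this, map_zero]
  obtain ⟨b, s, hbs⟩ := IsLocalization.exists_mk'_eq P.primeCompl (φ 1)
  have hb : ∀ m ∈ P, ∃ t : P.primeCompl, t.1 * (m * b) = 0 := by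
    intro m hm
    have h1 := hy m hm
    rw [← hbs, mul_comm] at h1
    have h2 : algebraMap A L (m * b) = 0 := by
      rw [map_mul, ← IsLocalization.mk'_spec L b s]
      linear_combination (algebraMap A L s.1) * h1
    obtain ⟨t, ht⟩ := (IsLocalization.map_eq_zero_iff P.primeCompl L _).1 h2
    exact ⟨t, ht⟩
  have hex : ∃ t : P.primeCompl, ∀ m ∈ P, t.1 * (m * b) = 0 := by
    obtain ⟨F, hF⟩ := (isNoetherian_def.1 ‹_› P : P.FG)
    classical
    choose! t ht using hb
    refine ⟨∏ x ∈ F, t x, ?_⟩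
    intro m hm
    rw [← hF] at hm
    induction hm using Submodule.span_induction with
    | mem x hx =>
      have hxP : x ∈ P := by rw [← hF]; exact Submodule.subset_span hx
      rw [← Finset.prod_erase_mul _ _ hx, Submonoid.coe_mul, mul_assoc, ht x hxP, mul_zero]
    | zero => simp
    | add x y _ _ h1 h2 => rw [add_mul, mul_add, h1, h2, add_zero]
    | smul c x _ h1 =>
      rw [smul_eq_mul]
      linear_combination c * h1
  obtain ⟨t, ht⟩ := hex
  let ψ : (A ⧸ P) →ₗ[A] A := Submodule.liftQ P (LinearMap.toSpanSingleton A A (t.1 * b)) (by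
    intro m hm
    rw [LinearMap.mem_ker, LinearMap.toSpanSingleton_apply, smul_eq_mul]
    linear_combination ht m hm)
  have h0 : ψ = 0 := mk0_inj (Subsingleton.elim (h := h) _ _)
  have h1 : t.1 * b = 0 := by
    have := LinearMap.congr_fun h0 (Ideal.Quotient.mk P 1)
    change LinearMap.toSpanSingleton A A (t.1 * b) 1 = 0 at this
    simpa using this
  have h2 : φ 1 = 0 := by
    rw [← hbs, IsLocalization.mk'_eq_zero_iff]
    exact ⟨t, h1⟩
  refine LinearMap.ext fun z => ?_
  obtain ⟨z, rfl⟩ := Ideal.Quotient.mk_surjective z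
  have : Ideal.Quotient.mk (maximalIdeal L) z = z • 1 := by
    change _ = Ideal.Quotient.mk _ (z * 1)
    rw [mul_one]
  rw [this, map_smul, h2, smul_zero]; rfl

lemma dp_loc [IsLocalRing L] {n : ℕ} (h : dpA P A n) : dp L L n := by
  have : IsNoetherianRing L := IsLocalization.isNoetherianRing P.primeCompl L inferInstance
  have : Module.Flat A L := IsLocalization.flat L P.primeCompl
  rintro (_ | i) hi
  · exact XV_loc0 P (h 0 hi)
  · have h1 := XV_baseChange (R' := L) i (A ⧸ P) (h _ hi)
    refine XV_congr_left ?_ h1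
    have e := (Algebra.TensorProduct.quotIdealMapEquivTensorQuot L P).symm.toLinearEquiv
    exact e.trans (Submodule.quotEquivOfEq _ _ (IsLocalization.AtPrime.map_eq_maximalIdeal P L))

end Loc

lemma CMl_loc {L L' : Type u} [CommRing L] [IsLocalRing L] [IsNoetherianRing L] [CommRing L']
    [IsLocalRing L'] [Algebra L L'] (q : Ideal L) [q.IsPrime] [IsLocalization.AtPrime L' q]
    (h : CMl L) : CMl L' := by
  have : IsNoetherianRing L' := IsLocalization.isNoetherianRing q.primeCompl L' inferInstance
  obtain ⟨d, hd, hdp⟩ := h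
  let Q : PrimeSpectrum L := ⟨q, inferInstance⟩
  have h1 := height_add_coheight_le hd Q
  have h2 := coheight_le_dim hd Q
  obtain ⟨c, hc⟩ := ENat.ne_top_iff_exists.1 (ne_top_of_le_ne_top (ENat.natCast_ne_top d) h2)
  rw [← hc] at h1 h2
  have hcd : c ≤ d := by exact_mod_cast h2
  have hdim : dimLE L (L ⧸ q) c := by
    intro p hp
    rw [Ideal.annihilator_quotient] at hp
    rw [hc]
    exact Order.coheight_anti (show Q ≤ p from hp)
  refine CMl_of_le (n := d - c) ?_ (dp_loc q (fun j hj => ischebeck hdp hdim (by omega)))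
  rw [IsLocalization.AtPrime.ringKrullDim_eq_height q L']
  have h3 : q.height ≠ ⊤ := Ideal.height_ne_top (Ideal.IsPrime.ne_top inferInstance)
  obtain ⟨m, hm⟩ := ENat.ne_top_iff_exists.1 h3
  change q.height + _ ≤ _ at h1
  rw [← hm] at h1 ⊢
  have : m + c ≤ d := by exact_mod_cast h1
  have h5 : m ≤ d - c := by omega
  exact WithBot.coe_le_coe.2 (Nat.cast_le.2 h5)

lemma CMl_up {L B : Type u} [CommRing L] [IsLocalRing L] [IsNoetherianRing L] [CommRing B]
    [IsLocalRing B] [IsNoetherianRing B] [Algebra L B] [Module.Flat L B]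
    (hm : (maximalIdeal L).map (algebraMap L B) = maximalIdeal B) (h : CMl L) : CMl B := by
  obtain ⟨d, hd, hdp⟩ := h
  exact ⟨d, by rw [dim_eq hm, hd], dp_baseChange hm.le (IsBaseChange.linearMap L B) hdp⟩

lemma CMl_equiv {L B : Type u} [CommRing L] [IsLocalRing L] [IsNoetherianRing L] [CommRing B]
    [IsLocalRing B] (e : L ≃+* B) (h : CMl L) : CMl B := by
  letI : Algebra L B := e.toRingHom.toAlgebra
  have : IsNoetherianRing B := isNoetherianRing_of_ringEquiv L e
  have : Module.Flat L B := Module.Flat.of_linearEquiv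
    ({ e.symm with
       map_smul' := fun r x => by
        change e.symm (e r * x) = r * e.symm x
        rw [map_mul, e.symm_apply_apply] } : B ≃ₗ[L] L)
  refine CMl_up ?_ h
  have hs : Function.Surjective (algebraMap L B) := e.surjective
  refine IsLocalRing.eq_maximalIdeal ?_
  exact (Ideal.map_eq_top_or_isMaximal_of_surjective _ hs inferInstance).resolve_left fun ht => by
    have h1 : (1 : B) ∈ (maximalIdeal L).map (algebraMap L B) := by rw [ht]; trivial
    obtain ⟨x, hx, hx1⟩ := (Ideal.mem_map_iff_of_surjective _ hs).1 h1
    have : x = 1 := e.injective (hx1.trans (map_one e).symm)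
    rw [this] at hx
    exact (Ideal.ne_top_iff_one _).1 (Ideal.IsPrime.ne_top inferInstance) hx

section Desc

variable {L B : Type u} [CommRing L] [IsLocalRing L] [IsNoetherianRing L] [CommRing B]
    [IsLocalRing B] [IsNoetherianRing B] [Algebra L B] [Module.FaithfullyFlat L B]

lemma dp_desc (hm : (maximalIdeal L).map (algebraMap L B) = maximalIdeal B) (n : ℕ) :
    ∀ (M : Type u) [AddCommGroup M] [Module L M] [Module.Finite L M],
      dp B (B ⊗[L] M) n → dp L M n := by
  induction n with
  | zero => intro M _ _ _ _ i hi; omega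
  | succ n ih =>
    intro M _ _ _ h
    have h1 : dp L M 1 := by
      intro i hi
      obtain rfl : i = 0 := by omega
      refine XV0_of_hom (subsingleton_of_forall_eq 0 fun φ => ?_)
      have hy : ∀ m ∈ maximalIdeal L, m • φ 1 = 0 := by
        intro m hm
        rw [← map_smul]
        have : m • (1 : L ⧸ maximalIdeal L) = 0 := by
          change Ideal.Quotient.mk _ (m * 1) = 0
          rwa [mul_one, Ideal.Quotient.eq_zero_iff_mem]
        rw [this, map_zero]
      let z : B ⊗[L] M := 1 ⊗ₜ φ 1
      let ψ : (B ⧸ maximalIdeal B) →ₗ[B] (B ⊗[L] M) :=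
        Submodule.liftQ _ (LinearMap.toSpanSingleton B _ z) (by
          rw [← hm, Ideal.map, Submodule.span_le]
          rintro _ ⟨m, hm', rfl⟩
          rw [SetLike.mem_coe, LinearMap.mem_ker, LinearMap.toSpanSingleton_apply,
            algebraMap_smul]
          change m • ((1 : B) ⊗ₜ[L] φ 1) = 0
          rw [← TensorProduct.tmul_smul, hy m hm', TensorProduct.tmul_zero])
      have hψ : ψ = 0 := Subsingleton.elim (h := hom_of_XV0 (h 0 (by omega))) _ _
      have hz : z = 0 := by
        have := LinearMap.congr_fun hψ (Ideal.Quotient.mk _ 1)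
        change LinearMap.toSpanSingleton B _ z 1 = 0 at this
        simpa using this
      have h2 : φ 1 = 0 := by
        apply Module.FaithfullyFlat.tensorProduct_mk_injective (A := L) (B := B) M
        change z = _
        rw [hz, map_zero]
      refine LinearMap.ext fun w => ?_
      obtain ⟨w, rfl⟩ := Ideal.Quotient.mk_surjective w
      have : Ideal.Quotient.mk (maximalIdeal L) w = w • 1 := by
        change _ = Ideal.Quotient.mk _ (w * 1)
        rw [mul_one]
      rw [this, map_smul, h2, smul_zero]; rfl
    obtain ⟨x, hx, hreg⟩ := dp_exists_reg h1
    refine dp_of_quot hx hreg (ih _ ?_)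
    have hreg' : IsSMulRegular (B ⊗[L] M) (algebraMap L B x) := by
      have h3 := IsWeaklyRegular.of_flat_of_isBaseChange (S := B)
        (TensorProduct.isBaseChange L M B) (rs := [x])
        ((isWeaklyRegular_singleton_iff M x).2 hreg)
      exact (isWeaklyRegular_singleton_iff _ _).1 h3
    exact dp_congr (QuotSMulTop.algebraMapTensorEquivTensorQuotSMulTop x M B) (dp_quot hreg' h)

lemma CMl_desc (hm : (maximalIdeal L).map (algebraMap L B) = maximalIdeal B) (h : CMl B) :
    CMl L := by
  obtain ⟨d, hd, hdp⟩ := h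
  refine ⟨d, by rw [← dim_eq hm, hd], dp_desc hm d L (dp_congr ?_ hdp)⟩
  exact (TensorProduct.AlgebraTensorModule.rid L B B).symm

end Desc

end CMbasic

-- Part 17
section CMpoly

open IsLocalRing Pointwise RingTheory.Sequence Polynomial

lemma nzd_poly {L : Type u} [CommRing L] [IsLocalRing L] (J : Ideal L) (f : L[X])
    (hf : f ∉ (maximalIdeal L).map C) (h : L[X]) (hfh : f * h ∈ J.map C) : h ∈ J.map C := by
  rw [Ideal.mem_map_C_iff] at hf hfh ⊢
  push Not at hf
  obtain ⟨n, hn⟩ := hf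
  have hu : IsUnit (f.coeff n) := by
    by_contra hc
    exact hn hc
  set q := mapRingHom (Ideal.Quotient.mk J)
  have h1 : q f * q h = 0 := by
    rw [← map_mul]
    ext k
    rw [coe_mapRingHom, coeff_map, coeff_zero, Ideal.Quotient.eq_zero_iff_mem]
    exact hfh k
  have h2 : q f ∈ nonZeroDivisors (L ⧸ J)[X] := by
    rw [Polynomial.mem_nonZeroDivisors_iff]
    intro a ha
    have h3 := congrArg (fun p => coeff p n) ha
    simp only [coeff_smul, coeff_zero, smul_eq_mul] at h3
    have h4 : (q f).coeff n = Ideal.Quotient.mk J (f.coeff n) := by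
      rw [coe_mapRingHom, coeff_map]
    rw [h4] at h3
    exact (hu.map (Ideal.Quotient.mk J)).mul_left_eq_zero.1 h3
  have h5 : q h = 0 := (mem_nonZeroDivisors_iff.1 h2).1 _ h1
  intro k
  have h6 := congrArg (fun p => coeff p k) h5
  simp only [coeff_zero] at h6
  rw [coe_mapRingHom, coeff_map, Ideal.Quotient.eq_zero_iff_mem] at h6
  exact h6

lemma CMl_poly {L B : Type u} [CommRing L] [IsLocalRing L] [IsNoetherianRing L] [CommRing B]
    [IsLocalRing B] (P : Ideal L[X]) [P.IsPrime] [Algebra L[X] B] [IsLocalization.AtPrime B P]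
    (hP : P.comap C = maximalIdeal L) (h : CMl L) : CMl B := by
  have hle : (maximalIdeal L).map C ≤ P := Ideal.map_le_iff_le_comap.2 hP.ge
  by_cases heq : (maximalIdeal L).map C = P
  · subst heq
    refine CMl_equiv (L := Rp L) ?_ (CMl_up (hm_Rp L) h)
    exact (IsLocalization.algEquiv (mC L).primeCompl (Rp L) B).toRingEquiv
  have : IsNoetherianRing B := IsLocalization.isNoetherianRing P.primeCompl B inferInstance
  obtain ⟨f, hfP, hf⟩ := Set.exists_of_ssubset (SetLike.coe_ssubset_coe.2 (lt_of_le_of_ne hle heq))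
  obtain ⟨d, hd, hdp⟩ := h
  obtain ⟨rs, h1, h2, h3⟩ := exists_weaklyRegular d L hdp
  have h4 : IsWeaklyRegular L[X] (rs.map (algebraMap L L[X])) :=
    IsWeaklyRegular.of_flat_of_isBaseChange (IsBaseChange.linearMap L L[X]) h3
  have hJ : Ideal.ofList (rs.map (algebraMap L L[X])) • (⊤ : Submodule L[X] L[X])
      = (Ideal.ofList rs).map C := by
    rw [Ideal.smul_eq_mul, Ideal.mul_top]
    exact (Ideal.map_ofList _ _).symm
  have h5 : IsWeaklyRegular L[X] (rs.map (algebraMap L L[X]) ++ [f]) := by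
    rw [isWeaklyRegular_append_iff]
    refine ⟨h4, (isWeaklyRegular_singleton_iff _ _).2 ?_⟩
    rw [hJ]
    refine isSMulRegular_iff_right_eq_zero_of_smul.2 fun y hy => ?_
    obtain ⟨y, rfl⟩ := Ideal.Quotient.mk_surjective y
    change Ideal.Quotient.mk _ (f * y) = 0 at hy
    rw [Ideal.Quotient.eq_zero_iff_mem] at hy ⊢
    exact nzd_poly _ f hf y hy
  have h6 := IsWeaklyRegular.of_isLocalizedModule B P.primeCompl (Algebra.linearMap L[X] B) h5
  have h7 := dp_of_weaklyRegular _ (by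
    intro r hr
    obtain ⟨s, hs, rfl⟩ := List.mem_map.1 hr
    rw [IsLocalization.AtPrime.to_map_mem_maximal_iff B P]
    rcases List.mem_append.1 hs with hs | hs
    · obtain ⟨t, ht, rfl⟩ := List.mem_map.1 hs
      exact hle (Ideal.mem_map_of_mem _ (h2 t ht))
    · rw [List.mem_singleton.1 hs]; exact hfP) B h6
  rw [List.length_map, List.length_append, List.length_map, h1, List.length_singleton] at h7
  refine CMl_of_le ?_ h7
  rw [IsLocalization.AtPrime.ringKrullDim_eq_height P B]
  refine (Ideal.height_le_ringKrullDim_of_ne_top (Ideal.IsPrime.ne_top inferInstance)).trans ?_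
  rw [Polynomial.ringKrullDim_of_isNoetherianRing, hd]
  exact le_rfl

section Trans

variable {A : Type u} [CommRing A] [IsNoetherianRing A]

lemma loc_loc_CM {L B D : Type u} [CommRing L] [Algebra A L] (W : Submonoid A) [IsLocalization W L]
    (PL : Ideal L) [PL.IsPrime] [CommRing B] [IsLocalRing B] [Algebra L B]
    [IsLocalization.AtPrime B PL]
    (P : Ideal A) [P.IsPrime] (hc : PL.comap (algebraMap A L) = P) [CommRing D] [IsLocalRing D]
    [Algebra A D] [IsLocalization.AtPrime D P] : CMl B ↔ CMl D := by
  have : IsNoetherianRing L := IsLocalization.isNoetherianRing W _ inferInstance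
  have : IsNoetherianRing B := IsLocalization.isNoetherianRing PL.primeCompl _ inferInstance
  have : IsNoetherianRing D := IsLocalization.isNoetherianRing P.primeCompl _ inferInstance
  let : Algebra A B := ((algebraMap L B).comp (algebraMap A L)).toAlgebra
  have : IsScalarTower A L B := IsScalarTower.of_algebraMap_eq' rfl
  have h1 := IsLocalization.isLocalization_isLocalization_atPrime_isLocalization W (S := L) B PL
  have h2 : IsLocalization P.primeCompl B := by
    convert h1
    exact hc.symm
  have e := (IsLocalization.algEquiv P.primeCompl B D).toRingEquiv
  exact ⟨CMl_equiv e, CMl_equiv e.symm⟩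

/-- `A[T]_P` is a localization of `A_p[T]` -/
lemma trans_aux (p : Ideal A) [hp : p.IsPrime] (P : Ideal A[X]) [hPp : P.IsPrime]
    (hP : P.comap C = p) :
    ∃ (PL : Ideal (Localization.AtPrime p)[X]) (_ : PL.IsPrime),
      PL.comap C = maximalIdeal (Localization.AtPrime p) ∧
      PL = P.map (mapRingHom (algebraMap A (Localization.AtPrime p))) ∧
      (CMl (Localization.AtPrime PL) ↔ CMl (Localization.AtPrime P)) := by
  set L := Localization.AtPrime p
  let : Algebra A[X] L[X] := (mapRingHom (algebraMap A L)).toAlgebra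
  have hloc : IsLocalization (Submonoid.map C p.primeCompl) L[X] :=
    Polynomial.isLocalization p.primeCompl L
  have hdis : Disjoint (Submonoid.map (C : A →+* A[X]) p.primeCompl : Set A[X]) (P : Set A[X]) := by
    rw [Set.disjoint_left]
    rintro _ ⟨s, hs, rfl⟩ h2
    apply hs
    rw [← hP]
    exact h2
  set PL := P.map (algebraMap A[X] L[X]) with hPL
  have hprime : PL.IsPrime := IsLocalization.isPrime_of_isPrime_disjoint _ L[X] P hPp hdis
  have hcomap : PL.comap (algebraMap A[X] L[X]) = P :=
    IsLocalization.under_map_of_isPrime_disjoint _ L[X] hPp hdis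
  refine ⟨PL, hprime, ?_, rfl, ?_⟩
  · have h1 : (PL.comap C).IsPrime := Ideal.comap_isPrime _ _
    refine ((maximalIdeal.isMaximal L).eq_of_le h1.ne_top ?_).symm
    rw [← IsLocalization.AtPrime.map_eq_maximalIdeal p L, Ideal.map_le_iff_le_comap]
    intro x hx
    rw [Ideal.mem_comap, Ideal.mem_comap]
    have : (C (algebraMap A L x) : L[X]) = algebraMap A[X] L[X] (C x) := (map_C _).symm
    rw [this]
    refine Ideal.mem_map_of_mem _ ?_
    rw [← hP] at hx
    exact hx
  · exact loc_loc_CM (Submonoid.map C p.primeCompl) PL P hcomap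

lemma CMl_poly_up (p : Ideal A) [hp : p.IsPrime] (P : Ideal A[X]) [hPp : P.IsPrime]
    (hP : P.comap C = p) (h : CMl (Localization.AtPrime p)) : CMl (Localization.AtPrime P) := by
  have : IsNoetherianRing (Localization.AtPrime p) :=
    IsLocalization.isNoetherianRing p.primeCompl _ inferInstance
  obtain ⟨PL, hPL, h1, -, e⟩ := trans_aux p P hP
  have : IsNoetherianRing (Localization.AtPrime PL) :=
    IsLocalization.isNoetherianRing PL.primeCompl _ inferInstance
  exact e.1 (CMl_poly PL h1 h)

lemma CMl_poly_down (p : Ideal A) [hp : p.IsPrime] (P : Ideal A[X]) [hPp : P.IsPrime]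
    (hP : P = p.map C) (h : CMl (Localization.AtPrime P)) : CMl (Localization.AtPrime p) := by
  have : IsNoetherianRing (Localization.AtPrime p) :=
    IsLocalization.isNoetherianRing p.primeCompl _ inferInstance
  have : IsNoetherianRing (Localization.AtPrime P) :=
    IsLocalization.isNoetherianRing P.primeCompl _ inferInstance
  have hPc : P.comap C = p := by
    ext x
    rw [Ideal.mem_comap, hP, Ideal.mem_map_C_iff]
    refine ⟨fun h => by simpa using h 0, fun h n => ?_⟩
    rw [coeff_C]; split_ifs
    · exact h
    · exact zero_mem _
  obtain ⟨PL, hPL, h1, h2, e⟩ := trans_aux p P hPc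
  have hPL' : PL = mC (Localization.AtPrime p) := by
    rw [h2, hP, Ideal.map_map, mC, ← IsLocalization.AtPrime.map_eq_maximalIdeal p, Ideal.map_map]
    congr 1
    ext x
    simp
  subst hPL'
  have h3 := e.2 h
  exact CMl_desc (B := Rp (Localization.AtPrime p)) (hm_Rp _) h3

/-- localizing a CM localization further -/
lemma CMl_le (p q : Ideal A) [hp : p.IsPrime] [hq : q.IsPrime] (hqp : q ≤ p)
    (h : CMl (Localization.AtPrime p)) : CMl (Localization.AtPrime q) := by
  set L := Localization.AtPrime p
  have : IsNoetherianRing L :=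
    IsLocalization.isNoetherianRing p.primeCompl _ inferInstance
  have hdis : Disjoint (p.primeCompl : Set A) (q : Set A) := by
    rw [Set.disjoint_left]
    intro s hs h2
    exact hs (hqp h2)
  set QL := q.map (algebraMap A L) with hQL
  have hprime : QL.IsPrime := IsLocalization.isPrime_of_isPrime_disjoint _ L q hq hdis
  have hcomap : QL.comap (algebraMap A L) = q :=
    IsLocalization.under_map_of_isPrime_disjoint _ L hq hdis
  exact (loc_loc_CM p.primeCompl QL q hcomap).1 (CMl_loc (L' := Localization.AtPrime QL) QL h)

end Trans

end CMpoly

-- Part 18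
section CMAsm

open IsLocalRing Pointwise Polynomial

lemma isLoc_sigma {S0 S1 B : Type u} [CommRing S0] [CommRing S1] [CommRing B] [Algebra S1 B]
    [Algebra S0 B] (σ : S0 →+* S1) (hσ : Function.Injective σ)
    (hcomp : ∀ x, algebraMap S0 B x = algebraMap S1 B (σ x))
    (P : Ideal S1) [P.IsPrime] [IsLocalization.AtPrime B P] (t : S0) (ht : σ t ∉ P)
    (hsurj : ∀ u : S1, ∃ (N : ℕ) (f : S0), σ t ^ N * u = σ f) :
    IsLocalization.AtPrime B (P.comap σ) where
  map_units := by
    rintro ⟨s, hs⟩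
    rw [hcomp]
    exact IsLocalization.map_units B (⟨σ s, hs⟩ : P.primeCompl)
  surj := by
    intro b
    obtain ⟨⟨v, s, hs⟩, h⟩ := IsLocalization.surj P.primeCompl b
    obtain ⟨N, f, hf⟩ := hsurj v
    obtain ⟨M, g, hg⟩ := hsurj s
    refine ⟨⟨f * t ^ M, g * t ^ N, ?_⟩, ?_⟩
    · change σ (g * t ^ N) ∉ P
      rw [map_mul, map_pow, ← hg]
      intro hm
      rcases Ideal.IsPrime.mem_or_mem ‹_› hm with h1 | h1
      · rcases Ideal.IsPrime.mem_or_mem ‹_› h1 with h2 | h2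
        · exact ht (Ideal.IsPrime.mem_of_pow_mem ‹_› _ h2)
        · exact hs h2
      · exact ht (Ideal.IsPrime.mem_of_pow_mem ‹_› _ h1)
    · change b * algebraMap S0 B (g * t ^ N) = algebraMap S0 B (f * t ^ M)
      change b * algebraMap S1 B s = algebraMap S1 B v at h
      rw [hcomp, hcomp, map_mul σ, map_mul σ, ← hf, ← hg, map_pow σ, map_pow σ]
      simp only [map_mul, ← h]
      ring
  exists_of_eq := by
    intro x y hxy
    rw [hcomp, hcomp] at hxy
    obtain ⟨⟨c, hc⟩, h⟩ := IsLocalization.exists_of_eq (M := P.primeCompl) hxy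
    obtain ⟨N, f, hf⟩ := hsurj c
    refine ⟨⟨f, ?_⟩, hσ ?_⟩
    · change σ f ∉ P
      rw [← hf]
      intro h1
      rcases Ideal.IsPrime.mem_or_mem ‹_› h1 with h2 | h2
      · exact ht (Ideal.IsPrime.mem_of_pow_mem ‹_› _ h2)
      · exact hc h2
    · change c * σ x = c * σ y at h
      rw [map_mul, map_mul, ← hf, mul_assoc, mul_assoc, h]

lemma CMl_sigma {S0 S1 B D : Type u} [CommRing S0] [CommRing S1] [CommRing B] [Algebra S1 B]
    (σ : S0 →+* S1) (hσ : Function.Injective σ)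
    (P : Ideal S1) [P.IsPrime] [IsLocalization.AtPrime B P] (t : S0) (ht : σ t ∉ P)
    (hsurj : ∀ u : S1, ∃ (N : ℕ) (f : S0), σ t ^ N * u = σ f)
    [CommRing D] [Algebra S0 D] (W : Ideal S0) [W.IsPrime] (hW : W = P.comap σ)
    [IsLocalization.AtPrime D W] [IsLocalRing B] [IsLocalRing D] [IsNoetherianRing D]
    (h : CMl D) : CMl B := by
  subst hW
  let : Algebra S0 B := ((algebraMap S1 B).comp σ).toAlgebra
  have := isLoc_sigma σ hσ (fun x => (rfl : algebraMap S0 B x = algebraMap S1 B (σ x))) P t ht hsurj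
  exact CMl_equiv (IsLocalization.algEquiv (P.comap σ).primeCompl D B).toRingEquiv h

lemma CMl_core_abs {A : Type u} [CommRing A] [IsNoetherianRing A] (σ : A[X] →+* A[X])
    (hσ : Function.Injective σ) (hX : σ X = X)
    (hsurj : ∀ u : A[X], ∃ (N : ℕ) (f : A[X]), X ^ N * u = σ f)
    (Q q : Ideal A) [Q.IsPrime] [q.IsPrime] (hq : q = (Q.map C).comap (σ.comp C))
    (h : CMl (Localization.AtPrime q)) : CMl (Localization.AtPrime Q) := by
  have hQ : (Q.map (C : A →+* A[X])).IsPrime := Ideal.isPrime_map_C_of_isPrime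
  have hW : ((Q.map (C : A →+* A[X])).comap σ).IsPrime := Ideal.comap_isPrime _ _
  have h1 := CMl_poly_up q ((Q.map (C : A →+* A[X])).comap σ) (by rw [hq]; rfl) h
  have : IsNoetherianRing (Localization.AtPrime ((Q.map (C : A →+* A[X])).comap σ)) :=
    IsLocalization.isNoetherianRing ((Q.map (C : A →+* A[X])).comap σ).primeCompl _ inferInstance
  refine CMl_poly_down Q (Q.map C) rfl ?_
  refine CMl_sigma σ hσ (Q.map C) X ?_ (by rw [hX]; exact hsurj) _ rfl h1
  rw [hX, Ideal.mem_map_C_iff]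
  intro h2
  have h3 := h2 1
  rw [coeff_X_one] at h3
  exact Ideal.IsPrime.one_notMem ‹_› h3

variable {R : Type u} [CommRing R] (I : Ideal R)

/-- the extended grading map -/
def sg : (reesAlgebra I)[X] →+* (reesAlgebra I)[X] := eval₂RingHom (th I) X

lemma sg_X : sg I X = X := by simp [sg]

lemma sg_C (a : reesAlgebra I) : sg I (C a) = th I a := by simp [sg]

lemma sg_monomial (n : ℕ) (a : reesAlgebra I) : sg I (monomial n a) = th I a * X ^ n := by
  simp [sg]

lemma sg_key (F : (reesAlgebra I)[X]) (n j : ℕ) :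
    ((sg I F).coeff (n + j)).1.coeff n = (F.coeff j).1.coeff n := by
  induction F using Polynomial.induction_on' with
  | add p q hp hq =>
    rw [map_add, coeff_add, coeff_add]
    change (_ + _ : R[X]).coeff n = (_ + _ : R[X]).coeff n
    rw [coeff_add, coeff_add, hp, hq]
  | monomial k a =>
    rw [sg_monomial, coeff_mul_X_pow', coeff_monomial]
    by_cases h : k = j
    · subst h
      rw [if_pos (by omega), if_pos rfl, th_coeff, Nat.add_sub_cancel, hc_val, coeff_monomial,
        if_pos rfl]
    · rw [if_neg h]
      split_ifs with h1
      · rw [th_coeff, hc_val, coeff_monomial, if_neg (by omega)]; rfl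
      · rfl

lemma sg_inj : Function.Injective (sg I) := by
  intro F G h
  ext j : 1
  apply Subtype.ext
  ext n
  rw [← sg_key I F n j, ← sg_key I G n j, h]

lemma sg_surj (F : (reesAlgebra I)[X]) : ∃ (N : ℕ) (f : (reesAlgebra I)[X]), X ^ N * F = sg I f := by
  have hadd : ∀ F G : (reesAlgebra I)[X], (∃ (N : ℕ) (f : (reesAlgebra I)[X]), X ^ N * F = sg I f) →
      (∃ (N : ℕ) (f : (reesAlgebra I)[X]), X ^ N * G = sg I f) →
      ∃ (N : ℕ) (f : (reesAlgebra I)[X]), X ^ N * (F + G) = sg I f := by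
    rintro F G ⟨N, f, hf⟩ ⟨M, g, hg⟩
    refine ⟨N + M, X ^ M * f + X ^ N * g, ?_⟩
    rw [map_add, map_mul, map_mul, map_pow, map_pow, sg_X, ← hf, ← hg]
    ring
  induction F using Polynomial.induction_on' with
  | add p q hp hq => exact hadd p q hp hq
  | monomial k a =>
    rw [← sum_hc a, map_sum]
    refine Finset.sum_induction _ (fun F => ∃ (N : ℕ) (f : (reesAlgebra I)[X]), X ^ N * F = sg I f)
      hadd ⟨0, 0, by rw [map_zero, mul_zero]⟩ ?_
    intro n _
    refine ⟨n, monomial k (hc a n), ?_⟩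
    rw [sg_monomial]
    have : th I (hc a n) = monomial n (hc a n) := by
      ext m : 1
      rw [th_coeff, coeff_monomial]
      apply Subtype.ext
      rw [hc_val, hc_val, coeff_monomial]
      split_ifs with h
      · rw [hc_val, h]
      · simp
    rw [this, ← C_mul_X_pow_eq_monomial, ← C_mul_X_pow_eq_monomial]
    ring

lemma CMl_of_core [IsNoetherianRing (reesAlgebra I)] (Q : Ideal (reesAlgebra I)) [Q.IsPrime]
    [(core Q).IsPrime]
    (h : CMl (Localization.AtPrime (core Q))) : CMl (Localization.AtPrime Q) := by
  refine CMl_core_abs (sg I) (sg_inj I) (sg_X I) (sg_surj I) Q (core Q) ?_ h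
  ext f
  rw [Ideal.mem_comap, RingHom.comp_apply, sg_C]
  rfl

end CMAsm

section CMAsm2

open IsLocalRing Pointwise Polynomial

attribute [local instance] algA

variable {R : Type u} [CommRing R] [IsLocalRing R] [IsNoetherianRing R] {I : Ideal R}

lemma CMl_down_abs {A L B : Type u} [CommRing A] [IsNoetherianRing A] [CommRing L] [Algebra A[X] L]
    (W : Submonoid A[X]) [IsLocalization W L] (PL : Ideal L) [PL.IsPrime] [CommRing B]
    [IsLocalRing B] [Algebra L B] [IsLocalization.AtPrime B PL] (p : Ideal A) [p.IsPrime]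
    (hc : PL.comap (algebraMap A[X] L) = p.map C) (h : CMl B) : CMl (Localization.AtPrime p) := by
  have hp : (p.map (C : A →+* A[X])).IsPrime := Ideal.isPrime_map_C_of_isPrime
  have h1 : CMl (Localization.AtPrime (p.map (C : A →+* A[X]))) :=
    (loc_loc_CM W PL (p.map C) hc).1 h
  exact CMl_poly_down p _ rfl h1

lemma CMl_down_MM [IsNoetherianRing (reesAlgebra I)]
    (h : CMl (LM (Ip I))) : CMl (LM I) :=
  CMl_down_abs (SA I) (MM (Ip I)) (MM I) (comap_MM I) h

theorem PreHyp.cm [IsNoetherianRing (reesAlgebra I)] {d g ℓ : ℕ} (H : PreHyp R I d g ℓ)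
    (Q : Ideal (reesAlgebra I)) [Q.IsPrime] :
    CMl (Localization.AtPrime Q) := by
  obtain ⟨a, h1, h2, h3⟩ := H.main.exists_core
  have h4 : CMl (LM (Ip I)) := CMl_of_le (dim_LM h1 h2) (dp_loc (MM (Ip I)) (dpA_rees h1 h2))
  have h5 := CMl_down_MM h4
  have := core_prime Q
  exact CMl_of_core I Q (CMl_le _ _ (core_le_MM Q (Ideal.IsPrime.ne_top ‹_›)) h5)

end CMAsm2

-- Part 19
section Final

open IsLocalRing Pointwise Polynomial RingTheory.Sequence

lemma depth_dp {R : Type u} [CommRing R] [IsLocalRing R] (M : Type u) [AddCommGroup M] [Module R M]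
    (e : ℕ) (h : (e : ℕ∞) ≤ moduleDepth R M) : dp R M e := by
  rcases Nat.eq_zero_or_pos e with rfl | he
  · intro i hi; omega
  have h1 : ∃ n ∈ {n : ℕ∞ | ∃ rs : List R, (rs.length : ℕ∞) = n ∧ (∀ r ∈ rs, r ∈ maximalIdeal R) ∧
      IsRegular M rs}, (e : ℕ∞) ≤ n := by
    by_contra hc
    push Not at hc
    have h2 : moduleDepth R M ≤ ((e - 1 : ℕ) : ℕ∞) := by
      refine sSup_le ?_
      rintro n ⟨rs, rfl, h3⟩
      have := hc _ ⟨rs, rfl, h3⟩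
      have h4 : rs.length < e := by exact_mod_cast this
      exact_mod_cast (by omega : rs.length ≤ e - 1)
    have h3 : e ≤ e - 1 := by exact_mod_cast h.trans h2
    omega
  obtain ⟨n, ⟨rs, rfl, h2, h3⟩, h4⟩ := h1
  have h5 : e ≤ rs.length := by exact_mod_cast h4
  exact dp_mono h5 (dp_of_weaklyRegular rs h2 M h3.toIsWeaklyRegular)

lemma depth_of_CMl {L : Type u} [CommRing L] [IsLocalRing L] [IsNoetherianRing L] (h : CMl L) :
    (moduleDepth L L : WithBot ℕ∞) = ringKrullDim L := by
  obtain ⟨d, hd, hdp⟩ := h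
  rw [hd]
  have : moduleDepth L L = (d : ℕ∞) := by
    apply le_antisymm
    · refine sSup_le ?_
      rintro n ⟨rs, rfl, h2, h3⟩
      by_contra hc
      have h4 : d + 1 ≤ rs.length := by
        by_contra h5
        exact hc (by exact_mod_cast (by omega : rs.length ≤ d))
      exact not_dp_succ hd (dp_mono h4 (dp_of_weaklyRegular rs h2 L h3.toIsWeaklyRegular))
    · obtain ⟨rs, h1, h2, h3⟩ := exists_weaklyRegular d L hdp
      refine le_sSup ⟨rs, by rw [h1], h2, ?_⟩
      exact (IsLocalRing.isRegular_iff_isWeaklyRegular_of_subset_maximalIdeal h2).2 h3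
  rw [this]; rfl

lemma clear_den {R A M M' : Type u} [CommRing R] [CommRing A] [Algebra R A] (S : Submonoid R)
    [IsLocalization S A] [AddCommGroup M] [Module R M] [AddCommGroup M'] [Module R M'] [Module A M']
    [IsScalarTower R A M'] (φ : M →ₗ[R] M') [IsLocalizedModule S φ] {n : ℕ} (g : Fin n → M')
    (hg : Submodule.span A (Set.range g) = ⊤) :
    ∃ b : Fin n → M, ∀ x : M, ∃ r ∈ S, r • x ∈ Submodule.span R (Set.range b) := by
  have h1 : ∀ i, ∃ x : M × S, x.2 • g i = φ x.1 := fun i => IsLocalizedModule.surj S φ (g i)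
  choose w hw using h1
  refine ⟨fun i => (w i).1, fun x => ?_⟩
  set N := Submodule.span R (Set.range fun i => (w i).1)
  have key : ∀ m : M', ∃ r ∈ S, ∃ y ∈ N, r • m = φ y := by
    intro m
    have hm : m ∈ Submodule.span A (Set.range g) := by rw [hg]; trivial
    induction hm using Submodule.span_induction with
    | mem m hm =>
      obtain ⟨i, rfl⟩ := hm
      exact ⟨(w i).2, (w i).2.2, _, Submodule.subset_span ⟨i, rfl⟩, hw i⟩
    | zero => exact ⟨1, one_mem _, 0, zero_mem _, by simp⟩
    | add a b _ _ ha hb =>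
      obtain ⟨r, hr, y, hy, h1⟩ := ha
      obtain ⟨s, hs, z, hz, h2⟩ := hb
      refine ⟨r * s, mul_mem hr hs, s • y + r • z,
        add_mem (N.smul_mem _ hy) (N.smul_mem _ hz), ?_⟩
      rw [map_add, map_smul, map_smul, ← h1, ← h2, smul_add, smul_smul, smul_smul, mul_comm s r]
    | smul c a _ ha =>
      obtain ⟨r, hr, y, hy, h1⟩ := ha
      obtain ⟨⟨c0, s⟩, hc⟩ := IsLocalization.surj S c
      refine ⟨r * s, mul_mem hr s.2, c0 • y, N.smul_mem _ hy, ?_⟩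
      rw [map_smul, ← h1, ← algebraMap_smul A c0, ← hc, ← algebraMap_smul A (r * (s : R)),
        ← algebraMap_smul A r, smul_smul, smul_smul, map_mul]
      congr 1
      ring
  obtain ⟨r, hr, y, hy, h1⟩ := key (φ x)
  rw [← map_smul] at h1
  obtain ⟨c, hc⟩ := (IsLocalizedModule.eq_iff_exists S φ).1 h1
  refine ⟨c * r, mul_mem c.2 hr, ?_⟩
  rw [mul_smul]
  have : (c : R) • r • x = (c : R) • y := hc
  rw [this]
  exact N.smul_mem _ hy

variable {R : Type u} [CommRing R]

lemma genAt_of_minGens [IsLocalRing R] [IsNoetherianRing R] (I p : Ideal R) (hp : p.IsPrime) (h : ℕ)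
    (hm : minGens (Localization (primeCompl' R p hp)) (LocalizedModule (primeCompl' R p hp) ↥I) ≤ h) :
    GenAt I ⊥ p h := by
  have hne : {n | ∃ f : Fin n → LocalizedModule (primeCompl' R p hp) ↥I,
      Submodule.span (Localization (primeCompl' R p hp)) (Set.range f) = ⊤}.Nonempty := by
    have : Module.Finite (Localization (primeCompl' R p hp))
      (LocalizedModule (primeCompl' R p hp) ↥I) :=
      Module.Finite.of_isLocalizedModule (primeCompl' R p hp)
        (LocalizedModule.mkLinearMap (primeCompl' R p hp) ↥I)
    obtain ⟨n, f, hf⟩ := Module.Finite.exists_fin (R := Localization (primeCompl' R p hp))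
      (M := LocalizedModule (primeCompl' R p hp) ↥I)
    exact ⟨n, f, hf⟩
  obtain ⟨f, hf⟩ := Nat.sInf_mem hne
  obtain ⟨b, hb⟩ := clear_den (A := Localization (primeCompl' R p hp)) (primeCompl' R p hp)
    (LocalizedModule.mkLinearMap (primeCompl' R p hp) ↥I) f hf
  refine GenAt_mono (I := I) hm ?_
  have hb2 : ∀ s : Finset R, (∀ x ∈ s, x ∈ I) → ∃ r, r ∉ p ∧ ∀ x ∈ s,
      r * x ∈ Ideal.span (Set.range fun i => (b i : R)) := by
    intro s
    classical
    induction s using Finset.induction_on with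
    | empty => intro _; exact ⟨1, hp.one_notMem, by simp⟩
    | insert x s _ ih =>
      intro hs
      obtain ⟨r, hr, h1⟩ := ih (fun y hy => hs y (by simp [hy]))
      obtain ⟨t, ht, h2⟩ := hb ⟨x, hs x (by simp)⟩
      have h3 : t * x ∈ Ideal.span (Set.range fun i => (b i : R)) := by
        have := Submodule.mem_map_of_mem (f := I.subtype) h2
        rw [Submodule.map_span, ← Set.range_comp] at this
        exact this
      refine ⟨r * t, fun hc => ?_, fun y hy => ?_⟩
      · rcases hp.mem_or_mem hc with h | h
        · exact hr h
        · exact ht h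
      · rcases Finset.mem_insert.1 hy with rfl | hy
        · rw [mul_assoc]; exact Ideal.mul_mem_left _ _ h3
        · rw [mul_comm r t, mul_assoc]; exact Ideal.mul_mem_left _ _ (h1 y hy)
  obtain ⟨s, hs⟩ := IsNoetherian.noetherian I
  obtain ⟨r, hr, h1⟩ := hb2 s (fun x hx => hs ▸ Submodule.subset_span hx)
  refine ⟨r, hr, fun i => b i, fun i => (b i).2, fun x hx => ?_⟩
  rw [bot_sup_eq]
  rw [← hs] at hx
  induction hx using Submodule.span_induction with
  | mem x hx => exact h1 x hx
  | zero => simp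
  | add x y _ _ h2 h3 => rw [mul_add]; exact add_mem h2 h3
  | smul c x _ h2 => rw [smul_eq_mul, mul_left_comm]; exact Ideal.mul_mem_left _ _ h2

lemma localDimAt_eq (p : Ideal R) (hp : p.IsPrime) : localDimAt R p hp = (p.height : WithBot ℕ∞) :=
  IsLocalization.AtPrime.ringKrullDim_eq_height p (Localization.AtPrime p)

variable (I : Ideal R)

/-- the structure map to the Rees algebra -/
def epS : SymModAlg R I →ₐ[R] reesAlgebra I :=
  Ideal.Quotient.liftₐ (Ideal.span (symRels R I)) (MvPolynomial.aeval (tL I)) (by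
    intro a ha
    have : Ideal.span (symRels R I) ≤ RingHom.ker (MvPolynomial.aeval (R := R) (tL I)) := by
      rw [Ideal.span_le]
      rintro a (⟨x, y, rfl⟩ | ⟨r, x, rfl⟩)
      · rw [SetLike.mem_coe, RingHom.mem_ker]
        simp
      · rw [SetLike.mem_coe, RingHom.mem_ker]
        simp [Algebra.smul_def]
    exact RingHom.mem_ker.1 (this ha))

/-- the inclusion of `I` into the symmetric algebra -/
def lamS : I →ₗ[R] SymModAlg R I where
  toFun x := Ideal.Quotient.mk _ (MvPolynomial.X x)
  map_add' x y := by
    rw [← map_add, Ideal.Quotient.eq]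
    refine Ideal.subset_span (Or.inl ⟨x, y, by ring⟩)
  map_smul' r x := by
    rw [RingHom.id_apply, ← Ideal.Quotient.mkₐ_eq_mk R, ← map_smul, Ideal.Quotient.mkₐ_eq_mk,
      Ideal.Quotient.eq]
    refine Ideal.subset_span (Or.inr ⟨r, x, ?_⟩)
    rw [MvPolynomial.smul_eq_C_mul]

lemma epS_lamS (x : I) : epS I (lamS I x) = tL I x := by
  exact MvPolynomial.aeval_X (R := R) (tL I) x

lemma epS_surj : Function.Surjective (epS I) := by
  have h1 : (epS I).range = ⊤ := by
    have h2 : (Algebra.adjoin R (Set.range (tL I) : Set (reesAlgebra I))) = ⊤ := by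
      apply Subalgebra.map_injective (f := (reesAlgebra I).val) Subtype.val_injective
      rw [AlgHom.map_adjoin, ← Set.range_comp]
      have h3 : Set.range ((reesAlgebra I).val ∘ tL I) = (Submodule.map (monomial 1) I : Set R[X]) := by
        ext f
        constructor
        · rintro ⟨b, rfl⟩; exact ⟨b, b.2, rfl⟩
        · rintro ⟨b, hb, rfl⟩; exact ⟨⟨b, hb⟩, rfl⟩
      rw [h3, adjoin_monomial_eq_reesAlgebra, Algebra.map_top]
      exact (Subalgebra.range_val _).symm
    rw [eq_top_iff, ← h2]
    apply Algebra.adjoin_le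
    rintro _ ⟨x, rfl⟩
    exact ⟨lamS I x, epS_lamS I x⟩
  intro y
  have : y ∈ (epS I).range := by rw [h1]; trivial
  exact this

lemma gen_abs {M S : Type u} [AddCommGroup M] [Module R M] [CommRing S] [Algebra R S]
    (lam : M →ₗ[R] S) (q : MvPolynomial M R →ₐ[R] S) (hq : Function.Surjective q)
    (hX : ∀ x, q (MvPolynomial.X x) = lam x) (z : S) : z ∈ ⨆ n : ℕ, (LinearMap.range lam) ^ n := by
  obtain ⟨f, rfl⟩ := hq z
  induction f using MvPolynomial.induction_on with
  | C r =>
    refine Submodule.mem_iSup_of_mem 0 ?_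
    rw [pow_zero]
    refine Submodule.mem_one.2 ⟨r, ?_⟩
    exact (AlgHom.commutes q r).symm
  | add p q hp hq => rw [map_add]; exact add_mem hp hq
  | mul_X p x hp =>
    rw [map_mul]
    have h1 : (⨆ n : ℕ, (LinearMap.range lam) ^ n) * LinearMap.range lam ≤
        ⨆ n : ℕ, (LinearMap.range lam) ^ n := by
      rw [Submodule.iSup_mul]
      refine iSup_le (fun n => ?_)
      rw [← pow_succ]
      exact le_iSup (fun n : ℕ => (LinearMap.range lam) ^ n) (n + 1)
    exact h1 (Submodule.mul_mem_mul hp ⟨x, (hX x).symm⟩)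

lemma torsion_le : ∀ z ∈ torsionIdeal R (SymModAlg R I), epS I z = 0 := by
  rintro z ⟨r, hr, hz⟩
  have h1 : r • epS I z = 0 := by rw [← map_smul, hz, map_zero]
  apply Subtype.ext
  ext n
  have h2 : r * (epS I z).1.coeff n = 0 := by
    have h3 : ((r • epS I z : reesAlgebra I) : R[X]).coeff n = 0 := by rw [h1]; rfl
    rw [← h3]
    change _ = (r • (epS I z : R[X])).coeff n
    rw [coeff_smul, smul_eq_mul]
  rw [mul_comm] at h2
  exact (mem_nonZeroDivisors_iff_right.1 hr) _ h2

/-- the map from the frozen Rees algebra -/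
def rhoS : ReesModAlg R I →+* reesAlgebra I :=
  Ideal.Quotient.lift (torsionIdeal R (SymModAlg R I)) (epS I).toRingHom (torsion_le I)

lemma rhoS_surj : Function.Surjective (rhoS I) := by
  intro y
  obtain ⟨z, hz⟩ := epS_surj I y
  exact ⟨Ideal.Quotient.mk _ z, hz⟩

lemma fiber_dim [IsLocalRing R] :
    ringKrullDim (reesAlgebra I ⧸ mA I) ≤ analyticSpread R I := by
  have h1 : fiberIdeal R I ≤ (mA I).comap (rhoS I) := by
    unfold fiberIdeal
    rw [Ideal.map_le_iff_le_comap]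
    intro r hr
    rw [Ideal.mem_comap, Ideal.mem_comap]
    have : rhoS I (algebraMap R (ReesModAlg R I) r) = algebraMap R (reesAlgebra I) r := by
      change epS I (algebraMap R _ r) = _
      rw [AlgHom.commutes]
    rw [this]
    exact Ideal.mem_map_of_mem _ hr
  refine ringKrullDim_le_of_surjective (Ideal.quotientMap (mA I) (rhoS I) h1) ?_
  exact Ideal.quotientMap_surjective (rhoS_surj I)

lemma CMl_ringEquiv {A B : Type u} [CommRing A] [CommRing B] [IsNoetherianRing A] (e : A ≃+* B)
    (h : ∀ (Q : Ideal A) [Q.IsPrime], CMl (Localization.AtPrime Q)) (p : Ideal B) [hp : p.IsPrime] :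
    CMl (Localization.AtPrime p) := by
  have hW : (p.comap e.toRingHom).IsPrime := Ideal.comap_isPrime _ _
  have : IsNoetherianRing (Localization.AtPrime (p.comap e.toRingHom)) :=
    IsLocalization.isNoetherianRing (p.comap e.toRingHom).primeCompl _ inferInstance
  refine CMl_sigma e.toRingHom e.injective p 1 ?_ ?_ (p.comap e.toRingHom) rfl
    (h (p.comap e.toRingHom))
  · rw [map_one]; exact hp.one_notMem
  · intro v
    exact ⟨0, e.symm v, by simp⟩


theorem preHyp_of [IsLocalRing R] [IsNoetherianRing R] {I : Ideal R}
    (hGor : IsGorensteinLocalRing R) (d : ℕ) (hd : ringKrullDim R = (d : WithBot ℕ∞))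
    (g ℓ : ℕ) (hg : idealHeight R I = (g : WithBot ℕ∞)) (hg1 : 1 ≤ g)
    (hl : analyticSpread R ↥I = (ℓ : WithBot ℕ∞))
    (hG : GcondIdeal R I (ℓ + 1))
    (hdepth : ∀ j : ℕ, 1 ≤ j → j + g ≤ ℓ →
      (d + 2 : ℕ∞) ≤ moduleDepth R ↥(I ^ j) + (g : ℕ∞) + (j : ℕ∞)) : PreHyp R I d g ℓ where
  G := by
    have h1 : moduleDepth R R = (d : ℕ∞) := by
      have := hGor.1
      unfold IsCMLocalRing at this
      rw [hd] at this
      exact_mod_cast this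
    obtain ⟨n, hn⟩ := hGor.2
    refine gorL_of_resfield hd (depth_dp R d h1.ge) n ?_
    intro j hj
    obtain ⟨j, rfl⟩ : ∃ i, j = i + 1 := ⟨j - 1, by omega⟩
    exact XV_of_oldExt (hn _ hj)
  hI := by
    intro p hp hIp
    have h1 : idealHeight R I ≤ localDimAt R p hp := sInf_le ⟨p, hp, hIp, rfl⟩
    rw [hg, localDimAt_eq] at h1
    exact_mod_cast h1
  hIm := by
    apply IsLocalRing.le_maximalIdeal
    rintro rfl
    have : {d | ∃ (p : Ideal R) (hp : p.IsPrime), (⊤ : Ideal R) ≤ p ∧ d = localDimAt R p hp} = ∅ := by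
      rw [Set.eq_empty_iff_forall_notMem]
      rintro d ⟨p, hp, h1, -⟩
      exact hp.ne_top (top_le_iff.1 h1)
    unfold idealHeight at hg
    rw [this, sInf_empty] at hg
    have h2 : ((⊤ : ℕ∞) : WithBot ℕ∞) = ((g : ℕ∞) : WithBot ℕ∞) := hg
    have h3 : (⊤ : ℕ∞) = (g : ℕ∞) := by exact_mod_cast h2
    exact ENat.natCast_ne_top g h3.symm
  hg := hg1
  hGen := by
    intro p hIp h hh hle
    have h0 := hG p.asIdeal p.isPrime hIp
    rw [localDimAt_eq, hh] at h0
    have h1 := h0 (by exact_mod_cast (by omega : h + 1 ≤ ℓ + 1))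
    exact genAt_of_minGens I p.asIdeal p.isPrime h (by exact_mod_cast h1)
  hH := by
    intro j h1 h2 e he
    refine depth_dp _ e ?_
    have h3 := hdepth j h1 h2
    have h4 : (e : ℕ∞) + g + j ≤ d + 2 := by exact_mod_cast he
    have h5 := h4.trans h3
    rw [add_assoc, add_assoc] at h5
    have h6 : ((g : ℕ∞) + j) ≠ ⊤ := by exact_mod_cast ENat.natCast_ne_top (g + j)
    exact (WithTop.add_le_add_iff_right h6).1 h5
  hdim := (fiber_dim I).trans hl.le

lemma lin_of_pre [IsLocalRing R] [IsNoetherianRing R] {I : Ideal R} {d g ℓ : ℕ}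
    (H : PreHyp R I d g ℓ) : ∀ z, epS I z = 0 → z = 0 := by
  intro z hz
  refine H.linType (lamS I) ((reesAlgebra I).val.comp (epS I)) ?_ ?_ z ?_
  · intro x
    rw [AlgHom.comp_apply, epS_lamS]; rfl
  · exact gen_abs (lamS I) (Ideal.Quotient.mkₐ R _) (Ideal.Quotient.mkₐ_surjective R _)
      (fun x => rfl)
  · rw [AlgHom.comp_apply, hz]; rfl

end Final

/-- Over a Gorenstein local ring of dimension `d`, an ideal `I` of height
`g ≥ 1` and analytic spread `ℓ` satisfying `G_{ℓ+1}` with `depth I^j ≥ d - g - j + 2` for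
`1 ≤ j ≤ ℓ - g` is of linear type and has Cohen-Macaulay Rees algebra. -/
theorem statement_3 (R : Type u) [CommRing R] [IsLocalRing R] [IsNoetherianRing R]
    (hGor : IsGorensteinLocalRing R) (d : ℕ) (hd : ringKrullDim R = (d : WithBot ℕ∞))
    (I : Ideal R) (g ℓ : ℕ) (hg : idealHeight R I = (g : WithBot ℕ∞)) (hg1 : 1 ≤ g)
    (hl : analyticSpread R ↥I = (ℓ : WithBot ℕ∞))
    (hG : GcondIdeal R I (ℓ + 1))
    (hdepth : ∀ j : ℕ, 1 ≤ j → j + g ≤ ℓ →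
      (d + 2 : ℕ∞) ≤ moduleDepth R ↥(I ^ j) + (g : ℕ∞) + (j : ℕ∞)) :
    IsLinearType R ↥I ∧ IsCMRing (ReesModAlg R ↥I) := by
  have H := preHyp_of hGor d hd g ℓ hg hg1 hl hG hdepth
  have hlin := lin_of_pre H
  refine ⟨?_, ?_⟩
  · unfold IsLinearType
    rw [eq_bot_iff]
    intro z hz
    exact hlin z (torsion_le I z hz)
  · have hinj : Function.Injective (rhoS I) := by
      rw [injective_iff_map_eq_zero]
      intro y hy
      obtain ⟨z, rfl⟩ := Ideal.Quotient.mk_surjective y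
      have h1 : epS I z = 0 := hy
      rw [hlin z h1, map_zero]
    have e : reesAlgebra I ≃+* ReesModAlg R I :=
      (RingEquiv.ofBijective (rhoS I) ⟨hinj, rhoS_surj I⟩).symm
    have hn : IsNoetherianRing (ReesModAlg R I) := isNoetherianRing_of_ringEquiv _ e
    intro p hp
    have hp' : p.IsPrime := hp.isPrime
    have : IsNoetherianRing (Localization.AtPrime p) :=
      IsLocalization.isNoetherianRing p.primeCompl _ hn
    exact depth_of_CMl (CMl_ringEquiv e (fun Q _ => H.cm Q) p)
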